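/- Let Ω ⊆ ℂ be a connected open set (a planar domain, hence a noncompact connected Riemann surface) and let A, B : Ω → Mat(n×n, ℂ) be holomorphic maps that are locally holomorphically similar at every point of Ω, i.e., for every ξ ∈ Ω there exist an open neighborhood U ⊆ Ω of ξ and a holomorphic map H : U → GL(n, ℂ) with B(ζ) = H(ζ)⁻¹ A(ζ) H(ζ) for all ζ ∈ U. Then A and B are globally holomorphically similar on Ω: there exists a holomorphic map H : Ω → GL(n, ℂ) with B(ζ) = H(ζ)⁻¹ A(ζ) H(ζ) for all ζ ∈ Ω. -/

import Mathlib

/-- A matrix-valued map is holomorphic on a set if each entry is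
complex-differentiable on that set. -/
def MatHoloOn {E : Type*} [NormedAddCommGroup E] [NormedSpace ℂ E] {n m : ℕ}
    (f : E → Matrix (Fin n) (Fin m) ℂ) (s : Set E) : Prop :=
  ∀ i j, DifferentiableOn ℂ (fun ζ => f ζ i j) s

namespace PlanarSimilarity

open Set Filter Topology Metric Complex

section PlanarSets

lemma isPreconnected_ball_diff_countable (c : ℂ) (r : ℝ) {S : Set ℂ} (hS : S.Countable) :
    IsPreconnected (ball c r \ S) := by
  rcases le_or_gt r 0 with hr | hr
  · rw [ball_eq_empty.2 hr, empty_sdiff]; exact isPreconnected_empty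
  set e := OpenPartialHomeomorph.univBall (E := ℂ) c r
  have hsrc : e.source = univ := OpenPartialHomeomorph.univBall_source c r
  have htgt : e.target = ball c r := OpenPartialHomeomorph.univBall_target c hr
  have hT : (e ⁻¹' S).Countable := hS.preimage_of_injOn (by
    have := e.injOn; rw [hsrc] at this; exact this.mono (subset_univ _))
  have hpre := (hT.isConnected_compl_of_one_lt_rank (by simp)).isPreconnected
  have := hpre.image e (by
    have := e.continuousOn; rw [hsrc] at this; exact this.mono (subset_univ _))
  convert this using 1
  ext z
  constructor
  · rintro ⟨hz, hzS⟩
    rw [← htgt] at hz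
    exact ⟨e.symm z, by simpa [e.right_inv hz] using hzS, e.right_inv hz⟩
  · rintro ⟨w, hw, rfl⟩
    exact ⟨htgt ▸ e.map_source (hsrc ▸ mem_univ w), hw⟩

lemma dense_compl_countable {S : Set ℂ} (hS : S.Countable) {U : Set ℂ} (hU : IsOpen U)
    (hne : U.Nonempty) : ∃ z ∈ U, z ∉ S := by
  obtain ⟨z, hz, hz'⟩ := (hS.dense_compl ℂ).inter_open_nonempty U hU hne
  exact ⟨z, hz, hz'⟩

lemma IsPreconnected.diff_countable {U : Set ℂ} (hU : IsOpen U) (hpre : IsPreconnected U)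
    {S : Set ℂ} (hS : S.Countable) : IsPreconnected (U \ S) := by
  rcases (U \ S).eq_empty_or_nonempty with h | ⟨a, ha⟩
  · rw [h]; exact isPreconnected_empty
  set C := connectedComponentIn (U \ S) a
  have hCpre : IsPreconnected C := isPreconnected_connectedComponentIn
  suffices U \ S ⊆ C by
    rwa [this.antisymm (connectedComponentIn_subset _ _)]
  have key : ∀ x r, ball x r ⊆ U → (∃ b ∈ ball x r, b ∉ S ∧ b ∈ C) →
      ∀ z ∈ ball x r, z ∉ S → z ∈ C := by
    rintro x r hxr ⟨b, hb, hbS, hbC⟩ z hz hzS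
    have h2 : ball x r \ S ⊆ connectedComponentIn (U \ S) b :=
      (isPreconnected_ball_diff_countable x r hS).subset_connectedComponentIn ⟨hb, hbS⟩
        (sdiff_subset_sdiff_left hxr)
    rw [← connectedComponentIn_eq hbC] at h2
    exact h2 ⟨hz, hzS⟩
  let Q : ℂ → Prop := fun x => ∀ᶠ z in 𝓝 x, z ∉ S → z ∈ C
  have hQ : ∀ x ∈ U, ∀ᶠ y in 𝓝[U] x, (Q x ↔ Q y) := by
    intro x hx
    obtain ⟨r, hr, hxr⟩ := Metric.isOpen_iff.1 hU x hx
    refine mem_nhdsWithin_of_mem_nhds ?_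
    filter_upwards [isOpen_ball.mem_nhds (mem_ball_self hr)] with y hy
    have gen : ∀ y ∈ ball x r, Q y ↔ ∀ z ∈ ball x r, z ∉ S → z ∈ C := by
      intro y hy
      constructor
      · intro h
        obtain ⟨V, hV, hVo, hyV⟩ := _root_.eventually_nhds_iff.1 h
        obtain ⟨b, hb, hbS⟩ := dense_compl_countable hS (hVo.inter isOpen_ball) ⟨y, hyV, hy⟩
        exact key x r hxr ⟨b, hb.2, hbS, hV b hb.1 hbS⟩
      · intro h
        filter_upwards [isOpen_ball.mem_nhds hy] with z hz using h z hz
    rw [gen y hy, gen x (mem_ball_self hr)]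
  have hall := fun y (hy : y ∈ U) => hpre.induction₂ (fun x y => (Q x ↔ Q y)) hQ
    (fun _ _ _ _ _ _ h1 h2 => h1.trans h2) (fun _ _ _ _ h => h.symm) ha.1 hy
  intro y hy
  have hQa : Q a := by
    obtain ⟨r, hr, hxr⟩ := Metric.isOpen_iff.1 hU a ha.1
    filter_upwards [isOpen_ball.mem_nhds (mem_ball_self hr)] with z hz
    exact key a r hxr ⟨a, mem_ball_self hr, ha.2, mem_connectedComponentIn ha⟩ z hz
  exact ((hall y hy.1).1 hQa).self_of_nhds hy.2

/-- A holomorphic function on a preconnected open set that is somewhere nonzero is nonzero on a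
punctured neighbourhood of every point. -/
lemma eventually_ne_zero {U : Set ℂ} (hU : IsOpen U) (hpre : IsPreconnected U) {γ : ℂ → ℂ}
    (hγ : DifferentiableOn ℂ γ U) {z₀ : ℂ} (hz₀ : z₀ ∈ U) (h0 : γ z₀ ≠ 0) {z : ℂ} (hz : z ∈ U) :
    ∀ᶠ w in 𝓝[≠] z, γ w ≠ 0 := by
  have han := hγ.analyticOnNhd hU
  rcases (han z hz).eventually_eq_zero_or_eventually_ne_zero with h | h
  · exact absurd (han.eqOn_zero_of_preconnected_of_eventuallyEq_zero hpre hz h hz₀) h0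
  · exact h

/-- A set with no accumulation point in a compact set `L` meets `L` in a finite set. -/
lemma finite_inter_of_eventually {L S : Set ℂ} (hL : IsCompact L)
    (h : ∀ z ∈ L, ∀ᶠ w in 𝓝[≠] z, w ∉ S) : (L ∩ S).Finite := by
  by_contra hinf
  obtain ⟨x, hxL, hx⟩ := Set.Infinite.exists_accPt_of_subset_isCompact hinf hL inter_subset_left
  have := (accPt_iff_frequently_nhdsNE.1 hx)
  exact this ((h x hxL).mono fun w hw hw' => hw hw'.2)

lemma countable_of_eventually {U S : Set ℂ}
    (h : ∀ z ∈ U, ∀ᶠ w in 𝓝[≠] z, w ∉ S) : (U ∩ S).Countable := by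
  have : DiscreteTopology ↥(U ∩ S) := by
    refine discreteTopology_subtype_iff.2 fun x hx => ?_
    rw [inf_principal_eq_bot]
    filter_upwards [h x hx.1] with w hw hw' using hw hw'.2
  exact Set.countable_coe_iff.1 (countable_of_Lindelof_of_discrete (X := ↥(U ∩ S)))

end PlanarSets

section Laurent
variable {E : Type*} [NormedAddCommGroup E] [NormedSpace ℂ E]

/-- Holomorphic outside the closed disc of radius `r` about `p`, and bounded near infinity. -/
def OuterHolo (f : ℂ → E) (p : ℂ) (r : ℝ) : Prop :=
  DifferentiableOn ℂ f {z | r < dist z p} ∧ ∃ C R₀ : ℝ, ∀ z, R₀ ≤ dist z p → ‖f z‖ ≤ C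

lemma isOpen_lt_dist (p : ℂ) (r : ℝ) : IsOpen {z : ℂ | r < dist z p} :=
  isOpen_lt continuous_const (continuous_id.dist continuous_const)

/-- Moving the centre of the excluded disc. -/
lemma OuterHolo.recenter {f : ℂ → E} {p q : ℂ} {r r' : ℝ} (h : OuterHolo f p r)
    (hr : r + dist q p ≤ r') : OuterHolo f q r' := by
  obtain ⟨h1, C, R₀, h2⟩ := h
  refine ⟨h1.mono fun z hz => ?_, C, R₀ + dist q p, fun z hz => h2 z ?_⟩
  · have := dist_triangle z p q
    rw [dist_comm p q] at this
    simp only [mem_ofPred_eq] at hz ⊢; linarith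
  · have := dist_triangle z p q
    rw [dist_comm p q] at this
    linarith

lemma differentiableAt_cauchyTransform {f : ℂ → E} {p : ℂ} {ρ : ℝ} (hρ : 0 < ρ)
    (hf : ContinuousOn f (sphere p ρ)) {w : ℂ} (hw : w ∉ sphere p ρ) :
    DifferentiableAt ℂ (fun w => ∮ z in C(p, ρ), (z - w)⁻¹ • f z) w := by
  obtain ⟨δ, hδ, hδw⟩ := Metric.isOpen_iff.1 (isClosed_sphere (x := p) (ε := ρ)).isOpen_compl w hw
  obtain ⟨M, hM⟩ := (isCompact_sphere p ρ).exists_bound_of_continuousOn hf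
  have hcm : ∀ t, circleMap p ρ t ∈ sphere p ρ := fun t => circleMap_mem_sphere p hρ.le t
  have hfar : ∀ t, ∀ x ∈ ball w (δ/2), δ / 2 ≤ ‖circleMap p ρ t - x‖ := by
    intro t x hx
    by_contra hlt
    push Not at hlt
    rw [← dist_eq_norm] at hlt
    have : circleMap p ρ t ∈ ball w δ := by
      have := dist_triangle (circleMap p ρ t) x w
      rw [mem_ball] at hx ⊢; linarith
    exact hδw this (hcm t)
  have hne : ∀ t, ∀ x ∈ ball w (δ/2), circleMap p ρ t - x ≠ 0 := fun t x hx h => by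
    have := hfar t x hx; rw [h, norm_zero] at this; linarith
  have hfc : Continuous fun t => f (circleMap p ρ t) :=
    hf.comp_continuous (continuous_circleMap p ρ) hcm
  have hdc : Continuous fun t => deriv (circleMap p ρ) t := by
    simp only [deriv_circleMap]; exact (continuous_circleMap 0 ρ).mul continuous_const
  have hwb : w ∈ ball w (δ/2) := mem_ball_self (by positivity)
  have hcont : ∀ x ∈ ball w (δ/2), Continuous fun t =>
      deriv (circleMap p ρ) t • (circleMap p ρ t - x)⁻¹ • f (circleMap p ρ t) := fun x hx =>
    hdc.smul ((((continuous_circleMap p ρ).sub continuous_const).inv₀ fun t => hne t x hx).smul hfc)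
  have := intervalIntegral.hasDerivAt_integral_of_dominated_loc_of_deriv_le
    (μ := MeasureTheory.volume) (a := 0) (b := 2 * Real.pi) (x₀ := w) (s := ball w (δ/2))
    (F := fun x t => deriv (circleMap p ρ) t • (circleMap p ρ t - x)⁻¹ • f (circleMap p ρ t))
    (F' := fun x t => deriv (circleMap p ρ) t •
      (((circleMap p ρ t - x)^2)⁻¹) • f (circleMap p ρ t))
    (bound := fun _ => |ρ| * (((δ/2)^2)⁻¹ * M))
    (isOpen_ball.mem_nhds hwb)
    (by filter_upwards [isOpen_ball.mem_nhds hwb] with x hx using (hcont x hx).aestronglyMeasurable)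
    ((hcont w hwb).intervalIntegrable _ _)
    (Continuous.aestronglyMeasurable
      (hdc.smul (((((continuous_circleMap p ρ).sub continuous_const).pow 2).inv₀
        fun t => pow_ne_zero 2 (hne t w hwb)).smul hfc)))
    (by
      refine Eventually.of_forall fun t _ x hx => ?_
      rw [norm_smul, norm_smul, norm_inv, norm_pow]
      have h1 : ‖deriv (circleMap p ρ) t‖ = |ρ| := by simp [deriv_circleMap]
      rw [h1]
      have := hfar t x hx
      gcongr
      exact hM _ (hcm t))
    (by simp)
    (by
      refine Eventually.of_forall fun t _ x hx => ?_
      have h := ((hasDerivAt_id x).const_sub (circleMap p ρ t)).inv (hne t x hx)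
      have h2 := (h.smul_const (f (circleMap p ρ t))).const_smul (deriv (circleMap p ρ) t)
      have h3 : - -1 / (circleMap p ρ t - id x) ^ 2 = ((circleMap p ρ t - x) ^ 2)⁻¹ := by
        rw [neg_neg, one_div]; rfl
      rw [h3] at h2
      exact h2)
  exact this.2.differentiableAt

variable [CompleteSpace E]

lemma circleIntegral_inv_sub_eq_zero {p w : ℂ} {ρ : ℝ} (hρ : 0 ≤ ρ) (hw : ρ < dist w p) :
    (∮ z in C(p, ρ), (z - w)⁻¹) = 0 := by
  refine DiffContOnCl.circleIntegral_eq_zero hρ (DifferentiableOn.diffContOnCl_ball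
    (U := {w}ᶜ) ?_ ?_)
  · intro z hz
    exact ((differentiableAt_id.sub_const w).inv (sub_ne_zero.2 hz)).differentiableWithinAt
  · rintro z hz rfl
    exact absurd (mem_closedBall.1 hz) (not_le.2 hw)

/-- Cauchy's integral formula for an annulus. -/
lemma cauchy_annulus {f : ℂ → E} {p : ℂ} {r R ρ₁ ρ₂ : ℝ} (h0 : 0 < ρ₁) (h1 : r < ρ₁)
    (h2 : ρ₂ < R) (hf : DifferentiableOn ℂ f {z | r < dist z p ∧ dist z p < R}) {w : ℂ}
    (hw1 : ρ₁ < dist w p) (hw2 : dist w p < ρ₂) :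
    (2 * Real.pi * I : ℂ) • f w =
      (∮ z in C(p, ρ₂), (z - w)⁻¹ • f z) - ∮ z in C(p, ρ₁), (z - w)⁻¹ • f z := by
  set A := {z : ℂ | r < dist z p ∧ dist z p < R}
  have hA : IsOpen A := (isOpen_lt_dist p r).inter isOpen_ball
  have hwA : w ∈ A := ⟨h1.trans hw1, hw2.trans h2⟩
  have hd := (differentiableOn_dslope (hA.mem_nhds hwA)).2 hf
  have heq := circleIntegral_eq_of_differentiable_on_annulus_off_countable (c := p) h0
    (hw1.trans hw2).le (f := dslope f w) countable_empty
    (hd.continuousOn.mono fun z hz =>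
      ⟨h1.trans_le (not_lt.1 hz.2), (mem_closedBall.1 hz.1).trans_lt h2⟩)
    (fun z hz =>
      hd.differentiableAt (hA.mem_nhds ⟨h1.trans (not_le.1 hz.1.2), lt_trans hz.1.1 h2⟩))
  have hint : ∀ ρ, 0 < ρ → r < ρ → ρ < R → ρ ≠ dist w p →
      (∮ z in C(p, ρ), dslope f w z) =
        (∮ z in C(p, ρ), (z - w)⁻¹ • f z) - (∮ z in C(p, ρ), (z - w)⁻¹) • f w := by
    intro ρ hρ h1 h2 hne
    have hns : ∀ z ∈ sphere p ρ, z - w ≠ 0 := by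
      rintro z hz h; rw [sub_eq_zero] at h; subst h; exact hne (mem_sphere.1 hz).symm
    have hci : ContinuousOn (fun z => (z - w)⁻¹) (sphere p ρ) :=
      (continuousOn_id.sub continuousOn_const).inv₀ hns
    have hfs : ContinuousOn f (sphere p ρ) := hf.continuousOn.mono fun z hz => by
      rw [mem_sphere] at hz; exact ⟨hz ▸ h1, hz ▸ h2⟩
    rw [← circleIntegral.integral_smul_const, ← circleIntegral.integral_sub]
    · refine circleIntegral.integral_congr hρ.le fun z hz => ?_
      rw [dslope_of_ne _ (sub_ne_zero.1 (hns z hz)), slope_def_module, smul_sub]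
    · exact (hci.smul hfs).circleIntegrable hρ.le
    · exact (hci.smul continuousOn_const).circleIntegrable hρ.le
  rw [hint ρ₁ h0 h1 (hw1.trans (hw2.trans h2)) hw1.ne,
    hint ρ₂ (h0.trans (hw1.trans hw2)) (h1.trans (hw1.trans hw2)) h2 hw2.ne',
    circleIntegral_inv_sub_eq_zero h0.le hw1,
    circleIntegral.integral_sub_inv_of_mem_ball (mem_ball.2 hw2), zero_smul, sub_zero] at heq
  rw [← heq]; abel

/-- Laurent splitting. -/
lemma exists_laurent_split {f : ℂ → E} {p : ℂ} {r R R' : ℝ} (hr : 0 ≤ r) (hrR : r < R')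
    (hR : R' < R) (hf : DifferentiableOn ℂ f {z | r < dist z p ∧ dist z p < R}) :
    ∃ f₁ f₂ : ℂ → E, OuterHolo f₁ p r ∧ DifferentiableOn ℂ f₂ (ball p R') ∧
      ∀ z, r < dist z p → dist z p < R' → f z = f₁ z + f₂ z := by
  set ρ := (r + R') / 2 with hρdef
  have hrρ : r < ρ := by linarith
  have hρR : ρ < R' := by linarith
  have hρ : 0 < ρ := by linarith
  have hfs : ∀ s, r < s → s < R → ContinuousOn f (sphere p s) := fun s h1 h2 =>
    hf.continuousOn.mono fun z hz => by rw [mem_sphere] at hz; exact ⟨hz ▸ h1, hz ▸ h2⟩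
  set c : ℂ := (2 * Real.pi * I : ℂ)⁻¹
  have hpi : (2 * Real.pi * I : ℂ) ≠ 0 := by simp [Real.pi_ne_zero, I_ne_zero]
  let g₂ : ℂ → E := fun w => c • ∮ z in C(p, R'), (z - w)⁻¹ • f z
  let g₁ : ℂ → E := fun w => -(c • ∮ z in C(p, ρ), (z - w)⁻¹ • f z)
  have hg₂ : DifferentiableOn ℂ g₂ (ball p R') := fun w hw =>
    ((differentiableAt_cauchyTransform (hρ.trans hρR) (hfs R' hrR hR) (by
      rw [mem_sphere]; exact (mem_ball.1 hw).ne)).const_smul c).differentiableWithinAt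
  have hg₁ : ∀ w, ρ < dist w p → DifferentiableAt ℂ g₁ w := fun w hw =>
    ((differentiableAt_cauchyTransform hρ (hfs ρ hrρ (hρR.trans hR)) (by
      rw [mem_sphere]; exact hw.ne')).const_smul c).neg
  have hsum : ∀ w, ρ < dist w p → dist w p < R' → f w = g₁ w + g₂ w := by
    intro w h1 h2
    have := cauchy_annulus hρ hrρ hR hf h1 h2
    have h3 : f w = c • (2 * Real.pi * I : ℂ) • f w := by
      rw [smul_smul, inv_mul_cancel₀ hpi, one_smul]
    rw [h3, this, smul_sub]; simp only [g₁, g₂]; abel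
  let f₁ : ℂ → E := fun w => if dist w p < R' then f w - g₂ w else g₁ w
  refine ⟨f₁, g₂, ⟨?_, ?_⟩, hg₂, ?_⟩
  · intro w hw
    rw [mem_ofPred_eq] at hw
    refine DifferentiableAt.differentiableWithinAt ?_
    by_cases h : dist w p < R'
    · have : f₁ =ᶠ[𝓝 w] fun w => f w - g₂ w := by
        filter_upwards [isOpen_ball.mem_nhds (mem_ball.2 h)] with z hz
        exact if_pos hz
      refine (DifferentiableAt.sub ?_ ?_).congr_of_eventuallyEq this
      · exact hf.differentiableAt (((isOpen_lt_dist p r).inter isOpen_ball).mem_nhds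
          ⟨hw, h.trans hR⟩)
      · exact hg₂.differentiableAt (isOpen_ball.mem_nhds h)
    · have hw' : ρ < dist w p := hρR.trans_le (not_lt.1 h)
      refine (hg₁ w hw').congr_of_eventuallyEq ?_
      filter_upwards [(isOpen_lt_dist p ρ).mem_nhds hw'] with z hz
      by_cases h : dist z p < R'
      · simp only [f₁, if_pos h, hsum z hz h, add_sub_cancel_right]
      · simp only [f₁, if_neg h]
  · obtain ⟨M, hM⟩ := (isCompact_sphere p ρ).exists_bound_of_continuousOn
      (hfs ρ hrρ (hρR.trans hR))
    refine ⟨‖c‖ * (2 * Real.pi * ρ * M), max R' (ρ + 1), fun z hz => ?_⟩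
    have h1 : ¬ dist z p < R' := not_lt.2 ((le_max_left _ _).trans hz)
    have h2 : ρ + 1 ≤ dist z p := (le_max_right _ _).trans hz
    simp only [f₁, if_neg h1, g₁, norm_neg, norm_smul]
    gcongr
    refine circleIntegral.norm_integral_le_of_norm_le_const hρ.le fun x hx => ?_
    have h3 : 1 ≤ ‖x - z‖ := by
      have := dist_triangle z x p
      rw [mem_sphere.1 hx] at this
      rw [← dist_eq_norm, dist_comm]; linarith
    rw [norm_smul, norm_inv]
    calc ‖x - z‖⁻¹ * ‖f x‖ ≤ 1 * ‖f x‖ := by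
          gcongr; exact inv_le_one_of_one_le₀ h3
      _ ≤ M := by rw [one_mul]; exact hM x hx
  · intro z _ h2
    simp only [f₁, if_pos h2, sub_add_cancel]

end Laurent

section PolePushing
variable {E : Type*} [NormedAddCommGroup E] [NormedSpace ℂ E]

/-- Functions with one pole at `p` can be approximated on `K` by functions whose finitely many
singularities avoid `L`. -/
def PolePush (E : Type*) [NormedAddCommGroup E] [NormedSpace ℂ E] (K L : Set ℂ) (p : ℂ) : Prop :=
  ∀ f : ℂ → E, OuterHolo f p 0 → ∀ ε > 0, ∃ F : Set ℂ, F.Finite ∧ Disjoint F L ∧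
    ∃ g : ℂ → E, DifferentiableOn ℂ g Fᶜ ∧ ∀ z ∈ K, ‖f z - g z‖ ≤ ε

lemma PolePush.of_notMem {K L : Set ℂ} {p : ℂ} (hp : p ∉ L) : PolePush E K L p := by
  intro f hf ε hε
  refine ⟨{p}, finite_singleton p, disjoint_singleton_left.2 hp, f, hf.1.mono fun z hz => ?_, ?_⟩
  · exact dist_pos.2 hz
  · intro z _; simpa using hε.le

variable [CompleteSpace E]

/-- A function holomorphic outside a closed disc and bounded at infinity is uniformly approximable,
off a slightly larger disc, by functions with their only singularity at the centre. -/
lemma OuterHolo.exists_approx {f : ℂ → E} {p : ℂ} {ρ ρ' ε : ℝ} (hρ : 0 ≤ ρ) (hρ' : ρ < ρ')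
    (hε : 0 < ε) (hf : OuterHolo f p ρ) :
    ∃ g : ℂ → E, OuterHolo g p 0 ∧ ∀ z, ρ' ≤ dist z p → ‖f z - g z‖ ≤ ε := by
  obtain ⟨hd, C, R₀, hC⟩ := hf
  obtain ⟨σ, h1, h2⟩ := exists_between hρ'
  obtain ⟨σ₁, h3, h4⟩ := exists_between h2
  obtain ⟨σ₂, h5, h6⟩ := exists_between h4
  have hσ : 0 < σ := hρ.trans_lt h1
  have hσ₁ : 0 < σ₁ := hσ.trans h3
  have hσ₂ : 0 < σ₂ := hσ₁.trans h5
  have hρ'0 : 0 < ρ' := hσ₂.trans h6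
  have hdist : ∀ u : ℂ, dist (p + u⁻¹) p = ‖u‖⁻¹ := fun u => by simp [dist_eq_norm]
  let g₀ : ℂ → E := fun u => f (p + u⁻¹)
  have hmem : ∀ u ∈ ball (0 : ℂ) σ⁻¹ \ {0}, σ < dist (p + u⁻¹) p := by
    rintro u ⟨hu, hu0⟩
    rw [hdist]
    rw [mem_ball_zero_iff] at hu
    have hu0 : 0 < ‖u‖ := norm_pos_iff.2 hu0
    rwa [lt_inv_comm₀ hσ hu0]
  have hg₀ : DifferentiableOn ℂ g₀ (ball 0 σ⁻¹ \ {0}) := by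
    intro u hu
    refine DifferentiableAt.differentiableWithinAt ?_
    refine DifferentiableAt.comp u (hd.differentiableAt ((isOpen_lt_dist p ρ).mem_nhds
      (h1.trans (hmem u hu)))) ?_
    exact (differentiableAt_const p).add (differentiableAt_id.inv hu.2)
  have hbdd : BddAbove (norm ∘ g₀ '' (ball 0 σ⁻¹ \ {0})) := by
    obtain ⟨M, hM⟩ :=
      ((isCompact_closedBall p R₀).diff isOpen_ball (t := ball p σ)).exists_bound_of_continuousOn
      (hd.continuousOn.mono fun z hz => h1.trans_le (not_lt.1 hz.2))
    refine ⟨max C M, ?_⟩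
    rintro _ ⟨u, hu, rfl⟩
    have := hmem u hu
    rcases le_total R₀ (dist (p + u⁻¹) p) with h | h
    · exact (hC _ h).trans (le_max_left _ _)
    · exact (hM _ ⟨h, not_lt.2 this.le⟩).trans (le_max_right _ _)
  have hs : ball (0 : ℂ) σ⁻¹ ∈ 𝓝 0 := isOpen_ball.mem_nhds (mem_ball_self (by positivity))
  have hG := differentiableOn_update_limUnder_of_bddAbove hs hg₀ hbdd
  set G := Function.update g₀ 0 (limUnder (𝓝[≠] 0) g₀)
  have hsub : closedBall (0 : ℂ) σ₁⁻¹ ⊆ ball 0 σ⁻¹ :=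
    closedBall_subset_ball (by gcongr)
  obtain ⟨τ₁, hτ₁⟩ : ∃ τ : NNReal, (τ : ℝ) = σ₁⁻¹ :=
    CanLift.prf (β := NNReal) σ₁⁻¹ (inv_nonneg.2 hσ₁.le)
  obtain ⟨τ₂, hτ₂⟩ : ∃ τ : NNReal, (τ : ℝ) = σ₂⁻¹ :=
    CanLift.prf (β := NNReal) σ₂⁻¹ (inv_nonneg.2 hσ₂.le)
  rw [← hτ₁] at hsub
  have hps := (hG.mono hsub).hasFPowerSeriesOnBall
    (by rw [← NNReal.coe_pos, hτ₁]; positivity)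
  set P := cauchyPowerSeries G 0 τ₁
  have hlim := hps.tendstoUniformlyOn (r' := τ₂) (by
    rw [ENNReal.coe_lt_coe, ← NNReal.coe_lt_coe, hτ₁, hτ₂]; gcongr)
  rw [hτ₂] at hlim
  obtain ⟨n, hn⟩ := (Metric.tendstoUniformlyOn_iff.1 hlim ε hε).exists
  have hPd : Differentiable ℂ fun u => P.partialSum n u := by
    simp only [FormalMultilinearSeries.partialSum, FormalMultilinearSeries.apply_eq_pow_smul_coeff]
    fun_prop
  refine ⟨fun z => P.partialSum n (z - p)⁻¹, ⟨?_, ?_⟩, fun z hz => ?_⟩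
  · intro z hz
    refine DifferentiableAt.differentiableWithinAt ?_
    refine (hPd _).comp z ((differentiableAt_id.sub_const p).inv ?_)
    exact sub_ne_zero.2 (dist_pos.1 hz)
  · obtain ⟨M, hM⟩ := (isCompact_closedBall (0 : ℂ) 1).exists_bound_of_continuousOn
      hPd.continuous.continuousOn
    refine ⟨M, 1, fun z hz => hM _ ?_⟩
    rw [mem_closedBall_zero_iff, norm_inv, ← dist_eq_norm]
    exact inv_le_one_of_one_le₀ hz
  · have hzp : 0 < dist z p := hρ'0.trans_le hz
    have hz0 : (z - p)⁻¹ ≠ 0 := inv_ne_zero (sub_ne_zero.2 (dist_pos.1 hzp))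
    have hzb : (z - p)⁻¹ ∈ ball (0 : ℂ) σ₂⁻¹ := by
      rw [mem_ball_zero_iff, norm_inv, ← dist_eq_norm]
      gcongr
      exact h6.trans_le hz
    have := hn _ hzb
    rw [zero_add, dist_eq_norm] at this
    have hGz : G (z - p)⁻¹ = f z := by
      simp only [G, Function.update_of_ne hz0, g₀, inv_inv, add_sub_cancel]
    rw [hGz] at this
    exact this.le


lemma PolePush.outer {K L : Set ℂ} {q : ℂ} (hq : PolePush E K L q) {r r' : ℝ} (hr0 : 0 ≤ r)
    (hr : r < r') (hK : ∀ z ∈ K, r' ≤ dist z q) {f : ℂ → E} (hf : OuterHolo f q r) {ε : ℝ}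
    (hε : 0 < ε) : ∃ F : Set ℂ, F.Finite ∧ Disjoint F L ∧
    ∃ g : ℂ → E, DifferentiableOn ℂ g Fᶜ ∧ ∀ z ∈ K, ‖f z - g z‖ ≤ ε := by
  obtain ⟨g, hg, hfg⟩ := hf.exists_approx hr0 hr (half_pos hε)
  obtain ⟨F, hF, hFL, k, hk, hgk⟩ := hq g hg (ε / 2) (half_pos hε)
  refine ⟨F, hF, hFL, k, hk, fun z hz => ?_⟩
  calc ‖f z - k z‖ = ‖(f z - g z) + (g z - k z)‖ := by congr 1; abel
    _ ≤ ε / 2 + ε / 2 := (norm_add_le _ _).trans (add_le_add (hfg z (hK z hz)) (hgk z hz))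
    _ = ε := by ring

lemma PolePush.of_connected {K L U : Set ℂ} (hU : IsOpen U) (hpre : IsPreconnected U)
    (hUK : Disjoint U K) (hUL : ¬ U ⊆ L) {p : ℂ} (hp : p ∈ U) : PolePush E K L p := by
  obtain ⟨a, haU, haL⟩ := not_subset.1 hUL
  refine (hpre.induction₂ (fun x y => PolePush E K L x ↔ PolePush E K L y) ?_
    (fun _ _ _ _ _ _ h1 h2 => h1.trans h2) (fun _ _ _ _ h => h.symm) haU hp).1 (.of_notMem haL)
  intro x hx
  obtain ⟨r, hr, hxr⟩ := Metric.isOpen_iff.1 hU x hx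
  have key : ∀ y z, dist z y < r / 4 → ball z (r/2) ⊆ U → PolePush E K L z → PolePush E K L y := by
    intro y z hyz hzU hz f hf ε hε
    refine hz.outer (r := r / 4) (r' := r / 2) (by positivity) (by linarith) ?_
      (hf.recenter (by linarith)) hε
    intro w hw
    by_contra h
    exact hUK.ne_of_mem (hzU (mem_ball.2 (not_le.1 h))) hw rfl
  refine mem_nhdsWithin_of_mem_nhds ?_
  filter_upwards [ball_mem_nhds x (show 0 < r / 4 by positivity)] with y hy
  rw [mem_ball] at hy
  refine ⟨key y x (by rwa [dist_comm]) ((ball_subset_ball (by linarith)).trans hxr) , key x y hy ?_⟩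
  exact (ball_subset_ball' (by linarith)).trans hxr

end PolePushing

section Exhaustion

/-- The standard compact exhaustion of a planar open set. -/
def exhaust (Ω : Set ℂ) (m : ℕ) : Set ℂ :=
  {z | ‖z‖ + 1 ≤ m ∧ ∀ a ∉ Ω, 1 / ((m : ℝ) + 1) ≤ dist z a}

lemma exhaust_zero (Ω : Set ℂ) : exhaust Ω 0 = ∅ := by
  ext z
  simp only [exhaust, mem_ofPred_eq, Nat.cast_zero, mem_empty_iff_false, iff_false, not_and]
  intro h; linarith [norm_nonneg z]

lemma exhaust_subset (Ω : Set ℂ) (m : ℕ) : exhaust Ω m ⊆ Ω := by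
  intro z hz
  by_contra h
  have := hz.2 z h
  rw [dist_self] at this
  have : 0 < 1 / ((m : ℝ) + 1) := by positivity
  linarith

lemma exhaust_mono (Ω : Set ℂ) : Monotone (exhaust Ω) := by
  intro m k hmk z hz
  have : (m : ℝ) ≤ k := by exact_mod_cast hmk
  refine ⟨hz.1.trans this, fun a ha => le_trans ?_ (hz.2 a ha)⟩
  gcongr

lemma isCompact_exhaust (Ω : Set ℂ) (m : ℕ) : IsCompact (exhaust Ω m) := by
  refine (isCompact_closedBall (0 : ℂ) m).of_isClosed_subset ?_ ?_
  · have : exhaust Ω m = {z | ‖z‖ + 1 ≤ m} ∩ ⋂ a ∈ Ωᶜ, {z | 1 / ((m : ℝ) + 1) ≤ dist z a} := by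
      ext z; simp [exhaust]
    rw [this]
    exact (isClosed_le (by fun_prop) continuous_const).inter
      (isClosed_biInter fun a _ => isClosed_le continuous_const (by fun_prop))
  · intro z hz
    rw [mem_closedBall_zero_iff]
    linarith [hz.1]

lemma exists_ball_subset_exhaust {Ω : Set ℂ} (hΩ : IsOpen Ω) {z : ℂ} (hz : z ∈ Ω) :
    ∃ m, ∃ r > 0, ball z r ⊆ exhaust Ω m := by
  obtain ⟨r, hr, hzr⟩ := Metric.isOpen_iff.1 hΩ z hz
  obtain ⟨m, hm⟩ := exists_nat_gt (max (‖z‖ + r + 1) (2 / r))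
  have h1 := (le_max_left _ _).trans hm.le
  have h2 := (le_max_right _ _).trans hm.le
  refine ⟨m, r / 2, by positivity, fun w hw => ⟨?_, fun a ha => ?_⟩⟩
  · have : ‖w‖ ≤ ‖z‖ + dist w z := by
      rw [dist_eq_norm]; simpa using norm_add_le z (w - z)
    rw [mem_ball] at hw; linarith
  · have h3 : r ≤ dist a z := by
      by_contra h; exact ha (hzr (not_le.1 h))
    have h4 := dist_triangle a w z
    rw [mem_ball] at hw
    rw [dist_comm a w] at h4
    have h5 : 1 / ((m : ℝ) + 1) ≤ r / 2 := by
      rw [div_le_div_iff₀ (by positivity) two_pos]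
      rw [div_le_iff₀ hr] at h2
      nlinarith
    linarith

lemma not_connectedComponentIn_subset {Ω : Set ℂ} (hΩ : IsOpen Ω) {m : ℕ} {d : ℂ} (hd : d ∈ Ω)
    (hdK : d ∉ exhaust Ω m) {L : Set ℂ} (hL : IsCompact L) (hLΩ : L ⊆ Ω) :
    ¬ connectedComponentIn (Ω \ exhaust Ω m) d ⊆ L := by
  intro hCL
  set C := connectedComponentIn (Ω \ exhaust Ω m) d
  have hO : IsOpen (Ω \ exhaust Ω m) := hΩ.sdiff (isCompact_exhaust Ω m).isClosed
  have hdC : d ∈ C := mem_connectedComponentIn ⟨hd, hdK⟩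
  have key : ∀ S : Set ℂ, IsPreconnected S → d ∈ S → (∀ z ∈ S, z ∉ exhaust Ω m) → S ⊆ L := by
    intro S hS hdS hSK
    refine (hS.subset_of_closure_inter_subset hO.connectedComponentIn ⟨d, hdS, hdC⟩ ?_).trans hCL
    rintro x ⟨hxC, hxS⟩
    have hx : x ∈ Ω \ exhaust Ω m := ⟨hLΩ (closure_minimal hCL hL.isClosed hxC), hSK x hxS⟩
    obtain ⟨y, hy1, hy2⟩ := mem_closure_iff.1 hxC _ (hO.connectedComponentIn (x := x))
      (mem_connectedComponentIn hx)
    have h1 := connectedComponentIn_eq hy1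
    have h2 := connectedComponentIn_eq hy2
    change x ∈ connectedComponentIn _ d
    rw [h2, ← h1]
    exact mem_connectedComponentIn hx
  by_cases h : ‖d‖ + 1 ≤ m
  · have : ∃ a ∉ Ω, dist d a < 1 / ((m : ℝ) + 1) := by
      by_contra hcon
      push Not at hcon
      exact hdK ⟨h, hcon⟩
    obtain ⟨a, ha, hda⟩ := this
    refine ha (hLΩ (key (segment ℝ d a) (convex_segment d a).isPreconnected
      (left_mem_segment ℝ d a) ?_ (right_mem_segment ℝ d a)))
    intro z hz hzK
    have h1 := hzK.2 a ha
    have h2 : dist z a ≤ dist d a := by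
      have : z ∈ closedBall a (dist d a) :=
        (convex_closedBall a (dist d a)).segment_subset (mem_closedBall.2 le_rfl)
          (mem_closedBall_self dist_nonneg) hz
      exact this
    linarith
  · obtain ⟨u, hu, hdu⟩ : ∃ u : ℂ, ‖u‖ = 1 ∧ d = (‖d‖ : ℂ) * u := by
      by_cases h0 : d = 0
      · exact ⟨1, by simp, by simp [h0]⟩
      · have : (‖d‖ : ℂ) ≠ 0 := by exact_mod_cast norm_ne_zero_iff.2 h0
        exact ⟨d / ‖d‖, by simp [h0], by field_simp⟩
    obtain ⟨R, hR⟩ := hL.isBounded.exists_norm_le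
    have hnorm : ∀ t : ℝ, 0 ≤ t → ‖((‖d‖ + t : ℝ) : ℂ) * u‖ = ‖d‖ + t := fun t ht => by
      rw [norm_mul, hu, mul_one, norm_real, Real.norm_of_nonneg (by positivity)]
    have hS := key ((fun t : ℝ => ((‖d‖ + t : ℝ) : ℂ) * u) '' Ici 0)
      (isPreconnected_Ici.image _ (by fun_prop)) ⟨0, by simp, by simpa using hdu.symm⟩ (by
        rintro _ ⟨t, ht, rfl⟩ hK
        have := hK.1
        simp only [hnorm t ht] at this
        have ht : 0 ≤ t := ht
        linarith)
    have h1 := hR _ (hS ⟨|R| + 1, by simp; positivity, rfl⟩)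
    simp only [hnorm (|R| + 1) (by positivity)] at h1
    linarith [le_abs_self R, norm_nonneg d]

end Exhaustion

section GeneralizedInverse

lemma differentiableOn_det {ι : Type*} [Fintype ι] [DecidableEq ι] {s : Set ℂ}
    {f : ℂ → Matrix ι ι ℂ} (hf : ∀ i j, DifferentiableOn ℂ (fun z => f z i j) s) :
    DifferentiableOn ℂ (fun z => (f z).det) s := by
  simp only [Matrix.det_apply]
  exact DifferentiableOn.fun_sum fun σ _ =>
    (DifferentiableOn.fun_finsetProd fun i _ => hf _ _).const_smul _

lemma differentiableOn_adjugate {ι : Type*} [Fintype ι] [DecidableEq ι] {s : Set ℂ}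
    {f : ℂ → Matrix ι ι ℂ} (hf : ∀ i j, DifferentiableOn ℂ (fun z => f z i j) s) (i j : ι) :
    DifferentiableOn ℂ (fun z => (f z).adjugate i j) s := by
  simp only [Matrix.adjugate_apply]
  refine differentiableOn_det fun k l => ?_
  by_cases h : k = j
  · subst h; simp only [Matrix.updateRow_self]; exact differentiableOn_const _
  · simp only [Matrix.updateRow_ne h]; exact hf k l

section Algebra
variable {F V : Type*} [Field F] [AddCommGroup V] [Module F V] [FiniteDimensional F V]
open Module

lemma exists_complementary_map (T : V →ₗ[F] V) :
    ∃ C : V →ₗ[F] V, IsUnit (T + C) ∧ finrank F (LinearMap.range T) +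
      finrank F (LinearMap.range C) ≤ finrank F V := by
  obtain ⟨W, hW⟩ := (LinearMap.range T).exists_isCompl
  obtain ⟨P, hP⟩ := (LinearMap.ker T).subtype.exists_leftInverse_of_injective
    (LinearMap.ker_eq_bot.2 (Submodule.subtype_injective _))
  have h1 := T.finrank_range_add_finrank_ker
  have h2 := Submodule.finrank_add_eq_of_isCompl hW
  let φ : LinearMap.ker T ≃ₗ[F] W := LinearEquiv.ofFinrankEq _ _ (by omega)
  refine ⟨W.subtype ∘ₗ φ.toLinearMap ∘ₗ P, ?_, ?_⟩
  · rw [LinearMap.isUnit_iff_ker_eq_bot, LinearMap.ker_eq_bot']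
    intro x hx
    simp only [LinearMap.add_apply, LinearMap.comp_apply, LinearEquiv.coe_coe,
      Submodule.subtype_apply] at hx
    have h3 : (φ (P x) : V) ∈ LinearMap.range T :=
      ⟨-x, by rw [map_neg]; exact neg_eq_of_add_eq_zero_right hx⟩
    have h4 : (φ (P x) : V) = 0 := Submodule.disjoint_def.1 hW.disjoint _ h3 (φ (P x)).2
    have h5 : P x = 0 := by simpa using h4
    rw [h4, add_zero] at hx
    have h6 := congrArg (fun f => f ⟨x, hx⟩) hP
    simp only [LinearMap.comp_apply, Submodule.subtype_apply, LinearMap.id_apply, h5] at h6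
    exact (congrArg Subtype.val h6).symm
  · have : LinearMap.range (W.subtype ∘ₗ φ.toLinearMap ∘ₗ P) ≤ W := by
      rintro _ ⟨x, rfl⟩; exact (φ (P x)).2
    have := Submodule.finrank_mono this
    omega

lemma comp_inverse_comp {T C G' : V →ₗ[F] V} (h1 : (T + C) * G' = 1)
    (h : finrank F (LinearMap.range T) + finrank F (LinearMap.range C) ≤ finrank F V) :
    T * G' * T = T := by
  have hdisj : Disjoint (LinearMap.range T) (LinearMap.range C) := by
    have htop : LinearMap.range T ⊔ LinearMap.range C = ⊤ := by
      rw [eq_top_iff]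
      intro x _
      have : x = T (G' x) + C (G' x) := by
        have := congrArg (fun f => f x) h1
        simpa using this.symm
      rw [this]
      exact Submodule.add_mem_sup ⟨_, rfl⟩ ⟨_, rfl⟩
    have h2 := Submodule.finrank_sup_add_finrank_inf_eq (LinearMap.range T) (LinearMap.range C)
    rw [htop, finrank_top] at h2
    rw [disjoint_iff, ← Submodule.finrank_eq_zero (R := F)]
    omega
  ext x
  have h3 : T (G' (T x)) + C (G' (T x)) = T x := by
    have := congrArg (fun f => f (T x)) h1
    simpa using this
  have h4 : C (G' (T x)) = 0 := Submodule.disjoint_def.1 hdisj _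
    ⟨x - G' (T x), by rw [map_sub, sub_eq_iff_eq_add']; exact h3.symm⟩ ⟨_, rfl⟩
  rw [h4, add_zero] at h3
  exact h3
end Algebra

variable {V : Type*} [NormedAddCommGroup V] [NormedSpace ℂ V] [FiniteDimensional ℂ V]

/-- A holomorphic family of endomorphisms has a meromorphic generalized inverse. -/
lemma exists_generalized_inverse {Ω : Set ℂ} (hΩ : IsOpen Ω) (hpre : IsPreconnected Ω)
    (hne : Ω.Nonempty) {T : ℂ → V →L[ℂ] V} (hT : DifferentiableOn ℂ T Ω) :
    ∃ (δ : ℂ → ℂ) (Ψ : ℂ → V →L[ℂ] V), DifferentiableOn ℂ δ Ω ∧ DifferentiableOn ℂ Ψ Ω ∧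
      (∃ z ∈ Ω, δ z ≠ 0) ∧ ∀ z ∈ Ω, T z * Ψ z * T z = δ z • T z := by
  classical
  let b := Module.finBasis ℂ V
  let Λ : (V →L[ℂ] V) ≃ₗ[ℂ] Matrix _ _ ℂ :=
    LinearMap.toContinuousLinearMap.symm ≪≫ₗ LinearMap.toMatrix b b
  have hΛmul : ∀ S S', Λ (S * S') = Λ S * Λ S' := fun S S' => LinearMap.toMatrix_mul b _ _
  have hΛone : Λ 1 = 1 := LinearMap.toMatrix_one b
  -- a point of maximal rank
  let rk : ℂ → ℕ := fun z => Module.finrank ℂ (LinearMap.range (T z : V →ₗ[ℂ] V))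
  obtain ⟨z₀, hz₀, hmax⟩ : ∃ z₀ ∈ Ω, ∀ z ∈ Ω, rk z ≤ rk z₀ := by
    have hfin : (rk '' Ω).Finite := (finite_Iic (Module.finrank ℂ V)).subset (by
      rintro _ ⟨z, _, rfl⟩; exact Submodule.finrank_le _)
    obtain ⟨_, ⟨z₀, hz₀, rfl⟩, hmax⟩ := hfin.exists_maximal (hne.image rk)
    refine ⟨z₀, hz₀, fun z hz => ?_⟩
    by_contra hlt
    exact hlt (hmax ⟨z, hz, rfl⟩ (not_le.1 hlt).le)
  obtain ⟨C, hC, hrk⟩ := exists_complementary_map (T z₀ : V →ₗ[ℂ] V)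
  let G : ℂ → V →L[ℂ] V := fun z => T z + LinearMap.toContinuousLinearMap C
  have hG : DifferentiableOn ℂ G Ω := hT.add_const _
  have hent : ∀ i j, DifferentiableOn ℂ (fun z => Λ (G z) i j) Ω := fun i j =>
    (LinearMap.toContinuousLinearMap
      (Matrix.entryLinearMap ℂ ℂ i j ∘ₗ Λ.toLinearMap)).differentiable.comp_differentiableOn hG
  let δ : ℂ → ℂ := fun z => (Λ (G z)).det
  let Ψ : ℂ → V →L[ℂ] V := fun z => Λ.symm (Λ (G z)).adjugate
  have hδ : DifferentiableOn ℂ δ Ω := differentiableOn_det hent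
  have hΨ : DifferentiableOn ℂ Ψ Ω := by
    have : Ψ = fun z => ∑ i, ∑ j, (Λ (G z)).adjugate i j • Λ.symm (Matrix.single i j 1) := by
      ext1 z
      simp only [Ψ]
      conv_lhs => rw [Matrix.matrix_eq_sum_single (Λ (G z)).adjugate]
      simp only [map_sum, ← map_smul, Matrix.smul_single, smul_eq_mul, mul_one]
    rw [this]
    exact DifferentiableOn.fun_sum fun i _ => DifferentiableOn.fun_sum fun j _ =>
      (differentiableOn_adjugate hent i j).smul_const _
  have hδ₀ : δ z₀ ≠ 0 := by
    have : Λ (G z₀) = LinearMap.toMatrix b b ((T z₀ : V →ₗ[ℂ] V) + C) := rfl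
    have h2 : IsUnit (Λ (G z₀)) := this ▸ hC.map (LinearMap.toMatrixAlgEquiv b)
    exact ((Matrix.isUnit_iff_isUnit_det _).1 h2).ne_zero
  have hgood : ∀ z ∈ Ω, δ z ≠ 0 → T z * Ψ z * T z = δ z • T z := by
    intro z hz hδz
    have hGΨ : G z * ((δ z)⁻¹ • Ψ z) = 1 := by
      apply Λ.injective
      rw [hΛmul, map_smul, hΛone]
      simp only [Ψ, LinearEquiv.apply_symm_apply, Matrix.mul_smul, Matrix.mul_adjugate, smul_smul]
      rw [inv_mul_cancel₀ hδz, one_smul]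
    have h1 : ((T z : V →ₗ[ℂ] V) + C) * (((δ z)⁻¹ • Ψ z : V →L[ℂ] V) : V →ₗ[ℂ] V) = 1 := by
      ext x
      exact congrArg (fun f : V →L[ℂ] V => f x) hGΨ
    have h2 := comp_inverse_comp h1 (le_trans (Nat.add_le_add_right (hmax z hz) _) hrk)
    have h3 : T z * ((δ z)⁻¹ • Ψ z) * T z = T z := by
      ext x
      exact congrArg (fun f : V →ₗ[ℂ] V => f x) h2
    rw [mul_smul_comm, smul_mul_assoc] at h3
    rw [← h3, smul_smul, mul_inv_cancel₀ hδz, one_smul, h3]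
  refine ⟨δ, Ψ, hδ, hΨ, ⟨z₀, hz₀, hδ₀⟩, fun z hz => ?_⟩
  have hne : ∀ᶠ w in 𝓝[≠] z, T w * Ψ w * T w = δ w • T w := by
    filter_upwards [eventually_ne_zero hΩ hpre hδ hz₀ hδ₀ hz,
      mem_nhdsWithin_of_mem_nhds (hΩ.mem_nhds hz)] with w h1 h2 using hgood w h2 h1
  have c1 : ContinuousAt (fun w => T w * Ψ w * T w) z :=
    (((hT.continuousOn.mul hΨ.continuousOn).mul hT.continuousOn).continuousAt (hΩ.mem_nhds hz))
  have c2 : ContinuousAt (fun w => δ w • T w) z :=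
    ((hδ.continuousOn.smul hT.continuousOn).continuousAt (hΩ.mem_nhds hz))
  exact tendsto_nhds_unique_of_eventuallyEq (c1.tendsto.mono_left nhdsWithin_le_nhds)
    (c2.tendsto.mono_left nhdsWithin_le_nhds) hne

end GeneralizedInverse

section GlobalSections
open scoped Matrix.Norms.Operator
variable {n : ℕ}

lemma finite_not_isUnit_add_smul {P Q : Matrix (Fin n) (Fin n) ℂ} (h : IsUnit P ∨ IsUnit Q) :
    {t : ℂ | ¬ IsUnit (P + t • Q)}.Finite := by
  have key : ∀ P Q : Matrix (Fin n) (Fin n) ℂ, IsUnit P →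
      {t : ℂ | ¬ IsUnit (P + t • Q)}.Finite := by
    intro P Q hP
    let p : Polynomial ℂ :=
      (P.map Polynomial.C + (Polynomial.X : Polynomial ℂ) • Q.map Polynomial.C).det
    have hp : ∀ t, p.eval t = (P + t • Q).det := by
      intro t
      rw [← Polynomial.coe_evalRingHom, RingHom.map_det]
      congr 1
      ext i j
      simp [mul_comm t]
    have hp0 : p ≠ 0 := by
      intro h0
      have := hp 0
      rw [h0, Polynomial.eval_zero, zero_smul, add_zero] at this
      exact ((Matrix.isUnit_iff_isUnit_det _).1 hP).ne_zero this.symm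
    refine (Polynomial.finite_setOfPred_isRoot hp0).subset fun t ht => ?_
    rw [mem_ofPred_eq, Matrix.isUnit_iff_isUnit_det, isUnit_iff_ne_zero, not_not] at ht
    exact (hp t).trans ht
  rcases h with h | h
  · exact key P Q h
  · refine ((finite_singleton 0).union ((key Q P h).preimage inv_injective.injOn)).subset fun t ht => ?_
    by_cases h0 : t = 0
    · exact Or.inl h0
    · refine Or.inr fun hu => ht ?_
      have : P + t • Q = algebraMap ℂ _ t * (Q + t⁻¹ • P) := by
        rw [← Algebra.smul_def, smul_add, smul_smul, mul_inv_cancel₀ h0, one_smul, add_comm]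
      rw [this]
      exact ((isUnit_iff_ne_zero.2 h0).map (algebraMap ℂ _)).mul hu

section Intertwine
variable {𝔸 : Type*} [NormedRing 𝔸] [NormedAlgebra ℂ 𝔸]

/-- `h` is holomorphic on `V` and intertwines `A` and `B` there. -/
def Intertwines (A B h : ℂ → 𝔸) (V : Set ℂ) : Prop :=
  DifferentiableOn ℂ h V ∧ ∀ z ∈ V, A z * h z = h z * B z

lemma Intertwines.mono {A B h : ℂ → 𝔸} {V W : Set ℂ}
    (hh : Intertwines A B h V) (hW : W ⊆ V) : Intertwines A B h W :=
  ⟨hh.1.mono hW, fun z hz => hh.2 z (hW hz)⟩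

variable [FiniteDimensional ℂ 𝔸]

lemma exists_projector {Ω : Set ℂ} (hΩ : IsOpen Ω) (hpre : IsPreconnected Ω)
    (hne : Ω.Nonempty) {A B : ℂ → 𝔸} (hA : DifferentiableOn ℂ A Ω)
    (hB : DifferentiableOn ℂ B Ω) :
    ∃ (δ : ℂ → ℂ) (Φ : ℂ → 𝔸 →L[ℂ] 𝔸),
      DifferentiableOn ℂ δ Ω ∧ DifferentiableOn ℂ Φ Ω ∧ (∃ z ∈ Ω, δ z ≠ 0) ∧
      ∀ z ∈ Ω, ∀ Y, A z * Φ z Y = Φ z Y * B z ∧ (A z * Y = Y * B z → Φ z Y = δ z • Y) := by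
  let m := ContinuousLinearMap.mul ℂ (𝔸)
  let T : ℂ → 𝔸 →L[ℂ] 𝔸 :=
    fun z => m (A z) - m.flip (B z)
  have hT : DifferentiableOn ℂ T Ω :=
    (m.differentiable.comp_differentiableOn hA).sub (m.flip.differentiable.comp_differentiableOn hB)
  have hTa : ∀ z Y, T z Y = A z * Y - Y * B z := fun z Y => rfl
  obtain ⟨δ, Ψ, hδ, hΨ, hδ0, h⟩ := exists_generalized_inverse hΩ hpre hne hT
  refine ⟨δ, fun z => δ z • 1 - Ψ z * T z, hδ,
    (hδ.smul_const _).sub (hΨ.mul hT), hδ0, fun z hz Y => ⟨?_, fun hY => ?_⟩⟩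
  · rw [← sub_eq_zero, ← hTa]
    have := congrArg (fun f => f Y) (h z hz)
    simp only [smul_apply] at this
    simp only [sub_apply, smul_apply, map_sub, map_smul,
      one_apply_eq_self]
    rw [← this]
    exact sub_self _
  · have : T z Y = 0 := by rw [hTa, hY, sub_self]
    simp only [sub_apply, smul_apply,
      one_apply_eq_self]
    rw [show (Ψ z * T z) Y = Ψ z (T z Y) from rfl, this, map_zero, sub_zero]


lemma DifferentiableOn.update_of {E : Type*} [NormedAddCommGroup E] [NormedSpace ℂ E]
    {f g : ℂ → E} {d : ℂ} {R : ℝ} {V : Set ℂ} (hV : IsOpen V) (hf : DifferentiableOn ℂ f V)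
    (hdV : d ∉ V) (hg : DifferentiableOn ℂ g (ball d R)) (hR : 0 < R)
    (hfg : ∀ z ∈ ball d R, z ≠ d → f z = g z) :
    DifferentiableOn ℂ (Function.update f d (g d)) (insert d V) := by
  intro z hz
  refine DifferentiableAt.differentiableWithinAt ?_
  by_cases h : z = d
  · subst h
    refine (hg.differentiableAt (ball_mem_nhds z hR)).congr_of_eventuallyEq ?_
    filter_upwards [ball_mem_nhds z hR] with w hw
    by_cases hwz : w = z
    · rw [hwz, Function.update_self]
    · rw [Function.update_of_ne hwz, hfg w hw hwz]
  · have hzV : z ∈ V := hz.resolve_left h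
    refine (hf.differentiableAt (hV.mem_nhds hzV)).congr_of_eventuallyEq ?_
    filter_upwards [hV.mem_nhds hzV] with w hw
    exact Function.update_of_ne (ne_of_mem_of_not_mem hw hdV) _ _

lemma exists_punctured_ball {d : ℂ} {P : ℂ → Prop} (h : ∀ᶠ z in 𝓝[≠] d, P z) :
    ∃ R > 0, ∀ z, 0 < dist z d → dist z d < R → P z := by
  obtain ⟨R, hR, h⟩ := Metric.mem_nhdsWithin_iff.1 h
  exact ⟨R, hR, fun z h1 h2 => h ⟨h2, dist_pos.1 h1⟩⟩

lemma exists_global_section {Ω : Set ℂ} (hΩ : IsOpen Ω) (hpre : IsPreconnected Ω)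
    {A B : ℂ → 𝔸} (hA : DifferentiableOn ℂ A Ω)
    (hB : DifferentiableOn ℂ B Ω) {d : ℂ} (hd : d ∈ Ω) {U : Set ℂ} (hU : IsOpen U) (hdU : d ∈ U)
    {H : ℂ → 𝔸} (hH : Intertwines A B H U) : ∃ X, Intertwines A B X Ω ∧ X d = H d := by
  obtain ⟨δ, Φ, hδ, hΦ, ⟨z₀, hz₀, hδ₀⟩, h⟩ := exists_projector hΩ hpre ⟨d, hd⟩ hA hB
  have : CompleteSpace 𝔸 := FiniteDimensional.complete ℂ 𝔸
  obtain ⟨R, hR, hball⟩ := exists_punctured_ball ((eventually_ne_zero hΩ hpre hδ hz₀ hδ₀ hd).and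
    (mem_nhdsWithin_of_mem_nhds ((hΩ.inter hU).mem_nhds ⟨hd, hdU⟩)))
  obtain ⟨f₁, f₂, hf₁, hf₂, hf⟩ := exists_laurent_split (f := fun z => (δ z)⁻¹ • H z) (p := d)
    (r := 0) (R := R) (R' := R / 2) le_rfl (by positivity) (by linarith) (by
      intro z hz
      obtain ⟨h1, h2, h3⟩ := hball z hz.1 hz.2
      exact (((hδ.differentiableAt (hΩ.mem_nhds h2)).inv h1).smul
        (hH.1.differentiableAt (hU.mem_nhds h3))).differentiableWithinAt)
  have hV : IsOpen (Ω \ {d}) := hΩ.sdiff isClosed_singleton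
  let f : ℂ → 𝔸 := fun z => Φ z (f₁ z + f₂ d)
  let g : ℂ → 𝔸 := fun z => H z - Φ z (f₂ z - f₂ d)
  have hsub : ball d (R/2) ⊆ Ω ∩ U := by
    intro z hz
    by_cases hzd : z = d
    · exact hzd ▸ ⟨hd, hdU⟩
    · exact (hball z (dist_pos.2 hzd) (by rw [mem_ball] at hz; linarith)).2
  have hgd : g d = H d := by simp only [g, sub_self, map_zero, sub_zero]
  have hfd : DifferentiableOn ℂ f (Ω \ {d}) := (hΦ.mono sdiff_subset).clm_apply
    ((hf₁.1.mono fun z hz => dist_pos.2 hz.2).add_const _)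
  have hgdiff : DifferentiableOn ℂ g (ball d (R/2)) := (hH.1.mono fun z hz => (hsub hz).2).sub
    ((hΦ.mono fun z hz => (hsub hz).1).clm_apply (hf₂.sub_const _))
  have := DifferentiableOn.update_of hV hfd (by simp) hgdiff (by positivity) (by
    intro z hz hzd
    have h0 := dist_pos.2 hzd
    rw [mem_ball] at hz
    obtain ⟨h1, h2, h3⟩ := hball z h0 (by linarith)
    have h4 := hf z h0 hz
    have h5 : Φ z ((δ z)⁻¹ • H z) = H z := by
      rw [map_smul, (h z h2 (H z)).2 (hH.2 z h3), smul_smul, inv_mul_cancel₀ h1, one_smul]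
    simp only [f, g]
    rw [← h5, h4, ← map_sub]
    congr 1; abel)
  rw [insert_sdiff_singleton, insert_eq_of_mem hd] at this
  refine ⟨_, ⟨this, fun z hz => ?_⟩, by rw [Function.update_self, hgd]⟩
  by_cases hzd : z = d
  · subst hzd; rw [Function.update_self, hgd]; exact hH.2 z hdU
  · rw [Function.update_of_ne hzd]
    exact (h z hz _).1

lemma exists_push_one {Ω : Set ℂ} (hΩ : IsOpen Ω) (hpre : IsPreconnected Ω)
    {A B : ℂ → 𝔸} (hA : DifferentiableOn ℂ A Ω) (hB : DifferentiableOn ℂ B Ω) {m : ℕ} {L : Set ℂ}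
    (hL : IsCompact L) (hLΩ : L ⊆ Ω) {F : Set ℂ} (hF : F.Finite)
    (hKF : Disjoint (exhaust Ω m) F) {h : ℂ → 𝔸} (hh : Intertwines A B h (Ω \ F)) {p : ℂ}
    (hpF : p ∈ F) (hpL : p ∈ L) {ε : ℝ} (hε : 0 < ε) :
    ∃ E : Set ℂ, E.Finite ∧ Disjoint E L ∧ ∃ h' : ℂ → 𝔸, Intertwines A B h' (Ω \ (F \ {p} ∪ E)) ∧
      ∀ z ∈ exhaust Ω m, ‖h' z - h z‖ ≤ ε := by
  have hp : p ∈ Ω := hLΩ hpL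
  have hpK : p ∉ exhaust Ω m := fun hK => hKF.ne_of_mem hK hpF rfl
  obtain ⟨δ, Φ, hδ, hΦ, ⟨z₀, hz₀, hδ₀⟩, hproj⟩ := exists_projector hΩ hpre ⟨p, hp⟩ hA hB
  have : CompleteSpace 𝔸 := FiniteDimensional.complete ℂ 𝔸
  have hF' : IsClosed (F \ {p}) := (hF.subset sdiff_subset).isClosed
  obtain ⟨R, hR, hball⟩ := exists_punctured_ball ((eventually_ne_zero hΩ hpre hδ hz₀ hδ₀ hp).and
    (mem_nhdsWithin_of_mem_nhds ((hΩ.sdiff hF').mem_nhds ⟨hp, by simp⟩)))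
  have hballF : ∀ z, 0 < dist z p → dist z p < R → z ∈ Ω \ F := fun z h1 h2 =>
    ⟨(hball z h1 h2).2.1, fun hzF => (hball z h1 h2).2.2 ⟨hzF, dist_pos.1 h1⟩⟩
  have hΩF : IsOpen (Ω \ F) := hΩ.sdiff hF.isClosed
  obtain ⟨f₁, f₂, hf₁, hf₂, hf⟩ := exists_laurent_split (f := fun z => (δ z)⁻¹ • h z) (p := p)
    (r := 0) (R := R) (R' := R / 2) le_rfl (by positivity) (by linarith) (by
      intro z hz
      obtain ⟨h1, h2, h3⟩ := hball z hz.1 hz.2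
      exact (((hδ.differentiableAt (hΩ.mem_nhds h2)).inv h1).smul
        (hh.1.differentiableAt (hΩF.mem_nhds (hballF z hz.1 hz.2)))).differentiableWithinAt)
  obtain ⟨C, hC⟩ := (isCompact_exhaust Ω m).exists_bound_of_continuousOn
    (hΦ.continuousOn.mono (exhaust_subset Ω m))
  have hO : IsOpen (Ω \ exhaust Ω m) := hΩ.sdiff (isCompact_exhaust Ω m).isClosed
  have hpush : PolePush 𝔸 (exhaust Ω m) L p :=
    .of_connected hO.connectedComponentIn isPreconnected_connectedComponentIn
      (disjoint_sdiff_left.mono_left (connectedComponentIn_subset _ _))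
      (not_connectedComponentIn_subset hΩ hp hpK hL hLΩ) (mem_connectedComponentIn ⟨hp, hpK⟩)
  obtain ⟨E, hE, hEL, k, hk, hfk⟩ := hpush f₁ hf₁ (ε / (|C| + 1)) (by positivity)
  have hpE : p ∉ E := fun hpE => hEL.ne_of_mem hpE hpL rfl
  let f : ℂ → 𝔸 := fun z => h z - Φ z (f₁ z - k z)
  let g : ℂ → 𝔸 := fun z => Φ z (f₂ z + k z)
  obtain ⟨r, hr, hrE⟩ := Metric.isOpen_iff.1 hE.isClosed.isOpen_compl p hpE
  set ρ := min r (R/2)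
  have hρ : 0 < ρ := lt_min hr (by positivity)
  have hfd : DifferentiableOn ℂ f (Ω \ (F ∪ E)) :=
      (hh.1.mono fun z hz => ⟨hz.1, fun hzF => hz.2 (.inl hzF)⟩).sub
    ((hΦ.mono sdiff_subset).clm_apply ((hf₁.1.mono fun z hz => dist_pos.2
      (by rintro rfl; exact hz.2 (.inl hpF))).sub (hk.mono fun z hz hzE => hz.2 (.inr hzE))))
  have hgdiff : DifferentiableOn ℂ g (ball p ρ) := by
    refine (hΦ.mono fun z hz => ?_).clm_apply ((hf₂.mono (ball_subset_ball (min_le_right _ _))).add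
      (hk.mono ((ball_subset_ball (min_le_left _ _)).trans hrE)))
    have h2 : dist z p < R := ((mem_ball.1 hz).trans_le (min_le_right _ _)).trans (by linarith)
    by_cases hzp : z = p
    · exact hzp ▸ hp
    · exact (hball z (dist_pos.2 hzp) h2).2.1
  have := DifferentiableOn.update_of (hΩ.sdiff (hF.union hE).isClosed) hfd
    (fun hp' => hp'.2 (.inl hpF)) hgdiff hρ (by
    intro z hz hzp
    have h0 := dist_pos.2 hzp
    have h2 : dist z p < R/2 := (mem_ball.1 hz).trans_le (min_le_right _ _)
    obtain ⟨h1, h3, _⟩ := hball z h0 (by linarith)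
    have h4 := hf z h0 h2
    have h5 : Φ z ((δ z)⁻¹ • h z) = h z := by
      rw [map_smul, (hproj z h3 (h z)).2 (hh.2 z (hballF z h0 (by linarith))), smul_smul,
        inv_mul_cancel₀ h1, one_smul]
    simp only [f, g]
    nth_rw 1 [← h5]
    rw [h4, ← map_sub]
    congr 1; abel)
  refine ⟨E, hE, hEL, Function.update f p (g p), ⟨this.mono ?_, ?_⟩, fun z hz => ?_⟩
  · rintro z ⟨hz, hz'⟩
    by_cases hzp : z = p
    · exact .inl hzp
    · refine .inr ⟨hz, ?_⟩
      rintro (h1 | h1)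
      · exact hz' (.inl ⟨h1, hzp⟩)
      · exact hz' (.inr h1)
  · rintro z ⟨hz, hz'⟩
    by_cases hzp : z = p
    · subst hzp; rw [Function.update_self]; exact (hproj z hz _).1
    · rw [Function.update_of_ne hzp]
      simp only [f, mul_sub, sub_mul]
      rw [(hproj z hz _).1, hh.2 z ⟨hz, fun h1 => hz' (.inl ⟨h1, hzp⟩)⟩]
  · have hzp : z ≠ p := by rintro rfl; exact hpK hz
    rw [Function.update_of_ne hzp]
    simp only [f, sub_sub_cancel_left, norm_neg]
    calc ‖Φ z (f₁ z - k z)‖ ≤ ‖Φ z‖ * ‖f₁ z - k z‖ := (Φ z).le_opNorm _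
      _ ≤ (|C| + 1) * (ε / (|C| + 1)) := by
        gcongr
        · linarith [hC z hz, le_abs_self C]
        · exact hfk z hz
      _ = ε := by field_simp

lemma exists_push {Ω : Set ℂ} (hΩ : IsOpen Ω) (hpre : IsPreconnected Ω)
    {A B : ℂ → 𝔸} (hA : DifferentiableOn ℂ A Ω) (hB : DifferentiableOn ℂ B Ω) {m : ℕ} {L : Set ℂ}
    (hL : IsCompact L) (hLΩ : L ⊆ Ω) (hKL : exhaust Ω m ⊆ L) {F : Set ℂ} (hF : F.Finite)
    (hKF : Disjoint (exhaust Ω m) F) {h : ℂ → 𝔸} (hh : Intertwines A B h (Ω \ F)) {ε : ℝ}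
    (hε : 0 < ε) :
    ∃ F' : Set ℂ, F'.Finite ∧ Disjoint F' L ∧ ∃ h' : ℂ → 𝔸, Intertwines A B h' (Ω \ F') ∧
      ∀ z ∈ exhaust Ω m, ‖h' z - h z‖ ≤ ε := by
  suffices H : ∀ Z : Finset ℂ, ∀ F : Set ℂ, F.Finite → Disjoint (exhaust Ω m) F → F ∩ L ⊆ Z →
      ∀ h : ℂ → 𝔸, Intertwines A B h (Ω \ F) → ∀ ε > 0,
      ∃ F' : Set ℂ, F'.Finite ∧ Disjoint F' L ∧ ∃ h' : ℂ → 𝔸, Intertwines A B h' (Ω \ F') ∧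
      ∀ z ∈ exhaust Ω m, ‖h' z - h z‖ ≤ ε from
    H hF.toFinset F hF hKF (by simp) h hh ε hε
  classical
  intro Z
  induction Z using Finset.induction_on with
  | empty =>
    intro F hF hKF hFL h hh ε hε
    refine ⟨F, hF, ?_, h, hh, fun z _ => by simpa using hε.le⟩
    rw [disjoint_iff_inter_eq_empty, ← subset_empty_iff]
    simpa using hFL
  | insert p Z _ ih =>
    intro F hF hKF hFL h hh ε hε
    by_cases hp : p ∈ F ∩ L
    · obtain ⟨E, hE, hEL, h₁, hh₁, hd₁⟩ :=
        exists_push_one hΩ hpre hA hB hL hLΩ hF hKF hh hp.1 hp.2 (half_pos hε)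
      obtain ⟨F', hF', hFL', h₂, hh₂, hd₂⟩ := ih (F \ {p} ∪ E) ((hF.subset sdiff_subset).union hE)
        (disjoint_union_right.2 ⟨hKF.mono_right sdiff_subset, (hEL.mono_right hKL).symm⟩) (by
          rintro z ⟨(hz | hz), hzL⟩
          · have := hFL ⟨hz.1, hzL⟩
            rw [Finset.coe_insert] at this
            exact this.resolve_left hz.2
          · exact absurd rfl (hEL.ne_of_mem hz hzL)) h₁ hh₁ (ε / 2) (half_pos hε)
      refine ⟨F', hF', hFL', h₂, hh₂, fun z hz => ?_⟩
      calc ‖h₂ z - h z‖ = ‖(h₂ z - h₁ z) + (h₁ z - h z)‖ := by congr 1; abel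
        _ ≤ ε / 2 + ε / 2 := (norm_add_le _ _).trans (add_le_add (hd₂ z hz) (hd₁ z hz))
        _ = ε := by ring
    · refine ih F hF hKF (fun z hz => ?_) h hh ε hε
      have := hFL hz
      rw [Finset.coe_insert] at this
      exact this.resolve_left fun hzp => hp (hzp ▸ hz)

end Intertwine

end GlobalSections

section FiniteSets
open scoped Matrix.Norms.Operator
variable {n : ℕ}

lemma exists_global_section_isUnit {Ω : Set ℂ} (hΩ : IsOpen Ω) (hpre : IsPreconnected Ω)
    {A B : ℂ → Matrix (Fin n) (Fin n) ℂ} (hA : DifferentiableOn ℂ A Ω)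
    (hB : DifferentiableOn ℂ B Ω)
    (hloc : ∀ d ∈ Ω, ∃ U, IsOpen U ∧ d ∈ U ∧ ∃ H, Intertwines A B H U ∧ ∀ z ∈ U, IsUnit (H z))
    (Z : Finset ℂ) (hZ : ∀ z ∈ Z, z ∈ Ω) :
    ∃ X, Intertwines A B X Ω ∧ ∀ z ∈ Z, IsUnit (X z) := by
  classical
  induction Z using Finset.induction_on with
  | empty =>
    refine ⟨fun _ => 0, ⟨differentiableOn_const _, fun z _ => ?_⟩, by simp⟩
    simp
  | insert d Z hd ih =>
    obtain ⟨X, hX, hXZ⟩ := ih fun z hz => hZ z (Finset.mem_insert_of_mem hz)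
    obtain ⟨U, hU, hdU, H, hH, hHu⟩ := hloc d (hZ d (Finset.mem_insert_self d Z))
    obtain ⟨Y, hY, hYd⟩ := exists_global_section hΩ hpre hA hB
      (hZ d (Finset.mem_insert_self d Z)) hU hdU hH
    have hfin : (⋃ z ∈ insert d Z, {t : ℂ | ¬ IsUnit (X z + t • Y z)}).Finite := by
      refine (insert d Z).finite_toSet.biUnion fun z hz => finite_not_isUnit_add_smul ?_
      rcases Finset.mem_insert.1 hz with rfl | hz
      · exact Or.inr (hYd ▸ hHu _ hdU)
      · exact Or.inl (hXZ z hz)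
    obtain ⟨t, ht⟩ := hfin.exists_notMem
    refine ⟨fun z => X z + t • Y z, ⟨hX.1.add (hY.1.const_smul t), fun z hz => ?_⟩, fun z hz => ?_⟩
    · rw [mul_add, add_mul, hX.2 z hz, mul_smul_comm, smul_mul_assoc, hY.2 z hz]
    · by_contra h
      exact ht (mem_biUnion (x := z) hz h)

section Algebra
open Polynomial

lemma exists_clear_denominators {R K : Type*} [CommRing R] [IsDomain R] [Field K] [Algebra R K]
    [IsFractionRing R K] (p : K[X]) :
    ∃ s : R, s ≠ 0 ∧ ∃ q : R[X], q.map (algebraMap R K) = C (algebraMap R K s) * p := by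
  obtain ⟨s, hs, h⟩ := IsLocalization.integerNormalization_spec (nonZeroDivisors R) p
  refine ⟨s, nonZeroDivisors.ne_zero hs, _, h.trans ?_⟩
  rw [← smul_eq_C_mul, algebraMap_smul]

lemma exists_squarefree_part_field {K : Type*} [Field K] [CharZero K] {f : K[X]} (hf : f ≠ 0) :
    ∃ (S g c a b : K[X]) (m : ℕ), f = S * g ∧ S ^ m = f * c ∧
      a * S + b * derivative S = 1 := by
  classical
  obtain ⟨g, hg⟩ : UniqueFactorizationMonoid.radical f ∣ f :=
    UniqueFactorizationMonoid.radical_dvd_self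
  obtain ⟨m, c, hc⟩ := UniqueFactorizationMonoid.exists_dvd_radical_self_pow hf
  obtain ⟨a, b, hab⟩ : (UniqueFactorizationMonoid.radical f).Separable :=
    PerfectField.separable_iff_squarefree.2 UniqueFactorizationMonoid.squarefree_radical
  exact ⟨_, g, c, a, b, m, hg, hc, hab⟩

/-- A squarefree part of a nonzero polynomial over a domain, up to denominators. -/
lemma exists_squarefree_part {R : Type*} [CommRing R] [IsDomain R] [CharZero R] {f : R[X]}
    (hf : f ≠ 0) : ∃ (S g c a b : R[X]) (m : ℕ) (D₁ D₂ D₃ : R), D₁ ≠ 0 ∧ D₂ ≠ 0 ∧ D₃ ≠ 0 ∧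
      C D₁ * f = S * g ∧ C D₂ * S ^ m = f * c ∧ a * S + b * derivative S = C D₃ := by
  have hφ : Function.Injective (algebraMap R (FractionRing R)) := IsFractionRing.injective R _
  have : CharZero (FractionRing R) := charZero_of_injective_algebraMap hφ
  have hf0 : f.map (algebraMap R (FractionRing R)) ≠ 0 := (Polynomial.map_ne_zero_iff hφ).2 hf
  obtain ⟨S₀, g₀, c₀, a₀, b₀, m, hg₀, hc₀, hab⟩ := exists_squarefree_part_field hf0
  obtain ⟨s, hs, S, hS⟩ := exists_clear_denominators (R := R) S₀
  obtain ⟨t, ht, g, hg⟩ := exists_clear_denominators (R := R) g₀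
  obtain ⟨u, hu, c, hc⟩ := exists_clear_denominators (R := R) c₀
  obtain ⟨x, hx, a, ha⟩ := exists_clear_denominators (R := R) a₀
  obtain ⟨y, hy, b, hb⟩ := exists_clear_denominators (R := R) b₀
  have hinj := Polynomial.map_injective _ hφ
  refine ⟨S, g, C (s ^ m) * c, C y * a, C x * b, m, s * t, u, s * x * y, mul_ne_zero hs ht, hu,
    mul_ne_zero (mul_ne_zero hs hx) hy, hinj ?_, hinj ?_, hinj ?_⟩
  · simp only [Polynomial.map_mul, map_C, hS, hg, map_mul]
    rw [hg₀]; ring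
  · simp only [Polynomial.map_mul, Polynomial.map_pow, map_C, hS, hc, map_pow, mul_pow]
    rw [hc₀]; ring
  · simp only [Polynomial.map_mul, Polynomial.map_add, map_C, hS, ha, hb, map_mul,
      ← Polynomial.derivative_map, derivative_C_mul]
    linear_combination (C (algebraMap R (FractionRing R) s) * C (algebraMap R (FractionRing R) x) *
      C (algebraMap R (FractionRing R) y)) * hab

end Algebra

end FiniteSets

section AnalyticGerms
open scoped Matrix.Norms.Operator
variable {n : ℕ}

section Germs
open Polynomial

/-- Functions analytic at `p`. -/
def analyticRing (p : ℂ) : Subring (ℂ → ℂ) where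
  carrier := {f | AnalyticAt ℂ f p}
  mul_mem' := fun ha hb => ha.mul hb
  one_mem' := analyticAt_const
  add_mem' := fun ha hb => ha.add hb
  zero_mem' := analyticAt_const
  neg_mem' := fun ha => ha.neg

/-- Evaluation at a point. -/
def analyticRing.eval (p z : ℂ) : analyticRing p →+* ℂ :=
  (Pi.evalRingHom (fun _ : ℂ => ℂ) z).comp (analyticRing p).subtype

lemma analyticRing.eval_apply (p z : ℂ) (f : analyticRing p) :
    analyticRing.eval p z f = (f : ℂ → ℂ) z := rfl

/-- The ideal of functions vanishing near `p`. -/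
def vanishingIdeal (p : ℂ) : Ideal (analyticRing p) where
  carrier := {f | ∀ᶠ z in 𝓝[≠] p, (f : ℂ → ℂ) z = 0}
  add_mem' := fun {a b} ha hb => by
    rw [mem_ofPred_eq] at *
    filter_upwards [ha, hb] with z h1 h2
    simp [h1, h2]
  zero_mem' := by simp
  smul_mem' := fun c x hx => by
    rw [mem_ofPred_eq] at *
    filter_upwards [hx] with z h1
    simp [h1]

lemma mem_vanishingIdeal {p : ℂ} {f : analyticRing p} :
    f ∈ vanishingIdeal p ↔ ∀ᶠ z in 𝓝[≠] p, (f : ℂ → ℂ) z = 0 := Iff.rfl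

lemma eventually_ne_of_notMem {p : ℂ} {f : analyticRing p} (hf : f ∉ vanishingIdeal p) :
    ∀ᶠ z in 𝓝[≠] p, (f : ℂ → ℂ) z ≠ 0 :=
  (AnalyticAt.eventually_eq_zero_or_eventually_ne_zero f.2).resolve_left
    fun h => hf (h.filter_mono nhdsWithin_le_nhds)

instance (p : ℂ) : (vanishingIdeal p).IsPrime where
  ne_top' := fun h => by
    have : (1 : analyticRing p) ∈ vanishingIdeal p := h ▸ Submodule.mem_top
    obtain ⟨z, hz⟩ := (mem_vanishingIdeal.1 this).exists
    simp at hz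
  mem_or_mem' := fun {x y} hxy => by
    by_contra! h
    obtain ⟨z, ⟨h1, h2⟩, h3⟩ := (((eventually_ne_of_notMem h.1).and
      (eventually_ne_of_notMem h.2)).and (mem_vanishingIdeal.1 hxy)).exists
    exact mul_ne_zero h1 h2 (by simpa using h3)

instance (p : ℂ) : CharZero (analyticRing p ⧸ vanishingIdeal p) := by
  refine charZero_of_inj_zero fun m hm => ?_
  rw [← map_natCast (Ideal.Quotient.mk (vanishingIdeal p)), Ideal.Quotient.eq_zero_iff_mem] at hm
  obtain ⟨z, hz⟩ := (mem_vanishingIdeal.1 hm).exists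
  simpa using hz

lemma eventually_map_eq_zero {p : ℂ} {P : (analyticRing p)[X]}
    (h : P.map (Ideal.Quotient.mk (vanishingIdeal p)) = 0) :
    ∀ᶠ z in 𝓝[≠] p, P.map (analyticRing.eval p z) = 0 := by
  have : ∀ᶠ z in 𝓝[≠] p, ∀ j ∈ P.support, ((P.coeff j : analyticRing p) : ℂ → ℂ) z = 0 := by
    refine (eventually_all_finset _).2 fun j _ => ?_
    rw [← mem_vanishingIdeal, ← Ideal.Quotient.eq_zero_iff_mem, ← coeff_map, h, coeff_zero]
  filter_upwards [this] with z hz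
  ext j
  rw [coeff_map, coeff_zero, analyticRing.eval_apply]
  by_cases hj : j ∈ P.support
  · exact hz j hj
  · rw [notMem_support_iff.1 hj]; rfl

lemma eventually_map_eq {p : ℂ} {P Q : (analyticRing p)[X]}
    (h : P.map (Ideal.Quotient.mk (vanishingIdeal p)) =
      Q.map (Ideal.Quotient.mk (vanishingIdeal p))) :
    ∀ᶠ z in 𝓝[≠] p, P.map (analyticRing.eval p z) = Q.map (analyticRing.eval p z) := by
  filter_upwards [eventually_map_eq_zero (P := P - Q) (by rw [Polynomial.map_sub, h, sub_self])]
    with z hz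
  rwa [Polynomial.map_sub, sub_eq_zero] at hz

lemma exists_reduced_charpoly {v : ℂ → Matrix (Fin n) (Fin n) ℂ} {p : ℂ}
    (hv : ∀ i j, AnalyticAt ℂ (fun z => v z i j) p) :
    ∃ (k : ℕ) (s : ℕ → ℂ → ℂ), (∀ j, AnalyticAt ℂ (s j) p) ∧ ∀ᶠ z in 𝓝[≠] p, s k z ≠ 0 ∧
      ∀ x, (∑ j ∈ Finset.range (k + 1), s j z * x ^ j = 0 ↔ x ∈ spectrum ℂ (v z)) ∧
        (x ∈ spectrum ℂ (v z) → ∑ j ∈ Finset.range (k + 1), s j z * (j * x ^ (j - 1)) ≠ 0) := by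
  let π := Ideal.Quotient.mk (vanishingIdeal p)
  have hπ : Function.Surjective π := Ideal.Quotient.mk_surjective
  let M : Matrix (Fin n) (Fin n) (analyticRing p) := Matrix.of fun i j => ⟨_, hv i j⟩
  have hM : ∀ z, M.charpoly.map (analyticRing.eval p z) = (v z).charpoly := by
    intro z
    rw [← Matrix.charpoly_map]
    rfl
  have hlift : ∀ P : (analyticRing p ⧸ vanishingIdeal p)[X],
      ∃ Q : (analyticRing p)[X], Q.map π = P := Polynomial.map_surjective π hπ
  obtain ⟨S', g', c', a', b', m, D₁', D₂', D₃', h1, h2, h3, e1, e2, e3⟩ :=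
    exists_squarefree_part (f := M.charpoly.map π) (M.charpoly_monic.map π).ne_zero
  obtain ⟨S, hS, hdeg⟩ := Polynomial.exists_degree_eq_of_mem_lifts
    ((Polynomial.mem_lifts S').2 (hlift S'))
  obtain ⟨g, rfl⟩ := hlift g'
  obtain ⟨c, rfl⟩ := hlift c'
  obtain ⟨a, rfl⟩ := hlift a'
  obtain ⟨b, rfl⟩ := hlift b'
  obtain ⟨D₁, rfl⟩ := hπ D₁'
  obtain ⟨D₂, rfl⟩ := hπ D₂'
  obtain ⟨D₃, rfl⟩ := hπ D₃'
  subst hS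
  have hS0 : S.map π ≠ 0 := by
    intro h0
    rw [h0, zero_mul, mul_eq_zero, C_eq_zero] at e1
    exact e1.elim h1 (M.charpoly_monic.map π).ne_zero
  have hlead : S.coeff S.natDegree ∉ vanishingIdeal p := by
    rw [← Ideal.Quotient.eq_zero_iff_mem, ← coeff_map, natDegree_eq_of_degree_eq hdeg]
    exact leadingCoeff_ne_zero.2 hS0
  have hD : ∀ {D : analyticRing p}, π D ≠ 0 → ∀ᶠ z in 𝓝[≠] p, (D : ℂ → ℂ) z ≠ 0 := fun {D} h =>
    eventually_ne_of_notMem fun h' => h (Ideal.Quotient.eq_zero_iff_mem.2 h')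
  refine ⟨S.natDegree, fun j => S.coeff j, fun j => (S.coeff j).2, ?_⟩
  filter_upwards [hD h1, hD h2, hD h3, eventually_ne_of_notMem hlead,
    eventually_map_eq (P := C D₁ * M.charpoly) (Q := S * g)
      (by simpa only [Polynomial.map_mul, map_C] using e1),
    eventually_map_eq (P := C D₂ * S ^ m) (Q := M.charpoly * c)
      (by simpa only [Polynomial.map_mul, Polynomial.map_pow, map_C] using e2),
    eventually_map_eq (P := a * S + b * derivative S) (Q := C D₃)
      (by simpa only [Polynomial.map_mul, Polynomial.map_add, map_C, derivative_map] using e3)]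
    with z k1 k2 k3 k4 f1 f2 f3
  refine ⟨k4, fun x => ?_⟩
  have ev : ∑ j ∈ Finset.range (S.natDegree + 1), ((S.coeff j : analyticRing p) : ℂ → ℂ) z * x ^ j
      = (S.map (analyticRing.eval p z)).eval x := by
    rw [eval_map, eval₂_eq_sum_range]
    rfl
  have ev' : ∑ j ∈ Finset.range (S.natDegree + 1),
      ((S.coeff j : analyticRing p) : ℂ → ℂ) z * (j * x ^ (j - 1))
      = (derivative (S.map (analyticRing.eval p z))).eval x := by
    have : S.map (analyticRing.eval p z) = ∑ j ∈ Finset.range (S.natDegree + 1),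
        C (((S.coeff j : analyticRing p) : ℂ → ℂ) z) * X ^ j := by
      conv_lhs => rw [S.as_sum_range_C_mul_X_pow, Polynomial.map_sum]
      simp [analyticRing.eval_apply]
    rw [this, derivative_sum, eval_finsetSum]
    refine Finset.sum_congr rfl fun j _ => ?_
    rw [derivative_C_mul_X_pow, eval_C_mul, eval_X_pow, mul_assoc]
  have f1' := congrArg (eval x) f1
  have f2' := congrArg (eval x) f2
  have f3' := congrArg (eval x) f3
  simp only [Polynomial.map_mul, Polynomial.map_pow, Polynomial.map_add, map_C, hM, eval_mul,
    eval_pow, eval_add, eval_C, analyticRing.eval_apply, ← derivative_map] at f1' f2' f3'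
  have hiff : ∑ j ∈ Finset.range (S.natDegree + 1),
      ((S.coeff j : analyticRing p) : ℂ → ℂ) z * x ^ j = 0 ↔ x ∈ spectrum ℂ (v z) := by
    rw [ev, Matrix.mem_spectrum_iff_isRoot_charpoly, IsRoot.def]
    constructor
    · intro h
      rw [h, zero_mul] at f1'
      exact (mul_eq_zero.1 f1').resolve_left k1
    · intro h
      rw [h, zero_mul] at f2'
      exact eq_zero_of_pow_eq_zero ((mul_eq_zero.1 f2').resolve_left k2)
  refine ⟨hiff, fun hx h0 => k3 ?_⟩
  rw [← hiff, ev] at hx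
  rw [ev'] at h0
  rw [← f3', hx, h0, mul_zero, mul_zero, add_zero]

end Germs

end AnalyticGerms

section GoodSpectrum
open scoped Matrix.Norms.Operator
variable {n : ℕ}

lemma exists_root_branch {p x : ℂ} {k : ℕ} {s : ℕ → ℂ → ℂ}
    (hs : ∀ j ∈ Finset.range k, AnalyticAt ℂ (s j) p)
    (hx : ∑ j ∈ Finset.range k, s j p * x ^ j = 0)
    (hx' : ∑ j ∈ Finset.range k, s j p * (j * x ^ (j - 1)) ≠ 0) :
    ∃ r : ℂ → ℂ, AnalyticAt ℂ r p ∧ r p = x ∧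
      ∀ᶠ w in 𝓝 p, ∑ j ∈ Finset.range k, s j w * r w ^ j = 0 := by
  let f : ℂ × ℂ → ℂ := fun u => ∑ j ∈ Finset.range k, s j u.1 * u.2 ^ j
  have hf : AnalyticAt ℂ f (p, x) := by
    refine Finset.analyticAt_fun_sum _ fun j hj => ?_
    exact (AnalyticAt.comp (f := Prod.fst) (x := ((p, x) : ℂ × ℂ)) (hs j hj) analyticAt_fst).mul
      (analyticAt_snd.pow j)
  have cdf : ContDiffAt ℂ ⊤ f (p, x) := hf.contDiffAt
  have hd : HasDerivAt (fun y => f (p, y))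
      (∑ j ∈ Finset.range k, s j p * (j * x ^ (j - 1))) x :=
    HasDerivAt.fun_sum fun j _ => (hasDerivAt_pow j x).const_mul (s j p)
  have hd' : HasDerivAt (fun y => f (p, y)) ((fderiv ℂ f (p, x) ∘L .inr ℂ ℂ ℂ) 1) x :=
    (hf.differentiableAt.hasFDerivAt.comp x (hasFDerivAt_prodMk_right p x)).hasDerivAt
  have if₂ : (fderiv ℂ f (p, x) ∘L .inr ℂ ℂ ℂ).IsInvertible := by
    refine ⟨ContinuousLinearEquiv.unitsEquivAut ℂ (Units.mk0 _ hx'), ?_⟩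
    ext
    simp [hd.unique hd']
  refine ⟨cdf.implicitFunction (by simp) if₂, ?_, cdf.implicitFunction_apply_self _ if₂, ?_⟩
  · exact (cdf.contDiffAt_implicitFunction (by simp) if₂).analyticAt
  · filter_upwards [cdf.eventually_apply_implicitFunction (by simp) if₂] with w hw
    exact hw.trans hx

/-- Near `p`, the eigenvalues of `v` are pairwise distinct holomorphic functions. -/
def GoodAt (v : ℂ → Matrix (Fin n) (Fin n) ℂ) (p : ℂ) : Prop :=
  ∃ R > 0, ∃ (k : ℕ) (r : Fin k → ℂ → ℂ), (∀ i, DifferentiableOn ℂ (r i) (ball p R)) ∧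
    ∀ z ∈ ball p R, Function.Injective (fun i => r i z) ∧
      spectrum ℂ (v z) = range fun i => r i z

open Polynomial in
lemma ncard_spectrum_eq {M : Matrix (Fin n) (Fin n) ℂ} {k : ℕ} {c : ℕ → ℂ} (hk : c k ≠ 0)
    (h : ∀ x, (∑ j ∈ Finset.range (k + 1), c j * x ^ j = 0 ↔ x ∈ spectrum ℂ M) ∧
        (x ∈ spectrum ℂ M → ∑ j ∈ Finset.range (k + 1), c j * (j * x ^ (j - 1)) ≠ 0)) :
    (spectrum ℂ M).Finite ∧ (spectrum ℂ M).ncard = k := by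
  classical
  let P : ℂ[X] := ∑ j ∈ Finset.range (k + 1), C (c j) * X ^ j
  have hcoeff : ∀ j, P.coeff j = if j < k + 1 then c j else 0 := by
    intro j
    simp [P, coeff_C_mul, coeff_X_pow]
  have hdeg : P.natDegree = k := by
    refine natDegree_eq_of_le_of_coeff_ne_zero ?_ (by rw [hcoeff]; simpa using hk)
    refine natDegree_le_iff_coeff_eq_zero.2 fun j hj => ?_
    rw [hcoeff, if_neg (by omega)]
  have hP0 : P ≠ 0 := by
    intro h0
    have := hcoeff k
    rw [h0, coeff_zero, if_pos (Nat.lt_succ_self k)] at this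
    exact hk this.symm
  have ev : ∀ x, P.eval x = ∑ j ∈ Finset.range (k + 1), c j * x ^ j := by
    intro x
    simp [P, eval_finsetSum]
  have ev' : ∀ x, (derivative P).eval x =
      ∑ j ∈ Finset.range (k + 1), c j * (j * x ^ (j - 1)) := by
    intro x
    rw [derivative_sum, eval_finsetSum]
    refine Finset.sum_congr rfl fun j _ => ?_
    rw [derivative_C_mul_X_pow, eval_C_mul, eval_X_pow, mul_assoc]
  have hroots : spectrum ℂ M = ↑P.roots.toFinset := by
    ext x
    rw [← (h x).1, ← ev, Finset.mem_coe, Multiset.mem_toFinset, mem_roots hP0, IsRoot.def]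
  have hnodup : P.roots.Nodup := by
    refine Multiset.nodup_iff_count_le_one.2 fun x => ?_
    rw [count_roots]
    by_contra! h1
    obtain ⟨h2, h3⟩ := (one_lt_rootMultiplicity_iff_isRoot hP0).1 h1
    refine (h x).2 ((h x).1.1 ?_) ?_
    · rw [← ev]; exact h2
    · rw [← ev']; exact h3
  refine ⟨hroots ▸ Finset.finite_toSet _, ?_⟩
  rw [hroots, Set.ncard_coe_finset, Multiset.toFinset_card_of_nodup hnodup,
    ← (IsAlgClosed.splits P).natDegree_eq_card_roots, hdeg]

lemma goodAt_of_eventually {v : ℂ → Matrix (Fin n) (Fin n) ℂ} {p : ℂ} {k : ℕ} {s : ℕ → ℂ → ℂ}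
    (hs : ∀ j ∈ Finset.range (k + 1), AnalyticAt ℂ (s j) p)
    (h : ∀ᶠ z in 𝓝 p, s k z ≠ 0 ∧
      ∀ x, (∑ j ∈ Finset.range (k + 1), s j z * x ^ j = 0 ↔ x ∈ spectrum ℂ (v z)) ∧
        (x ∈ spectrum ℂ (v z) → ∑ j ∈ Finset.range (k + 1), s j z * (j * x ^ (j - 1)) ≠ 0)) :
    GoodAt v p := by
  obtain ⟨hp0, hp⟩ := h.self_of_nhds
  obtain ⟨hfin, hcard⟩ := ncard_spectrum_eq (c := fun j => s j p) hp0 hp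
  have : Finite (spectrum ℂ (v p)) := hfin.to_subtype
  let e := Finite.equivFinOfCardEq ((Nat.card_coe_set_eq (spectrum ℂ (v p))).trans hcard)
  choose r hr hrp hr0 using fun i : Fin k => exists_root_branch hs
    ((hp _).1.2 (e.symm i).2) ((hp _).2 (e.symm i).2)
  have hinj : ∀ᶠ z in 𝓝 p, Function.Injective fun i => r i z := by
    have : ∀ᶠ z in 𝓝 p, ∀ i j : Fin k, i ≠ j → r i z ≠ r j z := by
      refine eventually_all.2 fun i => eventually_all.2 fun j => ?_
      by_cases hij : i = j
      · simp [hij]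
      · filter_upwards [(hr i).continuousAt.ne_iff_eventually_ne (hr j).continuousAt |>.1
          (by rw [hrp, hrp]; exact fun h => hij (e.symm.injective (Subtype.ext h)))] with z hz _
        exact hz
    filter_upwards [this] with z hz i j hij
    by_contra hne
    exact hz i j hne hij
  have hall : ∀ᶠ z in 𝓝 p, (∀ i, AnalyticAt ℂ (r i) z) ∧
      Function.Injective (fun i => r i z) ∧ spectrum ℂ (v z) = range fun i => r i z := by
    filter_upwards [eventually_all.2 fun i => (hr i).eventually_analyticAt, hinj, h,
      eventually_all.2 hr0] with z h1 h2 h3 h4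
    obtain ⟨hfz, hcz⟩ := ncard_spectrum_eq (c := fun j => s j z) h3.1 h3.2
    refine ⟨h1, h2, (Set.eq_of_subset_of_ncard_le ?_ ?_ hfz).symm⟩
    · rintro _ ⟨i, rfl⟩
      exact (h3.2 _).1.1 (h4 i)
    · rw [hcz, ← Nat.card_coe_set_eq, Nat.card_range_of_injective h2, Nat.card_eq_fintype_card,
        Fintype.card_fin]
  obtain ⟨R, hR, hball⟩ := Metric.eventually_nhds_iff_ball.1 hall
  exact ⟨R, hR, k, r, fun i z hz => ((hball z hz).1 i).differentiableAt.differentiableWithinAt,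
    fun z hz => (hball z hz).2⟩

lemma eventually_goodAt {v : ℂ → Matrix (Fin n) (Fin n) ℂ} {U : Set ℂ} (hU : IsOpen U)
    (hv : DifferentiableOn ℂ v U) {p : ℂ} (hp : p ∈ U) : ∀ᶠ z in 𝓝[≠] p, GoodAt v z := by
  have hva : ∀ i j, AnalyticAt ℂ (fun z => v z i j) p := fun i j => by
    have := (Matrix.entryLinearMap ℂ ℂ i j :
      Matrix (Fin n) (Fin n) ℂ →ₗ[ℂ] ℂ).toContinuousLinearMap.differentiable.comp_differentiableOn
        hv
    exact this.analyticAt (hU.mem_nhds hp)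
  obtain ⟨k, s, hs, h⟩ := exists_reduced_charpoly hva
  have h1 : ∀ᶠ z in 𝓝[≠] p, ∀ j ∈ Finset.range (k + 1), AnalyticAt ℂ (s j) z :=
    (eventually_all_finset _).2 fun j _ =>
      (hs j).eventually_analyticAt.filter_mono nhdsWithin_le_nhds
  filter_upwards [h1, eventually_eventually_nhdsWithin.2 h, self_mem_nhdsWithin] with z hz hz2 hne
  refine goodAt_of_eventually hz ?_
  rwa [IsOpen.nhdsWithin_eq isOpen_compl_singleton hne] at hz2

end GoodSpectrum

section PolyHolo
open Polynomial
variable {𝔸 : Type*} [NormedRing 𝔸] [NormedAlgebra ℂ 𝔸]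

/-- Functions holomorphic on `V`. -/
def holRing (V : Set ℂ) : Subring (ℂ → ℂ) where
  carrier := {f | DifferentiableOn ℂ f V}
  mul_mem' := fun ha hb => ha.mul hb
  one_mem' := differentiableOn_const 1
  add_mem' := fun ha hb => ha.add hb
  zero_mem' := differentiableOn_const 0
  neg_mem' := fun ha => ha.neg

/-- Evaluation at a point. -/
def holRing.eval (V : Set ℂ) (z : ℂ) : holRing V →+* ℂ :=
  (Pi.evalRingHom (fun _ : ℂ => ℂ) z).comp (holRing V).subtype

lemma holRing.eval_apply (V : Set ℂ) (z : ℂ) (f : holRing V) :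
    holRing.eval V z f = (f : ℂ → ℂ) z := rfl

/-- On `V`, the function `g` is a polynomial in `v` with holomorphic coefficients. -/
def PolyHolo (v : ℂ → 𝔸) (V : Set ℂ) (g : ℂ → 𝔸) : Prop :=
  ∃ P : (holRing V)[X], ∀ z ∈ V, g z = aeval (v z) (P.map (holRing.eval V z))

variable {v : ℂ → 𝔸} {V W : Set ℂ} {g g' : ℂ → 𝔸}

lemma PolyHolo.congr (h : PolyHolo v V g) (hg : ∀ z ∈ V, g' z = g z) : PolyHolo v V g' :=
  let ⟨P, hP⟩ := h
  ⟨P, fun z hz => (hg z hz).trans (hP z hz)⟩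

lemma PolyHolo.mono (h : PolyHolo v V g) (hW : W ⊆ V) : PolyHolo v W g := by
  obtain ⟨P, hP⟩ := h
  let φ : holRing V →+* holRing W := Subring.inclusion fun f hf => DifferentiableOn.mono hf hW
  refine ⟨P.map φ, fun z hz => (hP z (hW hz)).trans ?_⟩
  rw [Polynomial.map_map]
  rfl

lemma PolyHolo.add (h : PolyHolo v V g) (h' : PolyHolo v V g') :
    PolyHolo v V fun z => g z + g' z := by
  obtain ⟨P, hP⟩ := h
  obtain ⟨Q, hQ⟩ := h'
  exact ⟨P + Q, fun z hz => by
    beta_reduce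
    rw [hP z hz, hQ z hz, Polynomial.map_add, map_add]⟩

lemma PolyHolo.mul (h : PolyHolo v V g) (h' : PolyHolo v V g') :
    PolyHolo v V fun z => g z * g' z := by
  obtain ⟨P, hP⟩ := h
  obtain ⟨Q, hQ⟩ := h'
  exact ⟨P * Q, fun z hz => by
    beta_reduce
    rw [hP z hz, hQ z hz, Polynomial.map_mul, map_mul]⟩

lemma PolyHolo.of_holo {a : ℂ → ℂ} (ha : DifferentiableOn ℂ a V) :
    PolyHolo v V fun z => algebraMap ℂ 𝔸 (a z) :=
  ⟨C ⟨a, ha⟩, fun z _ => by rw [map_C, aeval_C]; rfl⟩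

lemma PolyHolo.smul {a : ℂ → ℂ} (ha : DifferentiableOn ℂ a V) (h : PolyHolo v V g) :
    PolyHolo v V fun z => a z • g z :=
  ((PolyHolo.of_holo ha).mul h).congr fun _ _ => Algebra.smul_def _ _

lemma PolyHolo.const (c : ℂ) : PolyHolo v V fun _ => algebraMap ℂ 𝔸 c :=
  PolyHolo.of_holo (differentiableOn_const c)

lemma PolyHolo.one : PolyHolo v V fun _ => (1 : 𝔸) :=
  (PolyHolo.const 1).congr fun _ _ => by simp

lemma PolyHolo.self : PolyHolo v V v := ⟨X, fun z _ => by simp⟩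

lemma PolyHolo.neg (h : PolyHolo v V g) : PolyHolo v V fun z => - g z :=
  ((PolyHolo.const (-1)).mul h).congr fun z _ => by simp

lemma PolyHolo.sub (h : PolyHolo v V g) (h' : PolyHolo v V g') :
    PolyHolo v V fun z => g z - g' z :=
  (h.add h'.neg).congr fun _ _ => sub_eq_add_neg _ _

lemma PolyHolo.pow (h : PolyHolo v V g) (m : ℕ) : PolyHolo v V fun z => g z ^ m := by
  obtain ⟨P, hP⟩ := h
  exact ⟨P ^ m, fun z hz => by
    beta_reduce
    rw [hP z hz, Polynomial.map_pow, map_pow]⟩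

lemma PolyHolo.aeval (h : PolyHolo v V g) (q : ℂ[X]) :
    PolyHolo v V fun z => Polynomial.aeval (g z) q := by
  induction q using Polynomial.induction_on' with
  | add p q hp hq => exact (hp.add hq).congr fun z _ => map_add _ _ _
  | monomial m a => exact ((PolyHolo.const a).mul (h.pow m)).congr fun z _ => aeval_monomial _

lemma PolyHolo.exists_coeff (h : PolyHolo v V g) : ∃ (N : ℕ) (a : ℕ → ℂ → ℂ),
    (∀ j, DifferentiableOn ℂ (a j) V) ∧
    ∀ z ∈ V, g z = ∑ j ∈ Finset.range N, a j z • v z ^ j := by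
  obtain ⟨P, hP⟩ := h
  refine ⟨P.natDegree + 1, fun j => P.coeff j, fun j => (P.coeff j).2, fun z hz => ?_⟩
  conv_lhs => rw [hP z hz, P.as_sum_range_C_mul_X_pow, Polynomial.map_sum, map_sum]
  refine Finset.sum_congr rfl fun j _ => ?_
  rw [Polynomial.map_mul, Polynomial.map_pow, map_C, map_X, map_mul, map_pow, aeval_X, aeval_C,
    Algebra.smul_def]
  rfl

lemma PolyHolo.differentiableOn (h : PolyHolo v V g) (hv : DifferentiableOn ℂ v V) :
    DifferentiableOn ℂ g V := by
  obtain ⟨N, a, ha, hg⟩ := h.exists_coeff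
  exact (DifferentiableOn.fun_sum fun j _ => (ha j).fun_smul (hv.fun_pow j)).congr hg

lemma commute_sum_smul_pow {x C : 𝔸} (h : Commute x C) (N : ℕ) (a : ℕ → ℂ) :
    Commute (∑ j ∈ Finset.range N, a j • x ^ j) C :=
  Commute.sum_left _ _ _ fun j _ => (h.pow_left j).smul_left _

lemma PolyHolo.commute (h : PolyHolo v V g) {z : ℂ} (hz : z ∈ V) {C : 𝔸} (hC : Commute (v z) C) :
    Commute (g z) C := by
  obtain ⟨N, a, ha, hg⟩ := h.exists_coeff
  rw [hg z hz]
  exact commute_sum_smul_pow hC N _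

end PolyHolo

section Exp
variable {𝔸 : Type*} [NormedRing 𝔸] [NormedAlgebra ℂ 𝔸]

lemma commute_exp {x C : 𝔸} (h : Commute x C) : Commute (NormedSpace.exp x) C := by
  let +nondep : NormedAlgebra ℚ 𝔸 := .restrictScalars ℚ ℂ 𝔸
  exact h.exp_left

variable [CompleteSpace 𝔸]

lemma exp_add_of_commute {x y : 𝔸} (h : Commute x y) :
    NormedSpace.exp (x + y) = NormedSpace.exp x * NormedSpace.exp y := by
  let +nondep : NormedAlgebra ℚ 𝔸 := .restrictScalars ℚ ℂ 𝔸
  exact NormedSpace.exp_add_of_commute h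

lemma isUnit_exp (x : 𝔸) : IsUnit (NormedSpace.exp x) := by
  let +nondep : NormedAlgebra ℚ 𝔸 := .restrictScalars ℚ ℂ 𝔸
  exact NormedSpace.isUnit_exp x

lemma differentiable_exp : Differentiable ℂ (NormedSpace.exp : 𝔸 → 𝔸) :=
  fun x => (NormedSpace.exp_analytic (𝕂 := ℂ) x).differentiableAt

variable {v : ℂ → 𝔸}

lemma exists_exp_factor {O K L : Set ℂ} (hv : DifferentiableOn ℂ v O)
    (hK : IsCompact K) (hKO : K ⊆ O) {p : ℂ} (hp : PolePush ℂ K L p) {r R R' : ℝ} (hr : 0 ≤ r)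
    (hrR : r < R') (hR : R' < R) (hKR : ∀ z ∈ K, R ≤ dist z p) (hRO : ball p R ⊆ O) {ℓ : ℂ → 𝔸}
    (hℓ : PolyHolo v {z | r < dist z p ∧ dist z p < R} ℓ) {ε : ℝ} (hε : 0 < ε) :
    ∃ E : Set ℂ, E.Finite ∧ Disjoint E L ∧ ∃ w β : ℂ → 𝔸,
      DifferentiableOn ℂ w (O \ (E ∪ closedBall p r)) ∧
      (∀ z, IsUnit (w z) ∧ ∀ C, Commute (v z) C → Commute (w z) C) ∧
      (∀ z ∈ K, ‖w z - 1‖ ≤ ε) ∧ DifferentiableOn ℂ β (ball p R' \ E) ∧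
      (∀ z C, Commute (v z) C → Commute (β z) C) ∧
      ∀ z, r < dist z p → dist z p < R' →
        w z * NormedSpace.exp (ℓ z) = NormedSpace.exp (β z) := by
  obtain ⟨N, a, ha, hℓa⟩ := hℓ.exists_coeff
  choose a₁ a₂ h₁ h₂ h12 using fun j => exists_laurent_split hr hrR hR (ha j)
  obtain ⟨δ, hδ, hexp⟩ := Metric.continuous_iff.1 (differentiable_exp (𝔸 := 𝔸)).continuous 0 ε hε
  have hbound : ∃ M > 0, ∀ j ∈ Finset.range N, ∀ z ∈ K, ‖v z ^ j‖ ≤ M := by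
    choose M hM using fun j : ℕ => hK.exists_bound_of_continuousOn
      ((hv.continuousOn.mono hKO).pow j)
    refine ⟨∑ j ∈ Finset.range N, |M j| + 1, by positivity, fun j hj z hz => ?_⟩
    have := Finset.single_le_sum (f := fun j => |M j|) (fun i _ => abs_nonneg _) hj
    have h2 : ‖v z ^ j‖ ≤ M j := hM j z hz
    linarith [le_abs_self (M j)]
  obtain ⟨M, hM0, hM⟩ := hbound
  have hη : 0 < δ / (2 * (N + 1) * M) := by positivity
  choose F hF hFL f hf hfa using fun j => hp.outer hr (hrR.trans hR) hKR (h₁ j) hη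
  refine ⟨⋃ j ∈ Finset.range N, F j, (Finset.range N).finite_toSet.biUnion fun j _ => hF j,
    disjoint_iUnion₂_left.2 fun j _ => hFL j,
    fun z => NormedSpace.exp (∑ j ∈ Finset.range N, (f j z - a₁ j z) • v z ^ j),
    fun z => ∑ j ∈ Finset.range N, (f j z + a₂ j z) • v z ^ j, ?_, ?_, ?_, ?_, ?_, ?_⟩
  · refine differentiable_exp.comp_differentiableOn (DifferentiableOn.fun_sum fun j hj => ?_)
    refine (((hf j).mono fun z hz => ?_).sub ((h₁ j).1.mono fun z hz => ?_)).fun_smul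
      ((hv.mono sdiff_subset).fun_pow j)
    · exact fun h => hz.2 (Or.inl (mem_biUnion (x := j) hj h))
    · exact not_le.1 fun h => hz.2 (Or.inr (mem_closedBall.2 h))
  · exact fun z => ⟨isUnit_exp _, fun C hC => commute_exp (commute_sum_smul_pow hC N _)⟩
  · intro z hz
    have : ‖∑ j ∈ Finset.range N, (f j z - a₁ j z) • v z ^ j‖ < δ := by
      calc _ ≤ ∑ j ∈ Finset.range N, ‖(f j z - a₁ j z) • v z ^ j‖ := norm_sum_le _ _
        _ ≤ ∑ j ∈ Finset.range N, δ / (2 * (N + 1) * M) * M := by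
          refine Finset.sum_le_sum fun j hj => (norm_smul_le _ _).trans ?_
          refine mul_le_mul ?_ (hM j hj z hz) (norm_nonneg _) hη.le
          rw [norm_sub_rev]
          exact hfa j z hz
        _ < δ := by
          rw [Finset.sum_const, Finset.card_range, nsmul_eq_mul]
          have : (N : ℝ) * (δ / (2 * (N + 1) * M) * M) = δ * (N / (2 * (N + 1))) := by
            field_simp
          rw [this]
          refine mul_lt_of_lt_one_right hδ ((div_lt_one (by positivity)).2 ?_)
          linarith [(Nat.cast_nonneg N : (0:ℝ) ≤ N)]
    have := hexp _ (by rwa [dist_zero_right])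
    rw [NormedSpace.exp_zero, dist_eq_norm] at this
    exact this.le
  · refine DifferentiableOn.fun_sum fun j hj => ?_
    refine (((hf j).mono fun z hz => ?_).add ((h₂ j).mono sdiff_subset)).fun_smul
      ((hv.mono fun z hz => hRO (ball_subset_ball hR.le hz.1)).fun_pow j)
    exact fun h => hz.2 (mem_biUnion (x := j) hj h)
  · exact fun z C hC => commute_sum_smul_pow hC N _
  · intro z h1 h2
    rw [hℓa z ⟨h1, h2.trans hR⟩]
    have hc : Commute (∑ j ∈ Finset.range N, (f j z - a₁ j z) • v z ^ j)
        (∑ j ∈ Finset.range N, a j z • v z ^ j) :=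
      commute_sum_smul_pow (commute_sum_smul_pow (Commute.refl _) _ _).symm _ _
    rw [← exp_add_of_commute hc, ← Finset.sum_add_distrib]
    congr 1
    refine Finset.sum_congr rfl fun j _ => ?_
    rw [← add_smul, h12 j z h1 h2]
    congr 1
    ring

end Exp

section Bicommutant
variable {𝔸 : Type*} [NormedRing 𝔸]

/-- At `z₀`, the function `w` commutes with every function which, near `z₀`, is continuous and
commutes with `v`. -/
def BicAt (v w : ℂ → 𝔸) (z₀ : ℂ) : Prop :=
  ∀ C : ℂ → 𝔸, (∀ᶠ z in 𝓝 z₀, ContinuousAt C z ∧ Commute (v z) (C z)) → Commute (w z₀) (C z₀)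

variable {v w w' : ℂ → 𝔸} {z₀ : ℂ}

lemma BicAt.of_commute (h : ∀ C, Commute (v z₀) C → Commute (w z₀) C) : BicAt v w z₀ :=
  fun _ hC => h _ hC.self_of_nhds.2

lemma BicAt.one : BicAt v (fun _ => 1) z₀ := .of_commute fun C _ => Commute.one_left C

lemma BicAt.mul (h : BicAt v w z₀) (h' : BicAt v w' z₀) : BicAt v (fun z => w z * w' z) z₀ :=
  fun C hC => (h C hC).mul_left (h' C hC)

lemma BicAt.congr (h : BicAt v w z₀) (hw : w' z₀ = w z₀) : BicAt v w' z₀ :=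
  fun C hC => by rw [hw]; exact h C hC

lemma BicAt.of_punctured (h : ∀ᶠ z in 𝓝[≠] z₀, BicAt v w z) (hw : ContinuousAt w z₀) :
    BicAt v w z₀ := by
  intro C hC
  have hCc : ContinuousAt C z₀ := hC.self_of_nhds.1
  have ev : (fun z => w z * C z) =ᶠ[𝓝[≠] z₀] fun z => C z * w z := by
    filter_upwards [h, hC.eventually_nhds.filter_mono nhdsWithin_le_nhds] with z h1 h2
    exact h1 C h2
  exact tendsto_nhds_unique_of_eventuallyEq ((hw.mul hCc).mono_left nhdsWithin_le_nhds)
    ((hCc.mul hw).mono_left nhdsWithin_le_nhds) ev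

lemma BicAt.eventually_commute {d : ℂ} {y : ℂ → 𝔸} (h : ∀ᶠ z in 𝓝[≠] d, BicAt v w z)
    (hy : ∀ᶠ z in 𝓝[≠] d, ContinuousAt y z ∧ Commute (v z) (y z)) :
    ∀ᶠ z in 𝓝[≠] d, Commute (w z) (y z) := by
  filter_upwards [h, eventually_eventually_nhdsWithin.2 hy, self_mem_nhdsWithin] with z h1 h2 h3
  rw [IsOpen.nhdsWithin_eq isOpen_compl_singleton h3] at h2
  exact h1 y h2

lemma norm_mul_sub_one_le {a b : 𝔸} {ε : ℝ} (ha : ‖a - 1‖ ≤ min 1 (ε / 3))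
    (hb : ‖b - 1‖ ≤ min 1 (ε / 3)) : ‖a * b - 1‖ ≤ ε := by
  have : a * b - 1 = (a - 1) * (b - 1) + (a - 1) + (b - 1) := by noncomm_ring
  have h1 := norm_add₃_le (a := (a - 1) * (b - 1)) (b := a - 1) (c := b - 1)
  have h2 := norm_mul_le (a - 1) (b - 1)
  rw [this]
  have := le_min_iff.1 ha
  have := le_min_iff.1 hb
  have : ‖a - 1‖ * ‖b - 1‖ ≤ 1 * (ε / 3) := by gcongr <;> tauto
  linarith

end Bicommutant

section Idempotent
variable {𝔸 : Type*} [NormedRing 𝔸] [NormedAlgebra ℂ 𝔸]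

/-- The element acting as `a` on the range of the idempotent `P` and as `1` on its kernel. -/
def idem (P : 𝔸) (a : ℂ) : 𝔸 := 1 - P + a • P

variable {P : 𝔸}

lemma idem_mul (hP : P * P = P) (a b : ℂ) : idem P a * idem P b = idem P (a * b) := by
  simp only [idem, mul_add, add_mul, mul_sub, sub_mul, mul_smul_comm, smul_mul_assoc, hP, one_mul,
    mul_one, mul_smul]
  module

lemma idem_one : idem P 1 = 1 := by simp [idem]

lemma isUnit_idem (hP : P * P = P) {a : ℂ} (ha : a ≠ 0) : IsUnit (idem P a) :=
  ⟨⟨idem P a, idem P a⁻¹, by rw [idem_mul hP, mul_inv_cancel₀ ha, idem_one],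
    by rw [idem_mul hP, inv_mul_cancel₀ ha, idem_one]⟩, rfl⟩

lemma commute_idem {C : 𝔸} (h : Commute P C) (a : ℂ) : Commute (idem P a) C :=
  ((Commute.one_left C).sub_left h).add_left (h.smul_left a)

lemma exp_smul_idempotent [CompleteSpace 𝔸] (hP : P * P = P) (c : ℂ) :
    NormedSpace.exp (c • P) = idem P (Complex.exp c) := by
  have h1 := NormedSpace.exp_series_hasSum_exp' (𝕂 := ℂ) (c • P)
  have h2 : HasSum (fun m : ℕ => ((m.factorial⁻¹ : ℂ) • c ^ m) • P) (Complex.exp c • P) := by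
    have := (NormedSpace.exp_series_hasSum_exp' (𝕂 := ℂ) c).smul_const P
    rwa [← Complex.exp_eq_exp_ℂ] at this
  have h3 := (hasSum_ite_eq (0 : ℕ) (1 - P)).add h2
  refine h1.unique (h3.congr_fun fun m => ?_)
  rcases m with _ | m
  · simp
  · have : P ^ (m + 1) = P := by
      induction m with
      | zero => simp
      | succ m ih => rw [pow_succ, ih, hP]
    simp [smul_pow, this, smul_smul]

lemma PolyHolo.idem {v : ℂ → 𝔸} {V : Set ℂ} {Q : ℂ → 𝔸} {a : ℂ → ℂ} (hQ : PolyHolo v V Q)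
    (ha : DifferentiableOn ℂ a V) : PolyHolo v V fun z => idem (Q z) (a z) :=
  (PolyHolo.one.sub hQ).add (hQ.smul ha)

end Idempotent

section Kill
variable {𝔸 : Type*} [NormedRing 𝔸] [NormedAlgebra ℂ 𝔸]

/-- The singularity at `d` of `y` can be removed, inside `L`, by a factor which is close to `1` on
`K` and lies in the bicommutant of `v`. -/
def Kill (O K L : Set ℂ) (v : ℂ → 𝔸) (d : ℂ) (y : ℂ → 𝔸) : Prop :=
  ∀ ε > 0, ∃ E : Set ℂ, E.Finite ∧ Disjoint E L ∧ ∃ w : ℂ → 𝔸,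
    DifferentiableOn ℂ w (O \ insert d E) ∧ (∀ z ∈ O \ insert d E, IsUnit (w z) ∧ BicAt v w z) ∧
    (∀ z ∈ K, ‖w z - 1‖ ≤ ε) ∧
    (d ∈ L → ∃ ρ > 0, ∃ q : ℂ → 𝔸, DifferentiableOn ℂ q (ball d ρ) ∧ IsUnit (q d) ∧
      ∀ z ∈ ball d ρ, z ≠ d → q z = w z * y z)

variable {O K L : Set ℂ} {v : ℂ → 𝔸} {d : ℂ} {y y₁ y₂ : ℂ → 𝔸}

lemma Kill.of_notMem (hd : d ∉ L) : Kill O K L v d y := fun ε hε =>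
  ⟨∅, finite_empty, empty_disjoint _, fun _ => 1, differentiableOn_const 1,
    fun _ _ => ⟨isUnit_one, .one⟩, fun _ _ => by simpa using hε.le, fun h => (hd h).elim⟩

lemma Kill.of_isUnit {ρ : ℝ} (hρ : 0 < ρ) (hy : DifferentiableOn ℂ y (ball d ρ))
    (hyd : IsUnit (y d)) : Kill O K L v d y := fun ε hε =>
  ⟨∅, finite_empty, empty_disjoint _, fun _ => 1, differentiableOn_const 1,
    fun _ _ => ⟨isUnit_one, .one⟩, fun _ _ => by simpa using hε.le,
    fun _ => ⟨ρ, hρ, y, hy, hyd, fun z _ _ => (one_mul _).symm⟩⟩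

lemma Kill.congr (h : Kill O K L v d y₁) (hy : ∀ᶠ z in 𝓝[≠] d, y₁ z = y₂ z) :
    Kill O K L v d y₂ := by
  obtain ⟨R, hR, hyR⟩ := exists_punctured_ball hy
  intro ε hε
  obtain ⟨E, hE, hEL, w, hw, hwu, hwK, hq⟩ := h ε hε
  refine ⟨E, hE, hEL, w, hw, hwu, hwK, fun hd => ?_⟩
  obtain ⟨ρ, hρ, q, hq, hqd, hqw⟩ := hq hd
  refine ⟨min ρ R, lt_min hρ hR, q, hq.mono (ball_subset_ball (min_le_left _ _)), hqd,
    fun z hz hzd => ?_⟩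
  rw [hqw z (ball_subset_ball (min_le_left _ _) hz) hzd,
    hyR z (dist_pos.2 hzd) (lt_of_lt_of_le hz (min_le_right _ _))]

lemma eventually_mem_diff_insert (hO : IsOpen O) (hd : d ∈ O) {E : Set ℂ} (hE : E.Finite)
    (hdE : d ∉ E) : ∀ᶠ z in 𝓝[≠] d, z ∈ O \ insert d E := by
  filter_upwards [self_mem_nhdsWithin, mem_nhdsWithin_of_mem_nhds
    ((hO.inter hE.isClosed.isOpen_compl).mem_nhds ⟨hd, hdE⟩)] with z h1 h2
  exact ⟨h2.1, fun h => h.elim h1 h2.2⟩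

lemma Kill.mul (hO : IsOpen O) (hd : d ∈ O) (h₁ : Kill O K L v d y₁) (h₂ : Kill O K L v d y₂)
    (hc : ∀ᶠ z in 𝓝[≠] d, ContinuousAt y₁ z ∧ Commute (v z) (y₁ z)) :
    Kill O K L v d fun z => y₁ z * y₂ z := by
  intro ε hε
  obtain ⟨E₁, hE₁, hEL₁, w₁, hw₁, hwu₁, hwK₁, hq₁⟩ := h₁ (min 1 (ε / 3)) (by positivity)
  obtain ⟨E₂, hE₂, hEL₂, w₂, hw₂, hwu₂, hwK₂, hq₂⟩ := h₂ (min 1 (ε / 3)) (by positivity)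
  have s₁ : O \ insert d (E₁ ∪ E₂) ⊆ O \ insert d E₁ :=
    sdiff_subset_sdiff_right (insert_subset_insert subset_union_left)
  have s₂ : O \ insert d (E₁ ∪ E₂) ⊆ O \ insert d E₂ :=
    sdiff_subset_sdiff_right (insert_subset_insert subset_union_right)
  refine ⟨E₁ ∪ E₂, hE₁.union hE₂, disjoint_union_left.2 ⟨hEL₁, hEL₂⟩, fun z => w₁ z * w₂ z,
    (hw₁.mono s₁).mul (hw₂.mono s₂), fun z hz => ⟨(hwu₁ z (s₁ hz)).1.mul (hwu₂ z (s₂ hz)).1,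
    (hwu₁ z (s₁ hz)).2.mul (hwu₂ z (s₂ hz)).2⟩,
    fun z hz => norm_mul_sub_one_le (hwK₁ z hz) (hwK₂ z hz), fun hdL => ?_⟩
  obtain ⟨ρ₁, hρ₁, q₁, hq₁, hqd₁, hqw₁⟩ := hq₁ hdL
  obtain ⟨ρ₂, hρ₂, q₂, hq₂, hqd₂, hqw₂⟩ := hq₂ hdL
  have hcomm : ∀ᶠ z in 𝓝[≠] d, Commute (w₂ z) (y₁ z) :=
    BicAt.eventually_commute ((eventually_mem_diff_insert hO hd hE₂
      fun h => hEL₂.notMem_of_mem_left h hdL).mono fun z hz => (hwu₂ z hz).2) hc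
  obtain ⟨R, hR, hyR⟩ := exists_punctured_ball hcomm
  have m₁ : min (min ρ₁ ρ₂) R ≤ ρ₁ := (min_le_left _ _).trans (min_le_left _ _)
  have m₂ : min (min ρ₁ ρ₂) R ≤ ρ₂ := (min_le_left _ _).trans (min_le_right _ _)
  refine ⟨min (min ρ₁ ρ₂) R, lt_min (lt_min hρ₁ hρ₂) hR, fun z => q₁ z * q₂ z,
    (hq₁.mono (ball_subset_ball m₁)).mul (hq₂.mono (ball_subset_ball m₂)), hqd₁.mul hqd₂,
    fun z hz hzd => ?_⟩
  beta_reduce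
  rw [hqw₁ z (ball_subset_ball m₁ hz) hzd, hqw₂ z (ball_subset_ball m₂ hz) hzd]
  have := (hyR z (dist_pos.2 hzd) (lt_of_lt_of_le hz (min_le_right _ _))).eq
  simp only [mul_assoc]
  rw [← mul_assoc (y₁ z), ← this, mul_assoc]

variable [CompleteSpace 𝔸]

lemma Kill.of_exp (hv : DifferentiableOn ℂ v O) (hK : IsCompact K) (hKO : K ⊆ O)
    (hp : PolePush ℂ K L d) {R : ℝ} (hR : 0 < R) (hKR : ∀ z ∈ K, R ≤ dist z d)
    (hRO : ball d R ⊆ O) {ℓ : ℂ → 𝔸} (hℓ : PolyHolo v (ball d R \ {d}) ℓ) :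
    Kill O K L v d fun z => NormedSpace.exp (ℓ z) := by
  intro ε hε
  obtain ⟨E, hE, hEL, w, β, hw, hwu, hwK, hβ, -, hwβ⟩ := exists_exp_factor hv hK hKO hp le_rfl
    (half_pos hR) (half_lt_self hR) hKR hRO (hℓ.mono fun z hz => ⟨hz.2, dist_pos.1 hz.1⟩) hε
  refine ⟨E, hE, hEL, w, hw.mono ?_, fun z _ => ⟨(hwu z).1, .of_commute (hwu z).2⟩, hwK,
    fun hd => ?_⟩
  · rw [closedBall_zero, union_singleton]
  · obtain ⟨ρ, hρ, hball⟩ := Metric.isOpen_iff.1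
      (isOpen_ball.inter hE.isClosed.isOpen_compl : IsOpen (ball d (R / 2) ∩ Eᶜ)) d
      ⟨mem_ball_self (half_pos hR), fun h => hEL.notMem_of_mem_left h hd⟩
    exact ⟨ρ, hρ, fun z => NormedSpace.exp (β z),
      differentiable_exp.comp_differentiableOn (hβ.mono hball), isUnit_exp _,
      fun z hz hzd => (hwβ z (dist_pos.2 hzd) (hball hz).1).symm⟩

end Kill

section Transfer
variable {𝔸 : Type*} [NormedRing 𝔸] [NormedAlgebra ℂ 𝔸] [CompleteSpace 𝔸]
variable {O K L : Set ℂ} {v : ℂ → 𝔸}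

/-- The ratio `(z - q) / (z - q')` stays in the slit plane when `z` is far from `q` and `q'`. -/
lemma sub_div_sub_mem_slitPlane {z p q q' : ℂ} {R : ℝ} (hz : R / 2 < dist z p)
    (hq : dist q p < R / 8) (hq' : dist q' p < R / 8) : (z - q) / (z - q') ∈ slitPlane := by
  have h1 : R / 4 < ‖z - q'‖ := by
    have := dist_triangle z q' p
    rw [← dist_eq_norm]
    have : 0 < R := by linarith [dist_nonneg (x := q) (y := p)]
    linarith
  have h2 : ‖q' - q‖ < R / 4 := by
    rw [← dist_eq_norm]
    linarith [dist_triangle_right q' q p]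
  have h0 : z - q' ≠ 0 := norm_pos_iff.1 (lt_of_le_of_lt (by
    linarith [dist_nonneg (x := q) (y := p)]) h1)
  have : (z - q) / (z - q') = 1 + (q' - q) / (z - q') := by field_simp; ring
  rw [this]
  refine Complex.mem_slitPlane_of_norm_lt_one ?_
  rw [norm_div, div_lt_one (norm_pos_iff.2 h0)]
  linarith

lemma Kill.transfer (hO : IsOpen O) (hv : DifferentiableOn ℂ v O) (hK : IsCompact K) (hKO : K ⊆ O)
    {p q q' : ℂ} (hp : PolePush ℂ K L p) {R : ℝ} (hKR : ∀ z ∈ K, R ≤ dist z p)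
    (hRO : ball p R ⊆ O) {P : ℂ → 𝔸} (hP : PolyHolo v (ball p R) P)
    (hPP : ∀ z ∈ ball p R, P z * P z = P z) (hq : dist q p < R / 8) (hq' : dist q' p < R / 8)
    (h : Kill O K L v q' fun z => idem (P z) (z - q')) :
    Kill O K L v q fun z => idem (P z) (z - q) := by
  rcases eq_or_ne q q' with rfl | hqq
  · exact h
  by_cases hqL : q ∉ L
  · exact .of_notMem hqL
  rw [not_not] at hqL
  intro ε hε
  have hR : 0 < R := by linarith [dist_nonneg (x := q) (y := p)]
  have hslit : ∀ z, R / 2 < dist z p → (z - q) / (z - q') ∈ slitPlane :=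
    fun z hz => sub_div_sub_mem_slitPlane hz hq hq'
  have hne : ∀ z, R / 2 < dist z p → z - q ≠ 0 ∧ z - q' ≠ 0 := fun z hz => by
    constructor <;> rintro h0 <;> simpa [h0] using hslit z hz
  have hℓ : PolyHolo v {z | R / 2 < dist z p ∧ dist z p < R}
      fun z => Complex.log ((z - q) / (z - q')) • P z := by
    refine PolyHolo.smul (fun z hz => DifferentiableAt.differentiableWithinAt ?_)
      (hP.mono fun z hz => hz.2)
    refine DifferentiableAt.clog ?_ (hslit z hz.1)
    exact (differentiableAt_id.sub_const q).div (differentiableAt_id.sub_const q') (hne z hz.1).2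
  obtain ⟨E₁, hE₁, hEL₁, w₁, β, hw₁, hwu₁, hwK₁, hβ, hβc, hwβ⟩ :=
    exists_exp_factor (R' := 3 * R / 4) hv hK hKO hp (by positivity : 0 ≤ R / 2) (by linarith)
      (by linarith) hKR hRO hℓ (ε := min 1 (ε / 3)) (by positivity)
  obtain ⟨E₂, hE₂, hEL₂, w₂, hw₂, hwu₂, hwK₂, hq₂⟩ := h (min 1 (ε / 3)) (by positivity)
  have hq'R : q' ∈ ball p (3 * R / 4) := mem_ball.2 (by linarith)
  have hqR : q ∈ ball p (3 * R / 4) := mem_ball.2 (by linarith)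
  have hballR : ball p (3 * R / 4) ⊆ ball p R := ball_subset_ball (by linarith)
  have hPd : DifferentiableOn ℂ P (ball p R) := hP.differentiableOn (hv.mono hRO)
  have hPc : ∀ {z}, z ∈ ball p (3 * R / 4) → ∀ {C}, Commute (v z) C → Commute (P z) C :=
    fun hz _ hC => hP.commute (hballR hz) hC
  have hPdz : ∀ {z}, z ∈ ball p (3 * R / 4) → DifferentiableAt ℂ P z := fun hz =>
    hPd.differentiableAt (isOpen_ball.mem_nhds (hballR hz))
  have hidem : ∀ {z} {a : ℂ → ℂ}, z ∈ ball p (3 * R / 4) → DifferentiableAt ℂ a z →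
      DifferentiableAt ℂ (fun z => idem (P z) (a z)) z := fun hz ha =>
    ((hPdz hz).const_sub 1).add (ha.fun_smul (hPdz hz))
  have hexp : ∀ {z}, z ∈ ball p (3 * R / 4) → z ∉ E₁ →
      DifferentiableAt ℂ (fun z => NormedSpace.exp (β z)) z := fun hz hzE =>
    (differentiable_exp _).comp _ (hβ.differentiableAt
      ((isOpen_ball.inter hE₁.isClosed.isOpen_compl).mem_nhds ⟨hz, hzE⟩))
  have hw₂d : ∀ {z}, z ∈ O → z ≠ q' → z ∉ E₂ → DifferentiableAt ℂ w₂ z := fun hz hzq hzE =>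
    hw₂.differentiableAt ((hO.inter (hE₂.insert q').isClosed.isOpen_compl).mem_nhds
      ⟨hz, fun h => h.elim hzq hzE⟩)
  have hannulus : ∀ z, R / 2 < dist z p → dist z p < 3 * R / 4 →
      NormedSpace.exp (β z) * idem (P z) ((z - q') / (z - q)) = w₁ z := by
    intro z hz hz'
    have hPz := hPP z (hballR hz')
    rw [← hwβ z hz hz', exp_smul_idempotent hPz, Complex.exp_log, mul_assoc, idem_mul hPz,
      div_mul_div_cancel₀ (hne z hz).2, div_self (hne z hz).1, idem_one, mul_one]
    exact slitPlane_ne_zero (hslit z hz)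
  -- the value of the new factor at `q'`
  obtain ⟨c, hc⟩ : ∃ c : 𝔸, q' ∈ L → IsUnit c ∧ ∃ e : ℂ → 𝔸, DifferentiableAt ℂ e q' ∧ e q' = c ∧
      ∀ᶠ z in 𝓝[≠] q', NormedSpace.exp (β z) * idem (P z) ((z - q') / (z - q)) * w₂ z = e z := by
    by_cases hq'L : q' ∈ L
    swap
    · exact ⟨1, fun h => (hq'L h).elim⟩
    obtain ⟨ρ, hρ, g, hg, hgq, hgw⟩ := hq₂ hq'L
    refine ⟨NormedSpace.exp (β q') * idem (P q') (q' - q)⁻¹ * g q', fun _ =>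
      ⟨((isUnit_exp _).mul (isUnit_idem (hPP q' (hballR hq'R))
        (inv_ne_zero (sub_ne_zero.2 hqq.symm)))).mul hgq,
      fun z => NormedSpace.exp (β z) * idem (P z) (z - q)⁻¹ * g z, ?_, rfl, ?_⟩⟩
    · refine ((hexp hq'R fun h => hEL₁.notMem_of_mem_left h hq'L).mul (hidem hq'R ?_)).mul
        (hg.differentiableAt (ball_mem_nhds _ hρ))
      exact (differentiableAt_id.sub_const q).inv (sub_ne_zero.2 hqq.symm)
    · have hc := BicAt.eventually_commute (y := fun z => idem (P z) (z - q'))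
        ((eventually_mem_diff_insert hO (hRO (hballR hq'R)) hE₂
          fun h => hEL₂.notMem_of_mem_left h hq'L).mono fun z hz => (hwu₂ z hz).2)
        (mem_nhdsWithin_of_mem_nhds (isOpen_ball.mem_nhds hq'R) |> fun h => by
          filter_upwards [h] with z hz
          exact ⟨(hidem hz (differentiableAt_id.sub_const q')).continuousAt,
            (commute_idem (hPc hz (Commute.refl _)) _).symm⟩)
      filter_upwards [self_mem_nhdsWithin, mem_nhdsWithin_of_mem_nhds (ball_mem_nhds q' hρ),
        mem_nhdsWithin_of_mem_nhds (isOpen_ball.mem_nhds hq'R), hc] with z hz hzρ hzR hzc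
      rw [hgw z hzρ hz, hzc.eq, mul_assoc, mul_assoc, ← mul_assoc (idem _ _) (idem _ _),
        idem_mul (hPP z (hballR hzR)), mul_comm, div_eq_mul_inv]
  let W₀ : ℂ → 𝔸 := fun z => if dist z p < 3 * R / 4 then
    NormedSpace.exp (β z) * idem (P z) ((z - q') / (z - q)) * w₂ z else w₁ z * w₂ z
  have hW₀ : ∀ z, R / 2 < dist z p → W₀ z = w₁ z * w₂ z := by
    intro z hz
    by_cases h : dist z p < 3 * R / 4
    · simp only [W₀, if_pos h, hannulus z hz h]
    · simp only [W₀, if_neg h]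
  have hW₀' : ∀ z ∈ ball p (3 * R / 4),
      W₀ z = NormedSpace.exp (β z) * idem (P z) ((z - q') / (z - q)) * w₂ z :=
    fun z hz => if_pos hz
  let W : ℂ → 𝔸 := Function.update W₀ q' c
  have hWne : ∀ z, z ≠ q' → W z = W₀ z := fun z hz => Function.update_of_ne hz _ _
  let E : Set ℂ := E₁ ∪ E₂ ∪ ({q'} \ L)
  have hE : E.Finite := (hE₁.union hE₂).union ((finite_singleton q').subset sdiff_subset)
  have hEL : Disjoint E L :=
    disjoint_union_left.2 ⟨disjoint_union_left.2 ⟨hEL₁, hEL₂⟩, disjoint_sdiff_left⟩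
  have main : ∀ z ∈ O \ insert q E, z ≠ q' → DifferentiableAt ℂ W z ∧ IsUnit (W z) ∧ BicAt v W z := by
    rintro z ⟨hzO, hzE⟩ hzq'
    have hzq : z ≠ q := fun h => hzE (.inl h)
    have hz₁ : z ∉ E₁ := fun h => hzE (.inr (.inl (.inl h)))
    have hz₂ : z ∉ E₂ := fun h => hzE (.inr (.inl (.inr h)))
    obtain ⟨hu₂, hb₂⟩ := hwu₂ z ⟨hzO, fun h => h.elim hzq' hz₂⟩
    by_cases hzR : dist z p < 3 * R / 4
    · refine ⟨?_, ?_, ?_⟩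
      · refine DifferentiableAt.congr_of_eventuallyEq (((hexp hzR hz₁).mul (hidem hzR ?_)).mul
          (hw₂d hzO hzq' hz₂)) ?_ (f := fun z =>
            NormedSpace.exp (β z) * idem (P z) ((z - q') / (z - q)) * w₂ z)
        · exact (differentiableAt_id.sub_const q').div (differentiableAt_id.sub_const q)
            (sub_ne_zero.2 hzq)
        · filter_upwards [isOpen_ball.mem_nhds hzR, isOpen_ne.mem_nhds hzq'] with x hx hx'
          rw [hWne x hx', hW₀' x hx]
      · rw [hWne z hzq', hW₀' z hzR]
        exact ((isUnit_exp _).mul (isUnit_idem (hPP z (hballR hzR))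
          (div_ne_zero (sub_ne_zero.2 hzq') (sub_ne_zero.2 hzq)))).mul hu₂
      · refine BicAt.congr (BicAt.mul (w := fun z => NormedSpace.exp (β z) *
          idem (P z) ((z - q') / (z - q))) (.of_commute fun C hC => ?_) hb₂)
          ((hWne z hzq').trans (hW₀' z hzR))
        exact (commute_exp (hβc z C hC)).mul_left (commute_idem (hPc hzR hC) _)
    · have hzR' : R / 2 < dist z p := by linarith
      refine ⟨?_, ?_, ?_⟩
      · refine DifferentiableAt.congr_of_eventuallyEq ((hw₁.differentiableAt
          ((hO.inter (hE₁.isClosed.union isClosed_closedBall).isOpen_compl).mem_nhds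
          ⟨hzO, fun h => h.elim hz₁ fun h => ?_⟩)).mul (hw₂d hzO hzq' hz₂)) ?_
        · exact (not_le.2 hzR') h
        · filter_upwards [(isOpen_lt continuous_const (continuous_id.dist continuous_const)).mem_nhds
            hzR', isOpen_ne.mem_nhds hzq'] with x hx hx'
          rw [hWne x hx', hW₀ x hx]
          rfl
      · rw [hWne z hzq', hW₀ z hzR']
        exact (hwu₁ z).1.mul hu₂
      · exact BicAt.congr (BicAt.mul (.of_commute (hwu₁ z).2) hb₂) ((hWne z hzq').trans (hW₀ z hzR'))
  have mainAt : ∀ z ∈ O \ insert q E, DifferentiableAt ℂ W z ∧ IsUnit (W z) ∧ BicAt v W z := by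
    intro z hz
    by_cases hzq' : z ≠ q'
    · exact main z hz hzq'
    rw [not_not] at hzq'
    subst hzq'
    have hzL : z ∈ L := by
      by_contra h
      exact hz.2 (.inr (.inr ⟨rfl, h⟩))
    obtain ⟨hcu, e, hed, hec, he⟩ := hc hzL
    have hWz : W z = c := Function.update_self _ _ _
    have hWd : DifferentiableAt ℂ W z := by
      refine hed.congr_of_eventuallyEq ?_
      have : ∀ᶠ x in 𝓝[≠] z, W x = e x := by
        filter_upwards [self_mem_nhdsWithin, he,
          mem_nhdsWithin_of_mem_nhds (isOpen_ball.mem_nhds hq'R)] with x hx hxe hxR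
        rw [hWne x hx, hW₀' x hxR, hxe]
      filter_upwards [eventually_nhdsWithin_iff.1 this] with x hx
      by_cases hxz : x = z
      · rw [hxz, hWz, hec]
      · exact hx hxz
    refine ⟨hWd, hWz ▸ hcu, .of_punctured ?_ hWd.continuousAt⟩
    filter_upwards [self_mem_nhdsWithin, mem_nhdsWithin_of_mem_nhds
      ((hO.inter (hE.insert q).isClosed.isOpen_compl).mem_nhds hz)] with x hx hx'
    exact (main x hx' hx).2.2
  refine ⟨E, hE, hEL, W, fun z hz => (mainAt z hz).1.differentiableWithinAt,
    fun z hz => (mainAt z hz).2, fun z hz => ?_, fun _ => ?_⟩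
  · have hz1 := hKR z hz
    have hzq' : z ≠ q' := by
      rintro rfl
      linarith
    rw [hWne z hzq', hW₀ z (by linarith)]
    exact norm_mul_sub_one_le (hwK₁ z hz) (hwK₂ z hz)
  · have hq₁ : q ∉ E₁ := fun h => hEL₁.notMem_of_mem_left h hqL
    have hq₂ : q ∉ E₂ := fun h => hEL₂.notMem_of_mem_left h hqL
    obtain ⟨ρ, hρ, hball⟩ := Metric.isOpen_iff.1
      (isOpen_ball.inter ((hE₁.union hE₂).insert q').isClosed.isOpen_compl) q
      (⟨hqR, by rintro (h | h | h) <;> contradiction⟩ : q ∈ ball p (3 * R / 4) ∩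
        (insert q' (E₁ ∪ E₂))ᶜ)
    have hx : ∀ z ∈ ball q ρ, z ∈ ball p (3 * R / 4) ∧ z ≠ q' ∧ z ∉ E₁ ∧ z ∉ E₂ := fun z hz =>
      ⟨(hball hz).1, fun h => (hball hz).2 (.inl h), fun h => (hball hz).2 (.inr (.inl h)),
        fun h => (hball hz).2 (.inr (.inr h))⟩
    refine ⟨ρ, hρ, fun z => NormedSpace.exp (β z) * idem (P z) (z - q') * w₂ z, fun z hz => ?_,
      ?_, fun z hz hzq => ?_⟩
    · obtain ⟨h1, h2, h3, h4⟩ := hx z hz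
      exact (((hexp h1 h3).mul (hidem h1 (differentiableAt_id.sub_const q'))).mul
        (hw₂d (hRO (hballR h1)) h2 h4)).differentiableWithinAt
    · exact ((isUnit_exp _).mul (isUnit_idem (hPP q (hballR hqR)) (sub_ne_zero.2 hqq))).mul
        (hwu₂ q ⟨hRO (hballR hqR), by rintro (h | h) <;> contradiction⟩).1
    · obtain ⟨h1, h2, h3, h4⟩ := hx z hz
      have hcomm : Commute (w₂ z) (idem (P z) (z - q)) := by
        refine (hwu₂ z ⟨hRO (hballR h1), fun h => h.elim h2 h4⟩).2 (fun z => idem (P z) (z - q)) ?_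
        filter_upwards [isOpen_ball.mem_nhds h1] with x hx
        exact ⟨(hidem hx (differentiableAt_id.sub_const q)).continuousAt,
          (commute_idem (hPc hx (Commute.refl _)) _).symm⟩
      beta_reduce
      rw [hWne z h2, hW₀' z h1, mul_assoc _ (w₂ z), hcomm.eq, ← mul_assoc,
        mul_assoc (NormedSpace.exp _) (idem _ _) (idem _ _), idem_mul (hPP z (hballR h1)),
        div_mul_cancel₀ _ (sub_ne_zero.2 hzq)]

end Transfer

section ExpLog
open Polynomial
variable {𝔸 : Type*} [NormedRing 𝔸] [NormedAlgebra ℂ 𝔸]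

lemma exp_eq_sum_of_pow_eq_zero {x : 𝔸} {m : ℕ} (hx : x ^ m = 0) :
    NormedSpace.exp x = aeval x (∑ i ∈ Finset.range m, C ((i.factorial : ℂ)⁻¹) * X ^ i) := by
  rw [NormedSpace.exp_eq_tsum ℂ]
  beta_reduce
  rw [tsum_eq_sum (s := Finset.range m), map_sum]
  · refine Finset.sum_congr rfl fun i _ => ?_
    rw [map_mul, aeval_C, map_pow, aeval_X, Algebra.smul_def]
  · intro i hi
    rw [pow_eq_zero_of_le (not_lt.1 fun h => hi (Finset.mem_range.2 h)) hx, smul_zero]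

variable [CompleteSpace 𝔸]

lemma exists_exp_aeval_eq (m k : ℕ) : ∀ j, m ≤ j + 1 + k → ∀ s : ℂ[X], ∃ p : ℂ[X], ∀ N : 𝔸,
    N ^ m = 0 → NormedSpace.exp (aeval N p) = 1 + aeval N (X ^ (j + 1) * s) := by
  induction k with
  | zero =>
    intro j hj s
    refine ⟨0, fun N hN => ?_⟩
    rw [map_zero, NormedSpace.exp_zero, map_mul, map_pow, aeval_X, pow_eq_zero_of_le hj hN,
      zero_mul, add_zero]
  | succ k ih =>
    intro j hj s
    set q : ℂ[X] := X ^ (j + 1) * s with hq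
    let e : ℂ[X] := ∑ i ∈ Finset.range m, C (((i + 1 + 1).factorial : ℂ)⁻¹) * X ^ i
    obtain ⟨p, hp⟩ := ih (j + 1) (by omega) (X ^ j * s ^ 2 * (e.comp (-q) - 1 + q * e.comp (-q)))
    refine ⟨p + q, fun N hN => ?_⟩
    have hexp : NormedSpace.exp (- aeval N q) = aeval N (1 - q + q ^ 2 * e.comp (-q)) := by
      have hqN : (- aeval N q) ^ (m + 2) = 0 := by
        rw [neg_pow, ← map_pow, hq, mul_pow, ← pow_mul, map_mul, map_pow, aeval_X,
          pow_eq_zero_of_le (by nlinarith) hN, zero_mul, mul_zero]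
      have hsum : ∑ i ∈ Finset.range (m + 2), C ((i.factorial : ℂ)⁻¹) * X ^ i =
          1 + X + X ^ 2 * e := by
        rw [Finset.sum_range_succ', Finset.sum_range_succ', Finset.mul_sum]
        simp only [zero_add, Nat.factorial_zero, Nat.factorial_one, Nat.cast_one, inv_one, map_one,
          pow_zero, pow_one, mul_one, one_mul]
        rw [add_assoc, add_comm, add_comm X]
        exact congrArg _ (Finset.sum_congr rfl fun i _ => by ring)
      rw [exp_eq_sum_of_pow_eq_zero hqN, hsum, ← map_neg, ← aeval_comp]
      congr 1
      simp only [add_comp, one_comp, X_comp, mul_comp, pow_comp]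
      ring
    have hc : Commute (aeval N p) (aeval N q) := by
      rw [Commute, SemiconjBy, ← map_mul, mul_comm, map_mul]
    have key : 1 + aeval N (X ^ (j + 1 + 1) *
        (X ^ j * s ^ 2 * (e.comp (-q) - 1 + q * e.comp (-q)))) =
        (1 + aeval N q) * NormedSpace.exp (- aeval N q) := by
      rw [hexp, ← map_one (aeval (R := ℂ) N), ← map_add, ← map_add, ← map_mul]
      congr 1
      have : X ^ (j + 1 + 1) * (X ^ j * s ^ 2 * (e.comp (-q) - 1 + q * e.comp (-q))) =
        q ^ 2 * (e.comp (-q) - 1 + q * e.comp (-q)) := by rw [hq]; ring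
      rw [this]
      ring
    rw [map_add, exp_add_of_commute hc, hp N hN, key, mul_assoc,
      ← exp_add_of_commute (Commute.neg_left (Commute.refl _)), neg_add_cancel,
      NormedSpace.exp_zero, mul_one]

lemma exists_exp_aeval_eq_one_add (m : ℕ) : ∃ p : ℂ[X], ∀ N : 𝔸,
    N ^ m = 0 → NormedSpace.exp (aeval N p) = 1 + N := by
  obtain ⟨p, hp⟩ := exists_exp_aeval_eq (𝔸 := 𝔸) m m 0 (by omega) 1
  exact ⟨p, fun N hN => by simpa using hp N hN⟩

end ExpLog

section RootProjection
open Polynomial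
open scoped Matrix.Norms.Operator
variable {n : ℕ}

/-- The set of eigenvalues. -/
noncomputable def eigenvalueFinset (M : Matrix (Fin n) (Fin n) ℂ) : Finset ℂ :=
  M.charpoly.roots.toFinset

lemma mem_eigenvalueFinset {M : Matrix (Fin n) (Fin n) ℂ} {x : ℂ} :
    x ∈ eigenvalueFinset M ↔ x ∈ spectrum ℂ M := by
  rw [eigenvalueFinset, Multiset.mem_toFinset, mem_roots M.charpoly_monic.ne_zero,
    Matrix.mem_spectrum_iff_isRoot_charpoly]

lemma pow_eq_zero_of_spectrum {M : Matrix (Fin n) (Fin n) ℂ} (h : ∀ x ∈ spectrum ℂ M, x = 0) :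
    M ^ n = 0 := by
  have h1 := (IsAlgClosed.splits M.charpoly).eq_prod_roots_of_monic M.charpoly_monic
  have h2 : M.charpoly.roots = Multiset.replicate M.charpoly.natDegree 0 :=
    Multiset.eq_replicate.2 ⟨(IsAlgClosed.splits M.charpoly).natDegree_eq_card_roots.symm,
      fun x hx => h x (mem_eigenvalueFinset.1 (Multiset.mem_toFinset.2 hx))⟩
  have h3 := M.aeval_self_charpoly
  rw [h1, h2, Matrix.charpoly_natDegree_eq_dim] at h3
  simpa using h3

lemma aeval_pow_eq_zero {M : Matrix (Fin n) (Fin n) ℂ} {p : ℂ[X]}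
    (h : ∀ x ∈ spectrum ℂ M, p.eval x = 0) : aeval M p ^ n = 0 := by
  rcases n with _ | n
  · exact Subsingleton.elim _ _
  refine pow_eq_zero_of_spectrum fun x hx => ?_
  rw [spectrum.map_polynomial_aeval_of_nonempty _ _
    (spectrum.nonempty_of_isAlgClosed_of_finiteDimensional ℂ M)] at hx
  obtain ⟨y, hy, rfl⟩ := hx
  exact h y hy

lemma isUnit_aeval {M : Matrix (Fin n) (Fin n) ℂ} {p : ℂ[X]}
    (h : ∀ x ∈ spectrum ℂ M, p.eval x ≠ 0) : IsUnit (aeval M p) := by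
  rcases n with _ | n
  · exact isUnit_of_subsingleton _
  rw [← spectrum.zero_notMem_iff ℂ, spectrum.map_polynomial_aeval_of_nonempty _ _
    (spectrum.nonempty_of_isAlgClosed_of_finiteDimensional ℂ M)]
  rintro ⟨y, hy, hy0⟩
  exact h y hy hy0

/-- A polynomial which is idempotent modulo every polynomial with roots in `S` of multiplicity at
most `n`, and projects to the part belonging to the root `x`. -/
noncomputable def projPoly {R : Type*} [CommRing R] (n : ℕ) (p : R[X]) : R[X] :=
  1 - (1 - p ^ n) ^ n

/-- The projection to the generalized eigenspace of `M` for `x`. -/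
noncomputable def rootProj (M : Matrix (Fin n) (Fin n) ℂ) (x : ℂ) : Matrix (Fin n) (Fin n) ℂ :=
  aeval M (projPoly n (Lagrange.basis (eigenvalueFinset M) id x))

variable {M : Matrix (Fin n) (Fin n) ℂ} {x : ℂ}

lemma eval_basis_self (hx : x ∈ spectrum ℂ M) :
    (Lagrange.basis (eigenvalueFinset M) id x).eval x = 1 :=
  Lagrange.eval_basis_self (v := id) (injOn_id _) (mem_eigenvalueFinset.2 hx)

lemma eval_basis_of_ne {y : ℂ} (hy : y ∈ spectrum ℂ M) (hxy : x ≠ y) :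
    (Lagrange.basis (eigenvalueFinset M) id x).eval y = 0 :=
  Lagrange.eval_basis_of_ne (v := id) hxy (mem_eigenvalueFinset.2 hy)

lemma rootProj_mul_self (hx : x ∈ spectrum ℂ M) : rootProj M x * rootProj M x = rootProj M x := by
  set e := Lagrange.basis (eigenvalueFinset M) id x with he
  have h1 : aeval M (e * (1 - e)) ^ n = 0 := by
    refine aeval_pow_eq_zero fun y hy => ?_
    rcases eq_or_ne x y with rfl | hxy
    · simp [he, eval_basis_self hx]
    · simp [he, eval_basis_of_ne hy hxy]
  obtain ⟨c, hc⟩ : (e * (1 - e)) ^ n ∣ projPoly n e * (1 - projPoly n e) := by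
    rw [mul_pow]
    refine mul_dvd_mul ?_ ?_
    · have := sub_dvd_pow_sub_pow (1 : ℂ[X]) (1 - e ^ n) n
      simpa [projPoly] using this
    · have := pow_dvd_pow_of_dvd (sub_dvd_pow_sub_pow (1 : ℂ[X]) e n) n
      simpa [projPoly] using this
  have h2 : aeval M (projPoly n e * (1 - projPoly n e)) = 0 := by
    rw [hc, map_mul, map_pow, h1, zero_mul]
  rw [map_mul, map_sub, map_one, mul_sub, mul_one, sub_eq_zero] at h2
  exact h2.symm

lemma sub_mul_rootProj_pow (hx : x ∈ spectrum ℂ M) :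
    ((M - algebraMap ℂ _ x) * rootProj M x) ^ n = 0 := by
  set e := Lagrange.basis (eigenvalueFinset M) id x with he
  have : (M - algebraMap ℂ _ x) * rootProj M x = aeval M ((X - C x) * projPoly n e) := by
    simp [rootProj, he]
  rw [this]
  refine aeval_pow_eq_zero fun y hy => ?_
  rcases eq_or_ne x y with rfl | hxy
  · simp
  · rcases n with _ | n
    · exact (hy (isUnit_of_subsingleton _)).elim
    · simp [projPoly, he, eval_basis_of_ne hy hxy]

lemma isUnit_mul_one_sub_rootProj_add (h0 : (0 : ℂ) ∈ spectrum ℂ M) :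
    IsUnit (M * (1 - rootProj M 0) + rootProj M 0) := by
  set e := Lagrange.basis (eigenvalueFinset M) id 0 with he
  have : M * (1 - rootProj M 0) + rootProj M 0 =
      aeval M (X * (1 - projPoly n e) + projPoly n e) := by
    simp [rootProj, he]
  rw [this]
  refine isUnit_aeval fun y hy => ?_
  have hn : n ≠ 0 := by
    rintro rfl
    exact hy (isUnit_of_subsingleton _)
  rcases eq_or_ne 0 y with rfl | hxy
  · simp [projPoly, he, eval_basis_self h0, hn]
  · simpa [projPoly, he, eval_basis_of_ne hy hxy, hn] using hxy.symm

lemma basis_eq_of_range {k : ℕ} {r : Fin k → ℂ} (hr : Function.Injective r)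
    (hM : spectrum ℂ M = range r) (i : Fin k) : Lagrange.basis (eigenvalueFinset M) id (r i) =
      ∏ j ∈ Finset.univ.erase i, C (r i - r j)⁻¹ * (X - C (r j)) := by
  classical
  have : (eigenvalueFinset M).erase (r i) = (Finset.univ.erase i).image r := by
    ext y
    simp only [Finset.mem_erase, mem_eigenvalueFinset, hM, Finset.mem_image, mem_range,
      Finset.mem_univ, and_true]
    constructor
    · rintro ⟨h1, j, rfl⟩
      exact ⟨j, fun h => h1 (h ▸ rfl), rfl⟩
    · rintro ⟨j, h1, rfl⟩
      exact ⟨fun h => h1 (hr h), j, rfl⟩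
  rw [Lagrange.basis, this, Finset.prod_image hr.injOn]
  rfl

lemma polyHolo_rootProj {v : ℂ → Matrix (Fin n) (Fin n) ℂ} {V : Set ℂ} {k : ℕ}
    {r : Fin k → ℂ → ℂ} (hr : ∀ i, DifferentiableOn ℂ (r i) V)
    (h : ∀ z ∈ V, Function.Injective (fun i => r i z) ∧ spectrum ℂ (v z) = range fun i => r i z)
    (i : Fin k) : PolyHolo v V fun z => rootProj (v z) (r i z) := by
  classical
  have hd : ∀ j, DifferentiableOn ℂ (fun z => if j = i then 0 else (r i z - r j z)⁻¹) V := by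
    intro j
    by_cases hj : j = i
    · simp only [if_pos hj]
      exact differentiableOn_const 0
    · simp only [if_neg hj]
      exact ((hr i).sub (hr j)).inv fun z hz h0 =>
        hj ((h z hz).1 (sub_eq_zero.1 h0)).symm
  refine ⟨projPoly n (∏ j ∈ Finset.univ.erase i,
    C (⟨_, hd j⟩ : holRing V) * (X - C (⟨r j, hr j⟩ : holRing V))), fun z hz => ?_⟩
  beta_reduce
  rw [rootProj, basis_eq_of_range (h z hz).1 (h z hz).2 i]
  congr 1
  simp only [projPoly, Polynomial.map_sub, Polynomial.map_one, Polynomial.map_pow,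
    Polynomial.map_prod, Polynomial.map_mul, map_C, map_X, holRing.eval_apply]
  refine congrArg (fun q => 1 - (1 - q ^ n) ^ n) (Finset.prod_congr rfl fun j hj => ?_)
  rw [if_neg (Finset.ne_of_mem_erase hj)]

end RootProjection

section KillRoot
open scoped Matrix.Norms.Operator
variable {n : ℕ} {O K L U S : Set ℂ} {v : ℂ → Matrix (Fin n) (Fin n) ℂ}

lemma eventually_eq_branch {r : ℂ → ℂ} {k : ℕ} {b : Fin k → ℂ → ℂ} {q : ℂ}
    (hb : ∀ i, ContinuousAt (b i) q) (hinj : Function.Injective fun i => b i q)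
    (hbs : ∀ᶠ z in 𝓝 q, spectrum ℂ (v z) = range fun i => b i z) (hr : ContinuousAt r q)
    (hrs : ∀ᶠ z in 𝓝 q, r z ∈ spectrum ℂ (v z)) : ∃ i, ∀ᶠ z in 𝓝 q, r z = b i z := by
  obtain ⟨i, hi⟩ : ∃ i, b i q = r q := by
    have := hrs.self_of_nhds
    rwa [hbs.self_of_nhds] at this
  refine ⟨i, ?_⟩
  have hne : ∀ᶠ z in 𝓝 q, ∀ j, j ≠ i → b j z ≠ r z := by
    refine eventually_all.2 fun j => ?_
    by_cases hj : j = i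
    · exact .of_forall fun z h => (h hj).elim
    · exact (((hb j).sub hr).eventually_ne (sub_ne_zero.2 (hi ▸ fun h => hj (hinj h)))).mono
        fun z h _ => sub_ne_zero.1 h
  filter_upwards [hne, hbs, hrs] with z h1 h2 h3
  rw [h2] at h3
  obtain ⟨j, hj⟩ := h3
  by_cases hji : j = i
  · rw [← hji]
    exact hj.symm
  · exact (h1 j hji hj).elim

/-- The simple zeros of the eigenprojection type at `p` can be removed, for all eigenvalue
branches. -/
def KillRoot (O K L : Set ℂ) (v : ℂ → Matrix (Fin n) (Fin n) ℂ) (p : ℂ) : Prop :=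
  ∀ r : ℂ → ℂ, ContinuousAt r p → (∀ᶠ z in 𝓝 p, r z ∈ spectrum ℂ (v z)) →
    Kill O K L v p fun z => idem (rootProj (v z) (r z)) (z - p)

lemma KillRoot.transfer (hO : IsOpen O) (hv : DifferentiableOn ℂ v O) (hK : IsCompact K)
    (hKO : K ⊆ O) {p q q' : ℂ} (hp : PolePush ℂ K L p) {R : ℝ} (hKR : ∀ z ∈ K, R ≤ dist z p)
    (hRO : ball p R ⊆ O) {k : ℕ} {b : Fin k → ℂ → ℂ}
    (hb : ∀ i, DifferentiableOn ℂ (b i) (ball p R))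
    (hbs : ∀ z ∈ ball p R, Function.Injective (fun i => b i z) ∧
      spectrum ℂ (v z) = range fun i => b i z)
    (hq : dist q p < R / 8) (hq' : dist q' p < R / 8) (h : KillRoot O K L v q') :
    KillRoot O K L v q := by
  intro r hr hrs
  have hR : 0 < R := by linarith [dist_nonneg (x := q) (y := p)]
  have hqR : ball p R ∈ 𝓝 q := isOpen_ball.mem_nhds (mem_ball.2 (by linarith))
  have hqR' : ball p R ∈ 𝓝 q' := isOpen_ball.mem_nhds (mem_ball.2 (by linarith))
  have hmem : ∀ z ∈ ball p R, ∀ i, b i z ∈ spectrum ℂ (v z) := fun z hz i => by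
    rw [(hbs z hz).2]
    exact mem_range_self i
  obtain ⟨i, hi⟩ := eventually_eq_branch
    (fun i => ((hb i).differentiableAt hqR).continuousAt) (hbs q (mem_of_mem_nhds hqR)).1
    (by filter_upwards [hqR] with z hz using (hbs z hz).2) hr hrs
  refine (Kill.transfer hO hv hK hKO hp hKR hRO (polyHolo_rootProj hb hbs i)
    (fun z hz => rootProj_mul_self (hmem z hz i)) hq hq' (h (b i)
    ((hb i).differentiableAt hqR').continuousAt ?_)).congr ?_
  · filter_upwards [hqR'] with z hz using hmem z hz i
  · filter_upwards [mem_nhdsWithin_of_mem_nhds hi] with z hz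
    rw [hz]

lemma GoodAt.exists_ball {p : ℂ} (h : GoodAt v p) (hU : U ∈ 𝓝 p) : ∃ R > 0, ball p R ⊆ U ∧
    ∃ k, ∃ b : Fin k → ℂ → ℂ, (∀ i, DifferentiableOn ℂ (b i) (ball p R)) ∧
      ∀ z ∈ ball p R, Function.Injective (fun i => b i z) ∧
        spectrum ℂ (v z) = range fun i => b i z := by
  obtain ⟨R, hR, k, b, hb, hbs⟩ := h
  obtain ⟨R', hR', hRU⟩ := Metric.mem_nhds_iff.1 hU
  have hs : ball p (min R R') ⊆ ball p R := ball_subset_ball (min_le_left _ _)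
  exact ⟨min R R', lt_min hR hR', (ball_subset_ball (min_le_right _ _)).trans hRU, k, b,
    fun i => (hb i).mono hs, fun z hz => hbs z (hs hz)⟩

lemma le_dist_of_disjoint_ball {p : ℂ} {R : ℝ} (hU : Disjoint U K) (h : ball p R ⊆ U) :
    ∀ z ∈ K, R ≤ dist z p := fun z hz => by
  by_contra hlt
  exact hU.notMem_of_mem_right hz (h (mem_ball.2 (not_le.1 hlt)))

lemma killRoot_of_goodAt (hO : IsOpen O) (hv : DifferentiableOn ℂ v O) (hK : IsCompact K)
    (hKO : K ⊆ O) (hL : IsClosed L) (hU : IsOpen U) (hUpre : IsPreconnected U)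
    (hUK : Disjoint U K) (hUL : ¬ U ⊆ L) (hS : S.Countable)
    (hUS : ∀ z ∈ U \ S, z ∈ O ∧ GoodAt v z) {d : ℂ} (hd : d ∈ U \ S) : KillRoot O K L v d := by
  obtain ⟨a, haU, haL⟩ := not_subset.1 hUL
  obtain ⟨z₁, ⟨hz₁U, hz₁L⟩, hz₁S⟩ := dense_compl_countable hS
    (hU.inter hL.isOpen_compl) ⟨a, haU, haL⟩
  have hpre : IsPreconnected (U \ S) := PlanarSimilarity.IsPreconnected.diff_countable hU hUpre hS
  refine (hpre.induction₂ (fun x y => KillRoot O K L v x ↔ KillRoot O K L v y) ?_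
    (fun _ _ _ _ _ _ h1 h2 => h1.trans h2) (fun _ _ _ _ h => h.symm)
    (⟨hz₁U, hz₁S⟩ : z₁ ∈ U \ S) hd).1 fun r _ _ => .of_notMem hz₁L
  intro p hp
  obtain ⟨hpO, hpg⟩ := hUS p hp
  obtain ⟨R, hR, hRU, k, b, hb, hbs⟩ := hpg.exists_ball ((hU.inter hO).mem_nhds ⟨hp.1, hpO⟩)
  have key : ∀ q q', dist q p < R / 8 → dist q' p < R / 8 → KillRoot O K L v q' →
      KillRoot O K L v q := fun q q' hq hq' =>
    .transfer hO hv hK hKO (.of_connected hU hUpre hUK hUL hp.1)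
      (le_dist_of_disjoint_ball hUK (hRU.trans inter_subset_left)) (hRU.trans inter_subset_right)
      hb hbs hq hq'
  filter_upwards [mem_nhdsWithin_of_mem_nhds (ball_mem_nhds p (by positivity : 0 < R / 8))] with q hq
  have hp' : dist p p < R / 8 := by rw [dist_self]; positivity
  exact ⟨key q p hq hp', key p q hp' hq⟩

end KillRoot

section KillSelf

lemma idem_mul_one_add_mul {𝔸 : Type*} [NormedRing 𝔸] [NormedAlgebra ℂ 𝔸] {P M : 𝔸}
    (hP : P * P = P) (h : Commute M P) {r : ℂ} (hr : r ≠ 0) :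
    idem P r * ((1 + r⁻¹ • ((M - algebraMap ℂ 𝔸 r) * P)) * (M * (1 - P) + P)) = M := by
  have h1 : P * ((M - algebraMap ℂ 𝔸 r) * P) = (M - algebraMap ℂ 𝔸 r) * P := by
    rw [← mul_assoc, ((h.sub_left (Algebra.commutes r P)).eq).symm, mul_assoc, hP]
  have h2 : idem P r * (1 + r⁻¹ • ((M - algebraMap ℂ 𝔸 r) * P)) = M * P + (1 - P) := by
    rw [mul_add, mul_one, idem, add_mul, sub_mul, one_mul, mul_smul_comm, mul_smul_comm, h1,
      sub_self, zero_add, smul_mul_assoc, h1, inv_smul_smul₀ hr, sub_mul, Algebra.smul_def]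
    abel
  rw [← mul_assoc, h2]
  have h3 : P * (M * (1 - P)) = 0 := by
    rw [← mul_assoc, ← h.eq, mul_assoc, mul_sub, mul_one, hP, sub_self, mul_zero]
  have h4 : (1 - P) * (M * (1 - P)) = M * (1 - P) := by rw [sub_mul, one_mul, h3, sub_zero]
  have h5 : (1 - P) * P = 0 := by rw [sub_mul, one_mul, hP, sub_self]
  rw [mul_add, add_mul, add_mul, mul_assoc, h3, mul_zero, h4, mul_assoc, hP, h5, mul_sub, mul_one]
  abel

variable {𝔸 : Type*} [NormedRing 𝔸] [NormedAlgebra ℂ 𝔸] {v : ℂ → 𝔸} in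
lemma PolyHolo.eventually_continuousAt_commute {V : Set ℂ} {y : ℂ → 𝔸} (h : PolyHolo v V y)
    (hV : IsOpen V) (hv : DifferentiableOn ℂ v V) {d : ℂ} (hd : V ∈ 𝓝[≠] d) :
    ∀ᶠ z in 𝓝[≠] d, ContinuousAt y z ∧ Commute (v z) (y z) := by
  filter_upwards [hd] with z hz
  exact ⟨((h.differentiableOn hv).differentiableAt (hV.mem_nhds hz)).continuousAt,
    (h.commute hz (Commute.refl _)).symm⟩

variable {𝔸 : Type*} [NormedRing 𝔸] [NormedAlgebra ℂ 𝔸] {v : ℂ → 𝔸} {O K L : Set ℂ} in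
lemma Kill.idem_pow (hO : IsOpen O) {d : ℂ} {R : ℝ} (hR : 0 < R) (hRO : ball d R ⊆ O)
    (hv : DifferentiableOn ℂ v O) {P : ℂ → 𝔸} (hP : PolyHolo v (ball d R) P)
    (hPP : ∀ z ∈ ball d R, P z * P z = P z) (h : Kill O K L v d fun z => idem (P z) (z - d))
    (m : ℕ) : Kill O K L v d fun z => idem (P z) ((z - d) ^ m) := by
  have hball : ball d R ∈ 𝓝[≠] d := mem_nhdsWithin_of_mem_nhds (ball_mem_nhds d hR)
  induction m with
  | zero => simpa only [pow_zero, idem_one] using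
      Kill.of_isUnit (y := fun _ => (1 : 𝔸)) hR (differentiableOn_const 1) isUnit_one
  | succ m ih =>
    refine (ih.mul hO (hRO (mem_ball_self hR)) h ((hP.idem (a := fun z => (z - d) ^ m)
      ?_).eventually_continuousAt_commute isOpen_ball (hv.mono hRO) hball)).congr ?_
    · fun_prop
    · filter_upwards [hball] with z hz
      rw [idem_mul (hPP z hz), pow_succ]

open scoped Matrix.Norms.Operator
variable {n : ℕ} {O K L U S : Set ℂ} {v : ℂ → Matrix (Fin n) (Fin n) ℂ}

lemma Kill.self_of_goodAt (hO : IsOpen O) (hv : DifferentiableOn ℂ v O) (hK : IsCompact K)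
    (hKO : K ⊆ O) {d : ℂ} (hd : d ∈ O) (hdK : d ∉ K) (hp : PolePush ℂ K L d) (hg : GoodAt v d)
    (hroot : KillRoot O K L v d) (hunit : ∀ᶠ z in 𝓝[≠] d, IsUnit (v z)) : Kill O K L v d v := by
  obtain ⟨R₀, hR₀, hunit⟩ := exists_punctured_ball hunit
  obtain ⟨R, hR, hRU, k, b, hb, hbs⟩ := hg.exists_ball
    ((hO.inter hK.isClosed.isOpen_compl |>.inter isOpen_ball).mem_nhds
      (⟨⟨hd, hdK⟩, mem_ball_self hR₀⟩ : d ∈ O ∩ Kᶜ ∩ ball d R₀))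
  have hRO : ball d R ⊆ O := fun z hz => (hRU hz).1.1
  have hKR : ∀ z ∈ K, R ≤ dist z d :=
    le_dist_of_disjoint_ball (U := Kᶜ) disjoint_compl_left fun z hz => (hRU hz).1.2
  have hvR : DifferentiableOn ℂ v (ball d R) := hv.mono hRO
  by_cases hvd : IsUnit (v d)
  · exact .of_isUnit hR hvR hvd
  have h0 : (0 : ℂ) ∈ spectrum ℂ (v d) := spectrum.zero_mem_iff ℂ |>.2 hvd
  have hspec : ∀ z ∈ ball d R, ∀ i, b i z ∈ spectrum ℂ (v z) := fun z hz i => by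
    rw [(hbs z hz).2]
    exact mem_range_self i
  obtain ⟨i, hi⟩ : ∃ i, b i d = 0 := by
    rwa [(hbs d (mem_ball_self hR)).2] at h0
  have hrne : ∀ z ∈ ball d R, z ≠ d → b i z ≠ 0 := fun z hz hzd h =>
    (spectrum.zero_mem_iff ℂ |>.1 (h ▸ hspec z hz i)) (hunit z (dist_pos.2 hzd) (hRU hz).2)
  have hball : ball d R ∈ 𝓝[≠] d := mem_nhdsWithin_of_mem_nhds (ball_mem_nhds d hR)
  obtain ⟨m, η, hη, hηd, hbη⟩ := (((hb i).analyticAt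
    (ball_mem_nhds d hR)).exists_eventuallyEq_pow_smul_nonzero_iff).2 fun h => by
      have h1 : ∀ᶠ z in 𝓝[≠] d, b i z ≠ 0 := by
        filter_upwards [hball, self_mem_nhdsWithin] with z hz hzd using hrne z hz hzd
      obtain ⟨z, h2, h3⟩ := (h1.and (h.filter_mono nhdsWithin_le_nhds)).exists
      exact h2 h3
  obtain ⟨ρ, hρ, hρη⟩ := Metric.eventually_nhds_iff_ball.1 hη.eventually_analyticAt
  have hηρ : DifferentiableOn ℂ η (ball d ρ) := fun z hz =>
    (hρη z hz).differentiableAt.differentiableWithinAt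
  let P := fun z => rootProj (v z) (b i z)
  have hP : PolyHolo v (ball d R) P := polyHolo_rootProj hb hbs i
  have hPP : ∀ z ∈ ball d R, P z * P z = P z := fun z hz => rootProj_mul_self (hspec z hz i)
  let s := min R ρ
  have hs : 0 < s := lt_min hR hρ
  have hsR : ball d s ⊆ ball d R := ball_subset_ball (min_le_left _ _)
  have hsρ : ball d s ⊆ ball d ρ := ball_subset_ball (min_le_right _ _)
  have hballs : ball d s ∈ 𝓝[≠] d := mem_nhdsWithin_of_mem_nhds (ball_mem_nhds d hs)
  have hpunct : ball d R \ {d} ∈ 𝓝[≠] d := sdiff_mem hball self_mem_nhdsWithin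
  have hroot' : Kill O K L v d fun z => idem (P z) (z - d) := by
    refine hroot (b i) ((hb i).differentiableAt (ball_mem_nhds d hR)).continuousAt ?_
    filter_upwards [ball_mem_nhds d hR] with z hz using hspec z hz i
  have hidη : PolyHolo v (ball d s) fun z => idem (P z) (η z) :=
    (hP.mono hsR).idem (hηρ.mono hsρ)
  have kη : Kill O K L v d fun z => idem (P z) (η z) :=
    .of_isUnit hs (hidη.differentiableOn (hvR.mono hsR))
      (isUnit_idem (hPP d (mem_ball_self hR)) hηd)
  let N := fun z => (b i z)⁻¹ • ((v z - algebraMap ℂ _ (b i z)) * P z)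
  have hN : PolyHolo v (ball d R \ {d}) N := by
    refine PolyHolo.smul (((hb i).mono sdiff_subset).inv fun z hz => hrne z hz.1 hz.2) ?_
    exact (PolyHolo.self.sub (.of_holo ((hb i).mono sdiff_subset))).mul (hP.mono sdiff_subset)
  obtain ⟨p, hp'⟩ := exists_exp_aeval_eq_one_add (𝔸 := Matrix (Fin n) (Fin n) ℂ) n
  have hexp : ∀ z ∈ ball d R, NormedSpace.exp (Polynomial.aeval (N z) p) = 1 + N z :=
    fun z hz => hp' _ (by rw [smul_pow, sub_mul_rootProj_pow (hspec z hz i), smul_zero])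
  have kN : Kill O K L v d fun z => 1 + N z :=
    (Kill.of_exp hv hK hKO hp hR hKR hRO (hN.aeval p)).congr
      (by filter_upwards [hball] with z hz using hexp z hz)
  let Q := fun z => v z * (1 - P z) + P z
  have hQ : PolyHolo v (ball d R) Q := (PolyHolo.self.mul (PolyHolo.one.sub hP)).add hP
  have kQ : Kill O K L v d Q := .of_isUnit hR (hQ.differentiableOn hvR) (by
    simp only [Q, P, hi]
    exact isUnit_mul_one_sub_rootProj_add h0)
  have hopen : IsOpen (ball d R \ {d}) := isOpen_ball.sdiff isClosed_singleton
  have k₁ := kN.mul hO hd kQ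
    ((PolyHolo.one.add hN).eventually_continuousAt_commute hopen (hvR.mono sdiff_subset) hpunct)
  have k₂ := kη.mul hO hd k₁
    (hidη.eventually_continuousAt_commute isOpen_ball (hvR.mono hsR) hballs)
  have k₃ := (Kill.idem_pow hO hR hRO hv hP hPP hroot' m).mul hO hd k₂
    ((hP.idem (a := fun z => (z - d) ^ m) (by fun_prop)).eventually_continuousAt_commute
      isOpen_ball hvR hball)
  refine k₃.congr ?_
  filter_upwards [hball, self_mem_nhdsWithin, hbη.filter_mono nhdsWithin_le_nhds] with z hz hzd hzη
  rw [← mul_assoc, idem_mul (hPP z hz), ← show b i z = (z - d) ^ m * η z from hzη]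
  exact idem_mul_one_add_mul (hPP z hz) (hP.commute hz (Commute.refl _)).symm (hrne z hz hzd)

end KillSelf

section KillFinset

variable {𝔸 : Type*} [NormedRing 𝔸] [NormedAlgebra ℂ 𝔸] {v : ℂ → 𝔸} {O K L : Set ℂ} in
lemma exists_kill_finset (hO : IsOpen O) (hv : ContinuousOn v O) (Z : Finset ℂ)
    (hZ : ∀ d ∈ Z, d ∈ O ∧ d ∈ L ∧ Kill O K L v d v) :
    ∀ ε > 0, ∃ E : Set ℂ, E.Finite ∧ Disjoint E L ∧ ∃ w : ℂ → 𝔸,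
      DifferentiableOn ℂ w (O \ (E ∪ Z)) ∧ (∀ z ∈ O \ (E ∪ Z), IsUnit (w z) ∧ BicAt v w z) ∧
      (∀ z ∈ K, ‖w z - 1‖ ≤ ε) ∧ ∀ d ∈ Z, ∃ ρ > 0, ∃ q : ℂ → 𝔸,
        DifferentiableOn ℂ q (ball d ρ) ∧ IsUnit (q d) ∧
        ∀ z ∈ ball d ρ, z ≠ d → q z = w z * v z := by
  classical
  induction Z using Finset.induction_on with
  | empty =>
    exact fun ε hε => ⟨∅, finite_empty, empty_disjoint _, fun _ => 1, differentiableOn_const 1,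
      fun _ _ => ⟨isUnit_one, .one⟩, fun _ _ => by simpa using hε.le, by simp⟩
  | insert d Z hdZ ih =>
    intro ε hε
    obtain ⟨hdO, hdL, hd⟩ := hZ d (Finset.mem_insert_self _ _)
    obtain ⟨E₁, hE₁, hEL₁, w₁, hw₁, hwu₁, hwK₁, hq₁⟩ :=
      ih (fun e he => hZ e (Finset.mem_insert_of_mem he)) (min 1 (ε / 3)) (by positivity)
    obtain ⟨E₂, hE₂, hEL₂, w₂, hw₂, hwu₂, hwK₂, hq₂⟩ := hd (min 1 (ε / 3)) (by positivity)
    have s₁ : O \ (E₁ ∪ E₂ ∪ ↑(insert d Z)) ⊆ O \ (E₁ ∪ Z) := by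
      refine sdiff_subset_sdiff_right (union_subset_union subset_union_left ?_)
      exact Finset.coe_subset.2 (Finset.subset_insert d Z)
    have s₂ : O \ (E₁ ∪ E₂ ∪ ↑(insert d Z)) ⊆ O \ insert d E₂ := by
      refine sdiff_subset_sdiff_right (insert_subset (.inr ?_) fun z hz => .inl (.inr hz))
      exact Finset.mem_coe.2 (Finset.mem_insert_self d Z)
    refine ⟨E₁ ∪ E₂, hE₁.union hE₂, disjoint_union_left.2 ⟨hEL₁, hEL₂⟩, fun z => w₁ z * w₂ z,
      (hw₁.mono s₁).mul (hw₂.mono s₂), fun z hz => ⟨(hwu₁ z (s₁ hz)).1.mul (hwu₂ z (s₂ hz)).1,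
      (hwu₁ z (s₁ hz)).2.mul (hwu₂ z (s₂ hz)).2⟩,
      fun z hz => norm_mul_sub_one_le (hwK₁ z hz) (hwK₂ z hz), fun e he => ?_⟩
    rcases Finset.mem_insert.1 he with rfl | heZ
    · obtain ⟨ρ, hρ, q, hq, hqd, hqw⟩ := hq₂ hdL
      have hmem : e ∈ O \ (E₁ ∪ Z) :=
        ⟨hdO, fun h => h.elim (fun h => hEL₁.notMem_of_mem_left h hdL) hdZ⟩
      obtain ⟨ρ', hρ', hball⟩ := Metric.isOpen_iff.1
        (hO.sdiff (hE₁.isClosed.union Z.finite_toSet.isClosed)) e hmem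
      refine ⟨min ρ ρ', lt_min hρ hρ', fun z => w₁ z * q z, (hw₁.mono ?_).mul (hq.mono ?_),
        (hwu₁ e hmem).1.mul hqd, fun z hz hze => ?_⟩
      · exact (ball_subset_ball (min_le_right _ _)).trans hball
      · exact ball_subset_ball (min_le_left _ _)
      · beta_reduce
        rw [hqw z (ball_subset_ball (min_le_left _ _) hz) hze, mul_assoc]
    · obtain ⟨ρ, hρ, q, hq, hqd, hqw⟩ := hq₁ e heZ
      obtain ⟨heO, heL, -⟩ := hZ e he
      have hopen : IsOpen (O \ insert d E₂) := hO.sdiff (hE₂.insert d).isClosed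
      have hmem : e ∈ O \ insert d E₂ := ⟨heO, fun h => h.elim (fun h => hdZ (h ▸ heZ))
        fun h => hEL₂.notMem_of_mem_left h heL⟩
      obtain ⟨ρ', hρ', hball⟩ := Metric.isOpen_iff.1 hopen e hmem
      refine ⟨min ρ ρ', lt_min hρ hρ', fun z => q z * w₂ z, (hq.mono ?_).mul (hw₂.mono ?_),
        hqd.mul (hwu₂ e hmem).1, fun z hz hze => ?_⟩
      · exact ball_subset_ball (min_le_left _ _)
      · exact (ball_subset_ball (min_le_right _ _)).trans hball
      · have hz' := hball (ball_subset_ball (min_le_right _ _) hz)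
        have hc : Commute (w₂ z) (v z) := (hwu₂ z hz').2 v (by
          filter_upwards [hO.mem_nhds hz'.1] with x hx
          exact ⟨hv.continuousAt (hO.mem_nhds hx), Commute.refl _⟩)
        beta_reduce
        rw [hqw z (ball_subset_ball (min_le_left _ _) hz) hze, mul_assoc, mul_assoc, hc.eq]

open scoped Matrix.Norms.Operator
variable {n : ℕ} {v : ℂ → Matrix (Fin n) (Fin n) ℂ}

lemma exists_bicommutant_factor {Ω L F : Set ℂ} (hΩ : IsOpen Ω) {m : ℕ} (hL : IsCompact L)
    (hLΩ : L ⊆ Ω) (hF : F.Finite) (hKF : Disjoint (exhaust Ω m) F)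
    (hv : DifferentiableOn ℂ v (Ω \ F)) (Z : Finset ℂ)
    (hZ : ∀ d ∈ Z, d ∈ Ω \ F ∧ d ∈ L ∧ d ∉ exhaust Ω m ∧ GoodAt v d ∧
      ∀ᶠ z in 𝓝[≠] d, IsUnit (v z)) {ε : ℝ} (hε : 0 < ε) :
    ∃ E : Set ℂ, E.Finite ∧ Disjoint E L ∧ ∃ w : ℂ → Matrix (Fin n) (Fin n) ℂ,
      DifferentiableOn ℂ w ((Ω \ F) \ (E ∪ Z)) ∧
      (∀ z ∈ (Ω \ F) \ (E ∪ Z), IsUnit (w z) ∧ BicAt v w z) ∧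
      (∀ z ∈ exhaust Ω m, ‖w z - 1‖ ≤ ε) ∧ ∀ d ∈ Z, ∃ ρ > 0, ∃ q,
        DifferentiableOn ℂ q (ball d ρ) ∧ IsUnit (q d) ∧
        ∀ z ∈ ball d ρ, z ≠ d → q z = w z * v z := by
  have hO : IsOpen (Ω \ F) := hΩ.sdiff hF.isClosed
  have hK : IsCompact (exhaust Ω m) := isCompact_exhaust Ω m
  have hKO : exhaust Ω m ⊆ Ω \ F := subset_sdiff.2 ⟨exhaust_subset Ω m, hKF⟩
  refine exists_kill_finset hO hv.continuousOn Z (fun d hdZ => ?_) ε hε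
  obtain ⟨hdO, hdL, hdK, hg, hu⟩ := hZ d hdZ
  have hUo : IsOpen (connectedComponentIn (Ω \ exhaust Ω m) d) :=
    (hΩ.sdiff hK.isClosed).connectedComponentIn
  have hUsub := connectedComponentIn_subset (Ω \ exhaust Ω m) d
  have hdU : d ∈ connectedComponentIn (Ω \ exhaust Ω m) d :=
    mem_connectedComponentIn ⟨hdO.1, hdK⟩
  have hUK : Disjoint (connectedComponentIn (Ω \ exhaust Ω m) d) (exhaust Ω m) :=
    disjoint_left.2 fun z hz => (hUsub hz).2
  have hUL := not_connectedComponentIn_subset hΩ hdO.1 hdK hL hLΩ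
  refine ⟨hdO, hdL, .self_of_goodAt hO hv hK hKO hdO hdK
    (.of_connected hUo isPreconnected_connectedComponentIn hUK hUL hdU) hg ?_ hu⟩
  refine killRoot_of_goodAt (S := F ∪ (Ω \ F) ∩ {z | ¬ GoodAt v z}) hO hv hK hKO hL.isClosed hUo
    isPreconnected_connectedComponentIn hUK hUL (hF.countable.union (countable_of_eventually ?_))
    (fun z hz => ?_) ⟨hdU, fun h => h.elim hdO.2 fun h => h.2 hg⟩
  · intro z hz
    exact (eventually_goodAt hO hv hz).mono fun w hw h => h hw
  · have hzO : z ∈ Ω \ F := ⟨(hUsub hz.1).1, fun h => hz.2 (.inl h)⟩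
    exact ⟨hzO, by_contra fun h => hz.2 (.inr ⟨hzO, h⟩)⟩

end KillFinset

section CoreStep
open scoped Matrix.Norms.Operator
variable {n : ℕ}

lemma differentiableOn_iff_entries {f : ℂ → Matrix (Fin n) (Fin n) ℂ} {s : Set ℂ} :
    DifferentiableOn ℂ f s ↔ ∀ i j, DifferentiableOn ℂ (fun z => f z i j) s := by
  refine ⟨fun h i j => ((Matrix.entryLinearMap ℂ ℂ i j :
    Matrix (Fin n) (Fin n) ℂ →ₗ[ℂ] ℂ).toContinuousLinearMap.differentiable.comp_differentiableOn h),
    fun h => ?_⟩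
  have : f = fun z => ∑ i, ∑ j, f z i j • Matrix.single i j (1 : ℂ) := by
    ext1 z
    conv_lhs => rw [Matrix.matrix_eq_sum_single (f z)]
    simp only [Matrix.smul_single, smul_eq_mul, mul_one]
  rw [this]
  exact DifferentiableOn.fun_sum fun i _ => DifferentiableOn.fun_sum fun j _ =>
    (h i j).smul_const _

lemma DifferentiableOn.matrix_det {f : ℂ → Matrix (Fin n) (Fin n) ℂ} {s : Set ℂ}
    (hf : DifferentiableOn ℂ f s) : DifferentiableOn ℂ (fun z => (f z).det) s :=
  differentiableOn_det (differentiableOn_iff_entries.1 hf)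

lemma DifferentiableOn.matrix_adjugate {f : ℂ → Matrix (Fin n) (Fin n) ℂ} {s : Set ℂ}
    (hf : DifferentiableOn ℂ f s) : DifferentiableOn ℂ (fun z => (f z).adjugate) s :=
  differentiableOn_iff_entries.2 (differentiableOn_adjugate (differentiableOn_iff_entries.1 hf))

lemma isUnit_iff_det_ne_zero {M : Matrix (Fin n) (Fin n) ℂ} : IsUnit M ↔ M.det ≠ 0 := by
  rw [Matrix.isUnit_iff_isUnit_det, isUnit_iff_ne_zero]

lemma GoodAt.add_algebraMap {v : ℂ → Matrix (Fin n) (Fin n) ℂ} {p : ℂ} (h : GoodAt v p) {g : ℂ → ℂ}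
    {U : Set ℂ} (hU : U ∈ 𝓝 p) (hg : DifferentiableOn ℂ g U) :
    GoodAt (fun z => v z + algebraMap ℂ _ (g z)) p := by
  obtain ⟨R, hR, hRU, k, b, hb, hbs⟩ := h.exists_ball hU
  refine ⟨R, hR, k, fun i z => b i z + g z, fun i => (hb i).add (hg.mono hRU), fun z hz => ?_⟩
  obtain ⟨h1, h2⟩ := hbs z hz
  refine ⟨fun i j hij => h1 (add_right_cancel hij), ?_⟩
  rw [← spectrum.add_singleton_eq, h2]
  ext x
  simp [eq_add_neg_iff_add_eq]

lemma exists_isUnit_radius {K : Set ℂ} (hK : IsCompact K) {h : ℂ → Matrix (Fin n) (Fin n) ℂ}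
    (hh : ContinuousOn h K) (hu : ∀ z ∈ K, IsUnit (h z)) :
    ∃ δ > 0, ∀ z ∈ K, ∀ M, ‖M - h z‖ ≤ δ → IsUnit M := by
  have : CompleteSpace (Matrix (Fin n) (Fin n) ℂ) := FiniteDimensional.complete ℂ _
  obtain ⟨δ, hδ, hsub⟩ := (hK.image_of_continuousOn hh).exists_cthickening_subset_open Units.isOpen
    (by rintro _ ⟨z, hz, rfl⟩; exact hu z hz)
  refine ⟨δ, hδ, fun z hz M hM => hsub ?_⟩
  exact closedBall_subset_cthickening (mem_image_of_mem h hz) δ (by rwa [mem_closedBall, dist_eq_norm])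

lemma eq_of_eventuallyEq_punctured {E : Type*} [TopologicalSpace E] [T2Space E] {f g : ℂ → E}
    {z : ℂ} (hf : ContinuousAt f z) (hg : ContinuousAt g z) (h : ∀ᶠ w in 𝓝[≠] z, f w = g w) :
    f z = g z :=
  tendsto_nhds_unique_of_eventuallyEq (hf.tendsto.mono_left nhdsWithin_le_nhds)
    (hg.tendsto.mono_left nhdsWithin_le_nhds) h

lemma Intertwines.adjugate {Ω : Set ℂ} (hΩ : IsOpen Ω) (hpre : IsPreconnected Ω)
    {A B X : ℂ → Matrix (Fin n) (Fin n) ℂ} (hA : DifferentiableOn ℂ A Ω)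
    (hB : DifferentiableOn ℂ B Ω) (hX : Intertwines A B X Ω) {z₀ : ℂ} (hz₀ : z₀ ∈ Ω)
    (hu : IsUnit (X z₀)) : Intertwines B A (fun z => (X z).adjugate) Ω := by
  have hadj := DifferentiableOn.matrix_adjugate hX.1
  refine ⟨hadj, fun z hz => ?_⟩
  refine eq_of_eventuallyEq_punctured (f := fun z => B z * (X z).adjugate)
    (g := fun z => (X z).adjugate * A z) ((hB.mul hadj).continuousOn.continuousAt (hΩ.mem_nhds hz))
    ((hadj.mul hA).continuousOn.continuousAt (hΩ.mem_nhds hz)) ?_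
  filter_upwards [eventually_ne_zero hΩ hpre (DifferentiableOn.matrix_det hX.1) hz₀
    (isUnit_iff_det_ne_zero.1 hu) hz, mem_nhdsWithin_of_mem_nhds (hΩ.mem_nhds hz)] with w hw hwΩ
  have h1 : (X w).det • (B w * (X w).adjugate) = (X w).det • ((X w).adjugate * A w) := by
    calc _ = ((X w).adjugate * X w) * (B w * (X w).adjugate) := by
          rw [Matrix.adjugate_mul, smul_mul_assoc, one_mul]
      _ = (X w).adjugate * (X w * B w) * (X w).adjugate := by simp only [mul_assoc]
      _ = (X w).adjugate * A w * (X w * (X w).adjugate) := by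
          rw [← hX.2 w hwΩ]; simp only [mul_assoc]
      _ = _ := by rw [Matrix.mul_adjugate, mul_smul_comm, mul_one]
  exact smul_right_injective _ hw h1

lemma finite_inter_not_isUnit {O L : Set ℂ} (hO : IsOpen O) (hpre : IsPreconnected O)
    {h : ℂ → Matrix (Fin n) (Fin n) ℂ} (hh : DifferentiableOn ℂ h O) {z₀ : ℂ} (hz₀ : z₀ ∈ O)
    (hu : IsUnit (h z₀)) (hL : IsCompact L) (hLO : L ⊆ O) : (L ∩ {z | ¬ IsUnit (h z)}).Finite :=
  finite_inter_of_eventually hL fun z hz => by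
    filter_upwards [eventually_ne_zero hO hpre (DifferentiableOn.matrix_det hh) hz₀
      (isUnit_iff_det_ne_zero.1 hu) (hLO hz)] with w hw h
    exact h (isUnit_iff_det_ne_zero.2 hw)

/-- An intertwiner can be perturbed so that it becomes the product of a factor with good spectrum
and the inverse of an adjugate. -/
lemma exists_perturbation {O L K : Set ℂ} (hO : IsOpen O) (hpre : IsPreconnected O)
    {h X : ℂ → Matrix (Fin n) (Fin n) ℂ} (hh : DifferentiableOn ℂ h O) (hX : DifferentiableOn ℂ X O)
    (hL : IsCompact L) (hLO : L ⊆ O) (hK : IsCompact K) (hKL : K ⊆ L)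
    (hKu : ∀ z ∈ K, IsUnit (h z)) {z₁ : ℂ} (hz₁ : z₁ ∈ O) (hu₁ : IsUnit (X z₁))
    (hu : ∀ z ∈ L, IsUnit (h z) ∨ IsUnit (X z)) {ε : ℝ} (hε : 0 < ε) :
    ∃ t : ℂ, (∀ z ∈ K, IsUnit (h z + t • X z) ∧ ‖t • X z‖ ≤ ε) ∧ IsUnit (h z₁ + t • X z₁) ∧
      ∀ z ∈ L, ¬ IsUnit (h z + t • X z) → IsUnit (X z) ∧
        GoodAt (fun z => (h z + t • X z) * (X z).adjugate) z := by
  have hv₀ : DifferentiableOn ℂ (fun z => h z * (X z).adjugate) O :=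
    hh.mul (DifferentiableOn.matrix_adjugate hX)
  obtain ⟨δ, hδ, hδu⟩ := exists_isUnit_radius hK (hh.continuousOn.mono (hKL.trans hLO)) hKu
  obtain ⟨C, hC⟩ := hK.exists_bound_of_continuousOn (hX.continuousOn.mono (hKL.trans hLO))
  have hT : ((L ∩ {z | ¬ IsUnit (X z)}) ∪
      (L ∩ {z | ¬ GoodAt (fun z => h z * (X z).adjugate) z})).Finite :=
    (finite_inter_not_isUnit hO hpre hX hz₁ hu₁ hL hLO).union
      (finite_inter_of_eventually hL fun z hz => by
        filter_upwards [eventually_goodAt hO hv₀ (hLO hz)] with w hw h using h hw)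
  set T := (L ∩ {z | ¬ IsUnit (X z)}) ∪ (L ∩ {z | ¬ GoodAt (fun z => h z * (X z).adjugate) z})
  have hTL : T ⊆ L := union_subset inter_subset_left inter_subset_left
  have hbad : (⋃ z ∈ insert z₁ T, {t : ℂ | ¬ IsUnit (h z + t • X z)}).Finite := by
    refine (hT.insert z₁).biUnion fun z hz => finite_not_isUnit_add_smul ?_
    rcases hz with rfl | hz
    · exact .inr hu₁
    · exact hu z (hTL hz)
  have hr : 0 < min δ ε / (|C| + 1) := by positivity
  obtain ⟨t, htball, ht⟩ := dense_compl_countable hbad.countable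
    (isOpen_ball (x := (0 : ℂ)) (ε := min δ ε / (|C| + 1))) ⟨0, mem_ball_self hr⟩
  simp only [mem_iUnion, not_exists, mem_ofPred_eq, not_not] at ht
  have hnorm : ∀ z ∈ K, ‖t • X z‖ ≤ min δ ε := by
    intro z hz
    rw [mem_ball_zero_iff, lt_div_iff₀ (by positivity)] at htball
    rw [norm_smul]
    refine le_trans (mul_le_mul_of_nonneg_left ?_ (norm_nonneg t)) htball.le
    linarith [hC z hz, le_abs_self C]
  refine ⟨t, fun z hz => ⟨hδu z hz _ ?_, (hnorm z hz).trans (min_le_right _ _)⟩,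
    ht z₁ (mem_insert _ _), fun z hz hzu => ?_⟩
  · rw [add_sub_cancel_left]
    exact (hnorm z hz).trans (min_le_left _ _)
  · have hzT : z ∉ T := fun h => hzu (ht z (mem_insert_of_mem _ h))
    have h1 : IsUnit (X z) := by_contra fun h => hzT (.inl ⟨hz, h⟩)
    have h2 : GoodAt (fun z => h z * (X z).adjugate) z := by_contra fun h => hzT (.inr ⟨hz, h⟩)
    refine ⟨h1, ?_⟩
    have h3 := h2.add_algebraMap (hO.mem_nhds (hLO hz))
      ((DifferentiableOn.matrix_det hX).const_mul t)
    convert h3 using 2 with w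
    rw [add_mul, smul_mul_assoc, Matrix.mul_adjugate, smul_smul, Algebra.algebraMap_eq_smul_one]

end CoreStep

section Extend
open scoped Matrix.Norms.Operator
variable {n : ℕ}

/-- An intertwiner invertible on `K` can be made invertible on a larger compact set. -/
lemma exists_isUnit_extension {Ω L F : Set ℂ} (hΩ : IsOpen Ω) (hpre : IsPreconnected Ω)
    {A B : ℂ → Matrix (Fin n) (Fin n) ℂ} (hA : DifferentiableOn ℂ A Ω)
    (hB : DifferentiableOn ℂ B Ω)
    (hloc : ∀ d ∈ Ω, ∃ U, IsOpen U ∧ d ∈ U ∧ ∃ H, Intertwines A B H U ∧ ∀ z ∈ U, IsUnit (H z))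
    {m : ℕ} (hL : IsCompact L) (hLΩ : L ⊆ Ω) (hKL : exhaust Ω m ⊆ L) (hF : F.Finite)
    (hFL : Disjoint F L) {h : ℂ → Matrix (Fin n) (Fin n) ℂ} (hh : Intertwines A B h (Ω \ F))
    (hKu : ∀ z ∈ exhaust Ω m, IsUnit (h z)) {z₁ : ℂ} (hz₁ : z₁ ∈ Ω \ F) (hu₁ : IsUnit (h z₁))
    {ε : ℝ} (hε : 0 < ε) :
    ∃ F' : Set ℂ, F'.Finite ∧ Disjoint F' L ∧ ∃ h', Intertwines A B h' (Ω \ F') ∧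
      (∀ z ∈ L, IsUnit (h' z)) ∧ ∀ z ∈ exhaust Ω m, ‖h' z - h z‖ ≤ ε := by
  classical
  have hO : IsOpen (Ω \ F) := hΩ.sdiff hF.isClosed
  have hpreO : IsPreconnected (Ω \ F) :=
    PlanarSimilarity.IsPreconnected.diff_countable hΩ hpre hF.countable
  have hLO : L ⊆ Ω \ F := subset_sdiff.2 ⟨hLΩ, hFL.symm⟩
  have hK := isCompact_exhaust Ω m
  have hZ₁ := finite_inter_not_isUnit hO hpreO hh.1 hz₁ hu₁ hL hLO
  obtain ⟨X, hX, hXu⟩ := exists_global_section_isUnit hΩ hpre hA hB hloc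
    (insert z₁ hZ₁.toFinset) (fun z hz => by
      rcases Finset.mem_insert.1 hz with rfl | hz
      · exact hz₁.1
      · exact hLΩ (hZ₁.mem_toFinset.1 hz).1)
  have hXz₁ : IsUnit (X z₁) := hXu z₁ (Finset.mem_insert_self _ _)
  have hXO : DifferentiableOn ℂ X (Ω \ F) := hX.1.mono sdiff_subset
  obtain ⟨t, htK, htz₁, htL⟩ := exists_perturbation hO hpreO hh.1 hXO hL hLO hK hKL hKu hz₁ hXz₁
    (fun z hz => or_iff_not_imp_left.2 fun hzu =>
      hXu z (Finset.mem_insert_of_mem (hZ₁.mem_toFinset.2 ⟨hz, hzu⟩))) (half_pos hε)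
  set g : ℂ → Matrix (Fin n) (Fin n) ℂ := fun z => h z + t • X z with hg_def
  have hg : Intertwines A B g (Ω \ F) := ⟨hh.1.add (hXO.const_smul t), fun z hz => by
    simp only [hg_def, mul_add, add_mul, hh.2 z hz, mul_smul_comm, smul_mul_assoc, hX.2 z hz.1]⟩
  set v : ℂ → Matrix (Fin n) (Fin n) ℂ := fun z => g z * (X z).adjugate with hv_def
  have hadj := hX.adjugate hΩ hpre hA hB hz₁.1 hXz₁
  have hv : DifferentiableOn ℂ v (Ω \ F) := hg.1.mul (hadj.1.mono sdiff_subset)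
  have hvA : ∀ z ∈ Ω \ F, Commute (v z) (A z) := fun z hz => by
    change g z * (X z).adjugate * A z = A z * (g z * (X z).adjugate)
    rw [mul_assoc, ← hadj.2 z hz.1, ← mul_assoc, ← mul_assoc, hg.2 z hz]
  have hZfin := finite_inter_not_isUnit hO hpreO hg.1 hz₁ htz₁ hL hLO
  set Z := hZfin.toFinset with hZ_def
  have hmemZ : ∀ z, z ∈ Z ↔ z ∈ L ∧ ¬ IsUnit (g z) := fun z => hZfin.mem_toFinset
  obtain ⟨C, hC⟩ := hK.exists_bound_of_continuousOn (hg.1.continuousOn.mono (hKL.trans hLO))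
  obtain ⟨E, hE, hEL, w, hw, hwu, hwK, hq⟩ := exists_bicommutant_factor hΩ hL hLΩ hF
    (hFL.symm.mono_left hKL) hv Z (fun d hd => by
      obtain ⟨hdL, hdu⟩ := (hmemZ d).1 hd
      refine ⟨hLO hdL, hdL, fun hdK => hdu (htK d hdK).1, (htL d hdL hdu).2, ?_⟩
      filter_upwards [eventually_ne_zero hO hpreO (DifferentiableOn.matrix_det hg.1) hz₁
        (isUnit_iff_det_ne_zero.1 htz₁) (hLO hdL),
        eventually_ne_zero hO hpreO (DifferentiableOn.matrix_det hXO) hz₁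
        (isUnit_iff_det_ne_zero.1 hXz₁) (hLO hdL)] with z h1 h2
      rw [isUnit_iff_det_ne_zero, hv_def, Matrix.det_mul, Matrix.det_adjugate]
      exact mul_ne_zero h1 (pow_ne_zero _ h2))
    (show 0 < ε / 2 / (|C| + 1) by positivity)
  have hwA : ∀ z ∈ (Ω \ F) \ (E ∪ Z), Commute (w z) (A z) := fun z hz => (hwu z hz).2 A (by
    filter_upwards [hO.mem_nhds hz.1] with x hx
    exact ⟨hA.continuousOn.continuousAt (hΩ.mem_nhds hx.1), hvA x hx⟩)
  choose! ρ hρ q hqd hqu hqw using hq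
  let h' : ℂ → Matrix (Fin n) (Fin n) ℂ :=
    fun z => if z ∈ Z then (X z).det⁻¹ • (q z z * X z) else w z * g z
  have hh'Z : ∀ z ∉ Z, h' z = w z * g z := fun z hz => if_neg hz
  have hXZ : ∀ z ∈ Z, IsUnit (X z) := fun z hz =>
    (htL z ((hmemZ z).1 hz).1 ((hmemZ z).1 hz).2).1
  have hO' : IsOpen ((Ω \ F) \ (E ∪ Z)) := hO.sdiff (hE.isClosed.union Z.finite_toSet.isClosed)
  have hOE : IsOpen (Ω \ (F ∪ E)) := hΩ.sdiff (hF.union hE).isClosed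
  have hint : ∀ z ∈ (Ω \ F) \ (E ∪ Z), A z * h' z = h' z * B z := fun z hz => by
    rw [hh'Z z fun h => hz.2 (.inr h), ← mul_assoc, ← (hwA z hz).eq, mul_assoc, hg.2 z hz.1,
      mul_assoc]
  have hdiff : DifferentiableOn ℂ h' (Ω \ (F ∪ E)) := fun z hz => by
    refine DifferentiableAt.differentiableWithinAt ?_
    by_cases hzZ : z ∈ Z
    · have hloc' : DifferentiableAt ℂ (fun x => (X x).det⁻¹ • (q z x * X x)) z := by
        have hXd := hX.1.differentiableAt (hΩ.mem_nhds hz.1)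
        exact (((DifferentiableOn.matrix_det hX.1).differentiableAt (hΩ.mem_nhds hz.1)).inv
          (isUnit_iff_det_ne_zero.1 (hXZ z hzZ))).smul
          (((hqd z hzZ).differentiableAt (ball_mem_nhds z (hρ z hzZ))).mul hXd)
      refine hloc'.congr_of_eventuallyEq ?_
      have hZz : IsOpen ((Z.erase z : Finset ℂ) : Set ℂ)ᶜ :=
        (Z.erase z).finite_toSet.isClosed.isOpen_compl
      filter_upwards [ball_mem_nhds z (hρ z hzZ), hZz.mem_nhds (by simp),
        ((DifferentiableOn.matrix_det hX.1).continuousOn.continuousAt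
          (hΩ.mem_nhds hz.1)).eventually_ne (isUnit_iff_det_ne_zero.1 (hXZ z hzZ))] with x h1 h2 h3
      by_cases hxz : x = z
      · subst hxz
        exact if_pos hzZ
      · have hxZ : x ∉ Z := fun h => h2 (Finset.mem_coe.2 (Finset.mem_erase.2 ⟨hxz, h⟩))
        rw [hh'Z x hxZ, hqw z hzZ x h1 hxz]
        simp only [hv_def, mul_assoc, Matrix.adjugate_mul, mul_smul_comm, mul_one, smul_smul]
        rw [inv_mul_cancel₀ h3, one_smul]
    · have hz' : z ∈ (Ω \ F) \ (E ∪ Z) := ⟨⟨hz.1, fun h => hz.2 (.inl h)⟩,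
        fun h => h.elim (fun h => hz.2 (.inr h)) hzZ⟩
      refine ((hw.differentiableAt (hO'.mem_nhds hz')).mul
        (hg.1.differentiableAt (hO.mem_nhds hz'.1))).congr_of_eventuallyEq ?_
      filter_upwards [hO'.mem_nhds hz'] with x hx
      exact hh'Z x fun h => hx.2 (.inr h)
  refine ⟨F ∪ E, hF.union hE, disjoint_union_left.2 ⟨hFL, hEL⟩, h', ⟨hdiff, fun z hz => ?_⟩,
    fun z hz => ?_, fun z hz => ?_⟩
  · have hc := hdiff.continuousOn.continuousAt (hOE.mem_nhds hz)
    refine eq_of_eventuallyEq_punctured (f := fun z => A z * h' z) (g := fun z => h' z * B z)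
      ((hA.continuousOn.continuousAt (hΩ.mem_nhds hz.1)).mul hc)
      (hc.mul (hB.continuousOn.continuousAt (hΩ.mem_nhds hz.1))) ?_
    have hZz : IsOpen ((Z.erase z : Finset ℂ) : Set ℂ)ᶜ :=
      (Z.erase z).finite_toSet.isClosed.isOpen_compl
    filter_upwards [mem_nhdsWithin_of_mem_nhds (hOE.mem_nhds hz),
      mem_nhdsWithin_of_mem_nhds (hZz.mem_nhds (by simp)), self_mem_nhdsWithin] with x h1 h2 h3
    exact hint x ⟨⟨h1.1, fun h => h1.2 (.inl h)⟩, fun h => h.elim (fun h => h1.2 (.inr h))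
      fun h => h2 (Finset.mem_coe.2 (Finset.mem_erase.2 ⟨h3, h⟩))⟩
  · by_cases hzZ : z ∈ Z
    · have hX0 := isUnit_iff_det_ne_zero.1 (hXZ z hzZ)
      have : h' z = algebraMap ℂ _ (X z).det⁻¹ * (q z z * X z) := by
        rw [← Algebra.smul_def]; exact if_pos hzZ
      rw [this]
      exact ((isUnit_iff_ne_zero.2 (inv_ne_zero hX0)).map (algebraMap ℂ _)).mul
        ((hqu z hzZ).mul (hXZ z hzZ))
    · rw [hh'Z z hzZ]
      have hzE : z ∉ E := fun h => hEL.notMem_of_mem_left h hz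
      refine (hwu z ⟨hLO hz, fun h => h.elim hzE hzZ⟩).1.mul (by_contra fun h => hzZ ?_)
      exact (hmemZ z).2 ⟨hz, h⟩
  · have hzZ : z ∉ Z := fun h => ((hmemZ z).1 h).2 (htK z hz).1
    have h1 : ‖h' z - g z‖ ≤ ε / 2 := by
      rw [hh'Z z hzZ, ← sub_one_mul]
      refine (norm_mul_le _ _).trans ((mul_le_mul (hwK z hz) (hC z hz) (norm_nonneg _)
        (by positivity)).trans ?_)
      rw [div_mul_eq_mul_div, div_le_iff₀ (by positivity)]
      exact mul_le_mul_of_nonneg_left (by linarith [le_abs_self C]) (by positivity)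
    have h2 : ‖g z - h z‖ ≤ ε / 2 := by
      simpa only [hg_def, add_sub_cancel_left] using (htK z hz).2
    linarith [norm_sub_le_norm_sub_add_norm_sub (h' z) (g z) (h z)]

lemma exists_step {Ω F : Set ℂ} (hΩ : IsOpen Ω) (hpre : IsPreconnected Ω) (hne : Ω.Nonempty)
    {A B : ℂ → Matrix (Fin n) (Fin n) ℂ} (hA : DifferentiableOn ℂ A Ω)
    (hB : DifferentiableOn ℂ B Ω)
    (hloc : ∀ d ∈ Ω, ∃ U, IsOpen U ∧ d ∈ U ∧ ∃ H, Intertwines A B H U ∧ ∀ z ∈ U, IsUnit (H z))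
    {m : ℕ} (hF : F.Finite) (hFK : Disjoint (exhaust Ω m) F)
    {h : ℂ → Matrix (Fin n) (Fin n) ℂ} (hh : Intertwines A B h (Ω \ F))
    (hKu : ∀ z ∈ exhaust Ω m, IsUnit (h z)) {ε : ℝ} (hε : 0 < ε) :
    ∃ F' : Set ℂ, F'.Finite ∧ Disjoint (exhaust Ω (m + 1)) F' ∧ ∃ h', Intertwines A B h' (Ω \ F') ∧
      (∀ z ∈ exhaust Ω (m + 1), IsUnit (h' z)) ∧ ∀ z ∈ exhaust Ω m, ‖h' z - h z‖ ≤ ε := by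
  have hL := isCompact_exhaust Ω (m + 1)
  have hLΩ := exhaust_subset Ω (m + 1)
  have hKL := exhaust_mono Ω m.le_succ
  rcases (exhaust Ω m).eq_empty_or_nonempty with hK | ⟨z₁, hz₁⟩
  · obtain ⟨z₁, hz₁⟩ := hne
    obtain ⟨X, hX, hXu⟩ := exists_global_section_isUnit hΩ hpre hA hB hloc {z₁} (by simpa using hz₁)
    obtain ⟨F', hF', hF'L, h', hh', hu, -⟩ := exists_isUnit_extension (m := m) hΩ hpre hA hB hloc hL
      hLΩ hKL finite_empty (empty_disjoint _) (hX.mono sdiff_subset) (by simp [hK])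
      (z₁ := z₁) ⟨hz₁, notMem_empty _⟩ (hXu z₁ (Finset.mem_singleton_self _)) hε
    exact ⟨F', hF', hF'L.symm, h', hh', hu, by simp [hK]⟩
  · have hKO : exhaust Ω m ⊆ Ω \ F := subset_sdiff.2 ⟨exhaust_subset Ω m, hFK⟩
    obtain ⟨δ, hδ, hδu⟩ := exists_isUnit_radius (isCompact_exhaust Ω m)
      (hh.1.continuousOn.mono hKO) hKu
    obtain ⟨F₁, hF₁, hFL₁, h₁, hh₁, hhK₁⟩ := exists_push hΩ hpre hA hB hL hLΩ hKL hF hFK hh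
      (show 0 < min δ (ε / 2) by positivity)
    have hu₁ : ∀ z ∈ exhaust Ω m, IsUnit (h₁ z) := fun z hz =>
      hδu z hz _ ((hhK₁ z hz).trans (min_le_left _ _))
    obtain ⟨F', hF', hF'L, h', hh', hu, hK⟩ := exists_isUnit_extension (m := m) hΩ hpre hA hB hloc hL
      hLΩ hKL hF₁ hFL₁ hh₁ hu₁ (z₁ := z₁) ⟨exhaust_subset Ω m hz₁,
      fun h => hFL₁.notMem_of_mem_left h (hKL hz₁)⟩ (hu₁ z₁ hz₁) (half_pos hε)
    refine ⟨F', hF', hF'L.symm, h', hh', hu, fun z hz => ?_⟩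
    linarith [norm_sub_le_norm_sub_add_norm_sub (h' z) (h₁ z) (h z), hK z hz,
      (hhK₁ z hz).trans (min_le_right _ _)]

end Extend

section UniformLimit
variable {E : Type*} [NormedAddCommGroup E] [NormedSpace ℂ E]

lemma differentiableOn_of_norm_sub_le [FiniteDimensional ℂ E] {U : Set ℂ} (hU : IsOpen U)
    {f : ℕ → ℂ → E} {g : ℂ → E} {η : ℕ → ℝ} (hη : Tendsto η atTop (𝓝 0))
    (h : ∀ᶠ k in atTop, DifferentiableOn ℂ (f k) U ∧ ∀ x ∈ U, ‖g x - f k x‖ ≤ η k) :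
    DifferentiableOn ℂ g U := by
  have : CompleteSpace E := FiniteDimensional.complete ℂ E
  have hu : TendstoUniformlyOn f g atTop U := by
    rw [Metric.tendstoUniformlyOn_iff]
    intro ε hε
    filter_upwards [h, hη.eventually_lt_const hε] with k hk hkε x hx
    rw [dist_eq_norm]
    exact (hk.2 x hx).trans_lt hkε
  exact hu.tendstoLocallyUniformlyOn.differentiableOn (h.mono fun _ hk => hk.1) hU

end UniformLimit

section Limit
open scoped Matrix.Norms.Operator
variable {n : ℕ}

lemma exists_approximating_sequence {Ω : Set ℂ} (hΩ : IsOpen Ω) (hpre : IsPreconnected Ω)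
    (hne : Ω.Nonempty) {A B : ℂ → Matrix (Fin n) (Fin n) ℂ} (hA : DifferentiableOn ℂ A Ω)
    (hB : DifferentiableOn ℂ B Ω)
    (hloc : ∀ d ∈ Ω, ∃ U, IsOpen U ∧ d ∈ U ∧ ∃ H, Intertwines A B H U ∧ ∀ z ∈ U, IsUnit (H z)) :
    ∃ (h : ℕ → ℂ → Matrix (Fin n) (Fin n) ℂ) (F : ℕ → Set ℂ) (η : ℕ → ℝ),
      (∀ m, Disjoint (exhaust Ω m) (F m) ∧ Intertwines A B (h m) (Ω \ F m) ∧ 0 < η m ∧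
        ∀ z ∈ exhaust Ω m, ∀ M, ‖M - h m z‖ ≤ η m → IsUnit M) ∧
      ∀ m, η (m + 1) ≤ η m / 2 ∧ ∀ z ∈ exhaust Ω m, ‖h (m + 1) z - h m z‖ ≤ η m / 4 := by
  let Good : ℕ → (ℂ → Matrix (Fin n) (Fin n) ℂ) × Set ℂ × ℝ → Prop := fun m s =>
    s.2.1.Finite ∧ Disjoint (exhaust Ω m) s.2.1 ∧ Intertwines A B s.1 (Ω \ s.2.1) ∧ 0 < s.2.2 ∧
      ∀ z ∈ exhaust Ω m, ∀ M, ‖M - s.1 z‖ ≤ s.2.2 → IsUnit M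
  have hstep : ∀ m s, Good m s → ∃ s', Good (m + 1) s' ∧ s'.2.2 ≤ s.2.2 / 2 ∧
      ∀ z ∈ exhaust Ω m, ‖s'.1 z - s.1 z‖ ≤ s.2.2 / 4 := by
    rintro m ⟨h, F, η⟩ ⟨hF, hKF, hh, hη, hu⟩
    have hη : 0 < η := hη
    obtain ⟨F', hF', hKF', h', hh', hu', hK⟩ := exists_step hΩ hpre hne hA hB hloc hF hKF hh
      (fun z hz => hu z hz (h z) (by simpa using hη.le)) (show 0 < η / 4 by positivity)
    obtain ⟨δ, hδ, hδu⟩ := exists_isUnit_radius (isCompact_exhaust Ω (m + 1))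
      (hh'.1.continuousOn.mono (subset_sdiff.2 ⟨exhaust_subset Ω (m + 1), hKF'⟩)) hu'
    exact ⟨⟨h', F', min δ (η / 2)⟩, ⟨hF', hKF', hh', by positivity,
      fun z hz M hM => hδu z hz M (hM.trans (min_le_left _ _))⟩, min_le_right _ _, hK⟩
  choose! next hnext using hstep
  let s : ℕ → (ℂ → Matrix (Fin n) (Fin n) ℂ) × Set ℂ × ℝ :=
    fun m => Nat.rec (fun _ => 0, ∅, 1) (fun m s => next m s) m
  have hs : ∀ m, Good m (s m) := fun m => by
    induction m with
    | zero =>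
      refine ⟨finite_empty, disjoint_empty _, ⟨differentiableOn_const _, fun z _ => ?_⟩,
        one_pos, fun z hz => ?_⟩
      · simp [s]
      · rw [exhaust_zero] at hz
        exact hz.elim
    | succ m ih => exact (hnext m _ ih).1
  exact ⟨fun m => (s m).1, fun m => (s m).2.1, fun m => (s m).2.2, fun m => (hs m).2,
    fun m => (hnext m _ (hs m)).2⟩

lemma exists_isUnit_intertwiner {Ω : Set ℂ} (hΩ : IsOpen Ω) (hpre : IsPreconnected Ω)
    (hne : Ω.Nonempty) {A B : ℂ → Matrix (Fin n) (Fin n) ℂ} (hA : DifferentiableOn ℂ A Ω)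
    (hB : DifferentiableOn ℂ B Ω)
    (hloc : ∀ d ∈ Ω, ∃ U, IsOpen U ∧ d ∈ U ∧ ∃ H, Intertwines A B H U ∧ ∀ z ∈ U, IsUnit (H z)) :
    ∃ H, Intertwines A B H Ω ∧ ∀ z ∈ Ω, IsUnit (H z) := by
  obtain ⟨h, F, η, hh, hs⟩ := exists_approximating_sequence hΩ hpre hne hA hB hloc
  have : CompleteSpace (Matrix (Fin n) (Fin n) ℂ) := FiniteDimensional.complete ℂ _
  have hdist : ∀ m k j, m ≤ k → k ≤ j → ∀ z ∈ exhaust Ω m,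
      ‖h j z - h k z‖ ≤ η k / 2 - η j / 2 := by
    intro m k j hmk hkj z hz
    induction j, hkj using Nat.le_induction with
    | base => simp
    | succ j hkj ih =>
      have h1 := (hs j).2 z (exhaust_mono Ω (hmk.trans hkj) hz)
      linarith [norm_sub_le_norm_sub_add_norm_sub (h (j + 1) z) (h j z) (h k z), (hs j).1]
  have hη : Tendsto (fun k => η k / 2) atTop (𝓝 0) := by
    have hle : ∀ k, η k / 2 ≤ η 0 / 2 * (1 / 2) ^ k := fun k => by
      induction k with
      | zero => simp
      | succ k ih => rw [pow_succ]; linarith [(hs k).1]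
    refine squeeze_zero (fun k => (half_pos (hh k).2.2.1).le) hle ?_
    simpa using (tendsto_pow_atTop_nhds_zero_of_lt_one (r := (1 / 2 : ℝ)) (by norm_num)
      (by norm_num)).const_mul (η 0 / 2)
  have hexh : ∀ z ∈ Ω, ∃ m, z ∈ exhaust Ω m := fun z hz => by
    obtain ⟨m, r, hr, hzm⟩ := exists_ball_subset_exhaust hΩ hz
    exact ⟨m, hzm (mem_ball_self hr)⟩
  have hlim : ∀ z ∈ Ω, ∃ l, Tendsto (fun k => h k z) atTop (𝓝 l) := fun z hz => by
    obtain ⟨m, hzm⟩ := hexh z hz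
    have hc : CauchySeq fun k => h (k + m) z :=
      cauchySeq_of_le_tendsto_0' (fun k => η (k + m) / 2) (fun k j hkj => by
        rw [dist_comm, dist_eq_norm]
        linarith [hdist m (k + m) (j + m) (by lia) (by lia) z hzm, (hh (j + m)).2.2.1])
        (hη.comp (tendsto_add_atTop_nat m))
    obtain ⟨l, hl⟩ := cauchySeq_tendsto_of_complete hc
    exact ⟨l, (tendsto_add_atTop_iff_nat m).1 hl⟩
  choose! H hH using hlim
  have hHk : ∀ m k, m ≤ k → ∀ z ∈ exhaust Ω m, ‖H z - h k z‖ ≤ η k / 2 := by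
    intro m k hmk z hz
    refine le_of_tendsto (((hH z (exhaust_subset Ω m hz)).sub_const _).norm) ?_
    filter_upwards [eventually_ge_atTop k] with j hj
    linarith [hdist m k j hmk hj z hz, (hh j).2.2.1]
  refine ⟨H, ⟨fun z hz => ?_, fun z hz => ?_⟩, fun z hz => ?_⟩
  · obtain ⟨m, r, hr, hzm⟩ := exists_ball_subset_exhaust hΩ hz
    refine ((differentiableOn_of_norm_sub_le (f := h) isOpen_ball hη ?_).differentiableAt
      (ball_mem_nhds z hr)).differentiableWithinAt
    filter_upwards [eventually_ge_atTop m] with k hk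
    refine ⟨?_, fun x hx => hHk m k hk x (hzm hx)⟩
    refine (hh k).2.1.1.mono fun x hx => ?_
    have hxk := exhaust_mono Ω hk (hzm hx)
    exact ⟨exhaust_subset Ω k hxk, (hh k).1.notMem_of_mem_left hxk⟩
  · obtain ⟨m, hzm⟩ := hexh z hz
    refine tendsto_nhds_unique_of_eventuallyEq ((hH z hz).const_mul (A z))
      ((hH z hz).mul_const (B z)) ?_
    filter_upwards [eventually_ge_atTop m] with k hk
    exact (hh k).2.1.2 z ⟨hz, (hh k).1.notMem_of_mem_left (exhaust_mono Ω hk hzm)⟩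
  · obtain ⟨m, hzm⟩ := hexh z hz
    exact (hh m).2.2.2 z hzm _ ((hHk m m le_rfl z hzm).trans (by linarith [(hh m).2.2.1]))

end Limit

end PlanarSimilarity

/-- Guralnick's theorem on a planar domain: locally holomorphically similar
holomorphic matrices are globally holomorphically similar. -/
theorem guralnick_planar_domain (n : ℕ) (Ω : Set ℂ) (hΩopen : IsOpen Ω)
    (hΩconn : IsConnected Ω)
    (A B : ℂ → Matrix (Fin n) (Fin n) ℂ)
    (hA : MatHoloOn A Ω) (hB : MatHoloOn B Ω)
    (hloc : ∀ ξ ∈ Ω, ∃ U : Set ℂ, IsOpen U ∧ ξ ∈ U ∧ U ⊆ Ω ∧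
      ∃ H : ℂ → Matrix (Fin n) (Fin n) ℂ, MatHoloOn H U ∧
        ∀ ζ ∈ U, IsUnit (H ζ) ∧ B ζ = (H ζ)⁻¹ * A ζ * H ζ) :
    ∃ H : ℂ → Matrix (Fin n) (Fin n) ℂ, MatHoloOn H Ω ∧
      ∀ ζ ∈ Ω, IsUnit (H ζ) ∧ B ζ = (H ζ)⁻¹ * A ζ * H ζ := by
  open PlanarSimilarity in
  open scoped Matrix.Norms.Operator in
  obtain ⟨H, hH, hu⟩ := exists_isUnit_intertwiner hΩopen hΩconn.isPreconnected hΩconn.nonempty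
    (differentiableOn_iff_entries.2 hA) (differentiableOn_iff_entries.2 hB) (fun d hd => by
      obtain ⟨U, hU, hdU, -, H, hH, hHu⟩ := hloc d hd
      refine ⟨U, hU, hdU, H, ⟨differentiableOn_iff_entries.2 hH, fun z hz => ?_⟩,
        fun z hz => (hHu z hz).1⟩
      obtain ⟨hz1, hz2⟩ := hHu z hz
      rw [hz2, ← mul_assoc, ← mul_assoc,
        Matrix.mul_nonsing_inv _ ((Matrix.isUnit_iff_isUnit_det _).1 hz1), one_mul])
  refine ⟨H, PlanarSimilarity.differentiableOn_iff_entries.1 hH.1, fun z hz => ⟨hu z hz, ?_⟩⟩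
  rw [mul_assoc, hH.2 z hz,
    Matrix.nonsing_inv_mul_cancel_left _ _ ((Matrix.isUnit_iff_isUnit_det _).1 (hu z hz))]
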